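/- arXiv:math/0509601 — 15 statements merged into one kernel-verified Lean document; each statement's English description precedes it below -/
import Mathlib

section
/- Let U be a subspace of V. Then (i) U is isotropic if and only if J_z(U) ⊆ U^⊥ for every z ∈ ℝ^m; and (ii) an isotropic subspace U is maximal isotropic if and only if U^⊥ = J_{e_1}(U) + J_{e_2}(U) + ⋯ + J_{e_m}(U) (the span of the images of U under the operators J_{e_i}), equivalently V = U ⊕ (J_{e_1}(U) + ⋯ + J_{e_m}(U)). -/
open RealInnerProductSpace

/-- The standard orthonormal basis vector `e_i` of `ℝ^m`. -/
noncomputable def stdBasis (m : ℕ) (i : Fin m) : EuclideanSpace ℝ (Fin m) :=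
  EuclideanSpace.single i (1 : ℝ)

/-- A subspace `U` is isotropic for the bracket `bra` if the bracket vanishes on `U × U`. -/
def IsotropicSub {V : Type*} [AddCommGroup V] [Module ℝ V] {Z : Type*} [Zero Z]
    (bra : V → V → Z) (U : Submodule ℝ V) : Prop :=
  ∀ u ∈ U, ∀ w ∈ U, bra u w = 0

/-- A subspace is maximal isotropic if it is isotropic and not strictly contained in any
isotropic subspace. -/
def MaxIsotropicSub {V : Type*} [AddCommGroup V] [Module ℝ V] {Z : Type*} [Zero Z]
    (bra : V → V → Z) (U : Submodule ℝ V) : Prop :=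
  IsotropicSub bra U ∧
    ∀ U' : Submodule ℝ V, IsotropicSub bra U' → U ≤ U' → U' = U

theorem stmt_0 {V : Type*} [NormedAddCommGroup V] [InnerProductSpace ℝ V]
    [FiniteDimensional ℝ V] {m : ℕ} (hm : 1 ≤ m)
    (J : EuclideanSpace ℝ (Fin m) →ₗ[ℝ] V →ₗ[ℝ] V)
    (hskew : ∀ (z : EuclideanSpace ℝ (Fin m)) (u w : V), ⟪J z u, w⟫ = -⟪u, J z w⟫)
    (hsq : ∀ (z : EuclideanSpace ℝ (Fin m)) (u : V), J z (J z u) = -(‖z‖ ^ 2) • u)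
    (bra : V → V → EuclideanSpace ℝ (Fin m))
    (hbra : ∀ (z : EuclideanSpace ℝ (Fin m)) (u w : V), ⟪z, bra u w⟫ = ⟪J z u, w⟫)
    (U : Submodule ℝ V) :
    (IsotropicSub bra U ↔
      ∀ (z : EuclideanSpace ℝ (Fin m)), ∀ u ∈ U, J z u ∈ Uᗮ) ∧
    (IsotropicSub bra U →
      ((MaxIsotropicSub bra U ↔
          Uᗮ = ⨆ i : Fin m, U.map (J (stdBasis m i))) ∧
        (MaxIsotropicSub bra U ↔
          IsCompl U (⨆ i : Fin m, U.map (J (stdBasis m i)))))) := by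
  have hz : ∀ u w, bra u w = 0 ↔ ∀ z, ⟪J z u, w⟫ = 0 := by
    intro u w
    constructor
    · intro h z
      rw [← hbra, h, inner_zero_right]
    · intro h
      have := hbra (bra u w) u w
      rw [h] at this
      exact inner_self_eq_zero.mp this
  have hself : ∀ x, bra x x = 0 := by
    intro x
    rw [hz]
    intro z
    have h := hskew z x x
    rw [real_inner_comm] at h
    rw [real_inner_comm]
    linarith
  have hsymm : ∀ u w, bra u w = 0 → bra w u = 0 := by
    intro u w h
    rw [hz] at h ⊢
    intro z
    rw [hskew, real_inner_comm, h z, neg_zero]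
  have hperp : ∀ x, x ∈ (⨆ i : Fin m, U.map (J (stdBasis m i)))ᗮ ↔ ∀ u ∈ U, bra u x = 0 := by
    intro x
    rw [← Submodule.iInf_orthogonal, Submodule.mem_iInf]
    constructor
    · intro h u hu
      ext i
      have h1 := (Submodule.mem_orthogonal _ _).1 (h i) _ (Submodule.mem_map_of_mem hu)
      rw [← hbra] at h1
      simpa [stdBasis, EuclideanSpace.inner_single_left] using h1
    · intro h i
      rw [Submodule.mem_orthogonal]
      rintro _ ⟨u, hu, rfl⟩
      exact (hz u x).1 (h u hu) _
  have hi : IsotropicSub bra U ↔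
      ∀ (z : EuclideanSpace ℝ (Fin m)), ∀ u ∈ U, J z u ∈ Uᗮ := by
    constructor
    · intro h z u hu
      rw [Submodule.mem_orthogonal']
      intro w hw
      exact (hz u w).1 (h u hu w hw) z
    · intro h u hu w hw
      rw [hz]
      intro z
      exact (Submodule.mem_orthogonal' _ _).1 (h z u hu) w hw
  refine ⟨hi, fun hU => ?_⟩
  have hle : (⨆ i : Fin m, U.map (J (stdBasis m i))) ≤ Uᗮ := by
    refine iSup_le fun i => ?_
    rintro _ ⟨u, hu, rfl⟩
    exact hi.1 hU _ u hu
  have hmain : MaxIsotropicSub bra U ↔ Uᗮ = ⨆ i : Fin m, U.map (J (stdBasis m i)) := by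
    constructor
    · rintro ⟨-, hmax⟩
      refine le_antisymm ?_ hle
      have key : (⨆ i : Fin m, U.map (J (stdBasis m i)))ᗮ ≤ U := by
        intro x hx
        rw [hperp] at hx
        have hiso : IsotropicSub bra (U ⊔ Submodule.span ℝ {x}) := by
          intro a ha b hb
          obtain ⟨u, hu, p, hp, rfl⟩ := Submodule.mem_sup.1 ha
          obtain ⟨w, hw, q, hq, rfl⟩ := Submodule.mem_sup.1 hb
          obtain ⟨s, rfl⟩ := Submodule.mem_span_singleton.1 hp
          obtain ⟨t, rfl⟩ := Submodule.mem_span_singleton.1 hq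
          rw [hz]
          intro z
          have h1 := (hz _ _).1 (hU u hu w hw) z
          have h2 := (hz _ _).1 (hx u hu) z
          have h3 := (hz _ _).1 (hsymm _ _ (hx w hw)) z
          have h4 := (hz _ _).1 (hself x) z
          simp [inner_add_left, inner_add_right, inner_smul_left, inner_smul_right, h1, h2, h3, h4]
        rw [← hmax _ hiso le_sup_left]
        exact Submodule.mem_sup_right (Submodule.mem_span_singleton_self x)
      have := Submodule.orthogonal_le key
      rwa [Submodule.orthogonal_orthogonal] at this
    · intro h
      refine ⟨hU, fun U' hU' hUU' => le_antisymm (fun x hx => ?_) hUU'⟩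
      rw [← Submodule.orthogonal_orthogonal U, h, hperp]
      exact fun u hu => hU' u (hUU' hu) x hx
  refine ⟨hmain, hmain.trans ⟨fun h => ?_, fun h => ?_⟩⟩
  · rw [← h]
    exact Submodule.isCompl_orthogonal_of_hasOrthogonalProjection
  · refine le_antisymm ?_ hle
    intro x hx
    have hxt : x ∈ U ⊔ ⨆ i : Fin m, U.map (J (stdBasis m i)) := by
      rw [h.sup_eq_top]
      trivial
    obtain ⟨u, hu, w, hw, rfl⟩ := Submodule.mem_sup.1 hxt
    have hu2 : u ∈ Uᗮ := by
      have := Submodule.sub_mem _ hx (hle hw)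
      simpa using this
    have hu0 : u = 0 := inner_self_eq_zero.mp ((Submodule.mem_orthogonal _ _).1 hu2 u hu)
    rw [hu0, zero_add]
    exact hw
end

section
/- Let n = dim V. If U ⊆ V is a maximal isotropic subspace, then n ≤ (m+1)·dim U and 2·dim U ≤ n; that is, n/(m+1) ≤ dim U ≤ n/2. -/
open RealInnerProductSpace

theorem stmt_1 {V : Type*} [NormedAddCommGroup V] [InnerProductSpace ℝ V]
    [FiniteDimensional ℝ V] {m : ℕ} (hm : 1 ≤ m)
    (J : EuclideanSpace ℝ (Fin m) →ₗ[ℝ] V →ₗ[ℝ] V)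
    (hskew : ∀ (z : EuclideanSpace ℝ (Fin m)) (u w : V), ⟪J z u, w⟫ = -⟪u, J z w⟫)
    (hsq : ∀ (z : EuclideanSpace ℝ (Fin m)) (u : V), J z (J z u) = -(‖z‖ ^ 2) • u)
    (bra : V → V → EuclideanSpace ℝ (Fin m))
    (hbra : ∀ (z : EuclideanSpace ℝ (Fin m)) (u w : V), ⟪z, bra u w⟫ = ⟪J z u, w⟫)
    [Nontrivial V]
    (U : Submodule ℝ V) (hU : MaxIsotropicSub bra U) :
    Module.finrank ℝ V ≤ (m + 1) * Module.finrank ℝ U ∧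
      2 * Module.finrank ℝ U ≤ Module.finrank ℝ V := by
  obtain ⟨hiso, hmax⟩ := hU
  have hbasis : ∀ u w : V, (∀ i : Fin m, ⟪J (EuclideanSpace.single i (1 : ℝ)) u, w⟫ = 0) →
      bra u w = 0 := by
    intro u w h
    ext i
    have h1 := hbra (EuclideanSpace.single i (1 : ℝ)) u w
    rw [h i, EuclideanSpace.inner_single_left] at h1
    simpa using h1
  have hzero : ∀ u w : V, bra u w = 0 → ∀ z, ⟪J z u, w⟫ = 0 := by
    intro u w h z
    rw [← hbra, h, inner_zero_right]
  have hself : ∀ (z : EuclideanSpace ℝ (Fin m)) (v : V), ⟪J z v, v⟫ = 0 := by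
    intro z v
    have h1 := hskew z v v
    rw [real_inner_comm] at h1
    have h2 := real_inner_comm v (J z v)
    linarith
  constructor
  · let T : (Fin m → U) →ₗ[ℝ] V :=
      ∑ i : Fin m, (J (EuclideanSpace.single i (1 : ℝ))).comp
        (U.subtype.comp (LinearMap.proj i))
    have hT : ∀ f, T f = ∑ i : Fin m, J (EuclideanSpace.single i (1 : ℝ)) (f i : V) := by
      intro f
      simp [T]
    have hW : (LinearMap.range T)ᗮ ≤ U := by
      intro v hv
      have hv1 : ∀ u ∈ U, ∀ z, ⟪J z u, v⟫ = 0 := by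
        intro u hu
        apply hzero
        apply hbasis
        intro i
        have h1 := (Submodule.mem_orthogonal _ _).1 hv (T (Pi.single i ⟨u, hu⟩)) ⟨_, rfl⟩
        rw [hT, Finset.sum_eq_single i] at h1
        · simpa using h1
        · intro j _ hj
          simp [Pi.single_eq_of_ne hj]
        · simp
      have hv2 : ∀ u ∈ U, ∀ z, ⟪J z v, u⟫ = 0 := by
        intro u hu z
        rw [hskew, real_inner_comm, hv1 u hu z, neg_zero]
      have h3 : IsotropicSub bra (U ⊔ Submodule.span ℝ {v}) := by
        intro a ha b hb
        obtain ⟨a1, ha1, a2, ha2, rfl⟩ := Submodule.mem_sup.1 ha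
        obtain ⟨b1, hb1, b2, hb2, rfl⟩ := Submodule.mem_sup.1 hb
        obtain ⟨s, rfl⟩ := Submodule.mem_span_singleton.1 ha2
        obtain ⟨t, rfl⟩ := Submodule.mem_span_singleton.1 hb2
        apply hbasis
        intro i
        simp only [map_add, map_smul, inner_add_left, inner_add_right, inner_smul_left,
          inner_smul_right, hself, hv1 a1 ha1, hv2 b1 hb1, hzero _ _ (hiso a1 ha1 b1 hb1)]
        simp
      rw [← hmax _ h3 le_sup_left]
      exact Submodule.mem_sup_right (Submodule.mem_span_singleton_self v)
    have h1 := Submodule.finrank_add_finrank_orthogonal (LinearMap.range T)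
    have h2 := Submodule.finrank_mono hW
    have h3 := LinearMap.finrank_range_le T
    rw [Module.finrank_pi_fintype] at h3
    simp only [Finset.sum_const, Finset.card_univ, Fintype.card_fin, smul_eq_mul] at h3
    rw [add_mul, one_mul]
    omega
  · let e : EuclideanSpace ℝ (Fin m) := EuclideanSpace.single ⟨0, hm⟩ (1 : ℝ)
    have he : ‖e‖ = 1 := by simp [e]
    have hinj : Function.Injective (J e) := by
      intro a b hab
      have h1 := congrArg (J e) hab
      rw [hsq, hsq, he] at h1
      simpa using h1
    have hle : U.map (J e) ≤ Uᗮ := by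
      rintro _ ⟨u, hu, rfl⟩
      rw [Submodule.mem_orthogonal]
      intro w hw
      rw [real_inner_comm]
      exact hzero _ _ (hiso u hu w hw) e
    have h1 := Submodule.finrank_add_finrank_orthogonal U
    have h2 := Submodule.finrank_mono hle
    have h3 := (Submodule.equivMapOfInjective (J e) hinj U).finrank_eq
    omega
end

section
/- If dim V = m + 1, then for every nonzero u ∈ V the line ℝ·u is a maximal isotropic subspace of V. (Hence in the H-type groups with dim 𝔳 = m+1, all maximal horizontal subgroups are one-dimensional.) -/
open RealInnerProductSpace

theorem stmt_5 {V : Type*} [NormedAddCommGroup V] [InnerProductSpace ℝ V]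
    [FiniteDimensional ℝ V] {m : ℕ} (hm : 1 ≤ m)
    (J : EuclideanSpace ℝ (Fin m) →ₗ[ℝ] V →ₗ[ℝ] V)
    (hskew : ∀ (z : EuclideanSpace ℝ (Fin m)) (u w : V), ⟪J z u, w⟫ = -⟪u, J z w⟫)
    (hsq : ∀ (z : EuclideanSpace ℝ (Fin m)) (u : V), J z (J z u) = -(‖z‖ ^ 2) • u)
    (bra : V → V → EuclideanSpace ℝ (Fin m))
    (hbra : ∀ (z : EuclideanSpace ℝ (Fin m)) (u w : V), ⟪z, bra u w⟫ = ⟪J z u, w⟫)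
    (hdim : Module.finrank ℝ V = m + 1) (u : V) (hu : u ≠ 0) :
    MaxIsotropicSub bra (Submodule.span ℝ {u}) := by
  have hself : ∀ z, ⟪J z u, u⟫ = 0 := by
    intro z
    have h := hskew z u u
    have h' := real_inner_comm (J z u) u
    linarith
  have hL : Function.Injective (J.flip u) := by
    rw [injective_iff_map_eq_zero]
    intro z hz
    have hz' : J z u = 0 := hz
    have h := hsq z u
    rw [hz', map_zero] at h
    have h2 := (smul_eq_zero.mp h.symm).resolve_right hu
    simpa using h2
  have hrank : Module.finrank ℝ (LinearMap.range (J.flip u)) = m := by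
    rw [LinearMap.finrank_range_of_inj hL]
    simp
  have hperp : Submodule.span ℝ {u} = (LinearMap.range (J.flip u))ᗮ := by
    apply Submodule.eq_of_le_of_finrank_eq
    · rw [Submodule.span_singleton_le_iff_mem, Submodule.mem_orthogonal]
      rintro _ ⟨z, rfl⟩
      exact hself z
    · have h := Submodule.finrank_add_finrank_orthogonal (LinearMap.range (J.flip u))
      rw [finrank_span_singleton hu]
      omega
  refine ⟨?_, ?_⟩
  · intro a ha b hb
    obtain ⟨s, rfl⟩ := Submodule.mem_span_singleton.mp ha
    obtain ⟨t, rfl⟩ := Submodule.mem_span_singleton.mp hb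
    refine ext_inner_left ℝ fun z => ?_
    rw [hbra, map_smul, real_inner_smul_left, real_inner_smul_right, hself]
    simp
  · intro U' hU' hle
    refine le_antisymm ?_ hle
    intro w hw
    rw [hperp, Submodule.mem_orthogonal]
    rintro _ ⟨z, rfl⟩
    have h := hbra z u w
    rw [hU' u (hle (Submodule.mem_span_singleton_self u)) w hw, inner_zero_right] at h
    exact h.symm
end

section
/- Suppose m = 8 and dim V = 16. Set K := J_{e_1} ∘ J_{e_2} ∘ ⋯ ∘ J_{e_8}. Let v ∈ V be nonzero with K v = v, let z ∈ ℝ^8 be nonzero, and put v' := v - ‖z‖^{-2} • J_z v (so v' = v + J_z^{-1} v). Then the centralizer of v + J_z v equals the image of ℝ^8 under u ↦ J_u v'; that is, {w ∈ V : [v + J_z v, w] = 0} = {J_u v' : u ∈ ℝ^8}. -/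
open RealInnerProductSpace

theorem aux_prod_comm {R : Type*} [Ring R] (A : R) : ∀ (n : ℕ) (f : Fin n → R) (c : Fin n → ℤ),
    (∀ i, A * f i = c i • (f i * A)) →
    A * (List.ofFn f).prod = (∏ i, c i) • ((List.ofFn f).prod * A) := by
  intro n
  induction n with
  | zero => intro f c h; simp
  | succ n ih =>
    intro f c h
    rw [List.ofFn_succ, List.prod_cons, Fin.prod_univ_succ, ← mul_assoc, h 0, smul_mul_assoc,
      mul_assoc, ih (fun i => f i.succ) (fun i => c i.succ) (fun i => h _), mul_smul_comm,
      smul_smul, mul_assoc]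

theorem aux_prod_isom {V : Type*} [NormedAddCommGroup V] [InnerProductSpace ℝ V] :
    ∀ (n : ℕ) (f : Fin n → (V →ₗ[ℝ] V)), (∀ i x y, ⟪f i x, f i y⟫ = ⟪x, y⟫) →
    ∀ x y, ⟪(List.ofFn f).prod x, (List.ofFn f).prod y⟫ = ⟪x, y⟫ := by
  intro n
  induction n with
  | zero => intro f h x y; simp
  | succ n ih =>
    intro f h x y
    rw [List.ofFn_succ, List.prod_cons, Module.End.mul_apply, Module.End.mul_apply, h]
    exact ih _ (fun i => h _) x y

theorem stmt_6 {V : Type*} [NormedAddCommGroup V] [InnerProductSpace ℝ V]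
    [FiniteDimensional ℝ V] (hdim : Module.finrank ℝ V = 16)
    (J : EuclideanSpace ℝ (Fin 8) →ₗ[ℝ] V →ₗ[ℝ] V)
    (hskew : ∀ (z : EuclideanSpace ℝ (Fin 8)) (u w : V), ⟪J z u, w⟫ = -⟪u, J z w⟫)
    (hsq : ∀ (z : EuclideanSpace ℝ (Fin 8)) (u : V), J z (J z u) = -(‖z‖ ^ 2) • u)
    (bra : V → V → EuclideanSpace ℝ (Fin 8))
    (hbra : ∀ (z : EuclideanSpace ℝ (Fin 8)) (u w : V), ⟪z, bra u w⟫ = ⟪J z u, w⟫)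
    (K : V →ₗ[ℝ] V)
    (hK : K = (List.ofFn fun i : Fin 8 => J (stdBasis 8 i)).prod)
    (v : V) (hv : v ≠ 0) (hKv : K v = v)
    (z : EuclideanSpace ℝ (Fin 8)) (hz : z ≠ 0) :
    {w : V | bra (v + J z v) w = 0} =
      Set.range fun u : EuclideanSpace ℝ (Fin 8) =>
        J u (v - (‖z‖ ^ 2)⁻¹ • J z v) := by
  classical
  have hac : ∀ (s t : EuclideanSpace ℝ (Fin 8)) (x : V),
      J s (J t x) = -(J t (J s x)) - (2 * ⟪s, t⟫) • x := by
    intro s t x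
    have h := hsq (s + t) x
    rw [norm_add_sq_real] at h
    simp only [map_add, LinearMap.add_apply, hsq] at h
    linear_combination (norm := module) h
  have hin : ∀ (s t : EuclideanSpace ℝ (Fin 8)) (x : V),
      ⟪J s x, J t x⟫ = ⟪s, t⟫ * ⟪x, x⟫ := by
    intro s t x
    have h1 := hskew s x (J t x)
    have h2 := hskew t x (J s x)
    rw [hac s t x, inner_sub_right, inner_neg_right, inner_smul_right] at h1
    rw [real_inner_comm] at h2
    linarith
  have hiso : ∀ (i : Fin 8) (x y : V),
      ⟪J (stdBasis 8 i) x, J (stdBasis 8 i) y⟫ = ⟪x, y⟫ := by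
    intro i x y
    rw [hskew, hsq]
    simp [stdBasis]
  have hKiso : ∀ x y, ⟪K x, K y⟫ = ⟪x, y⟫ := by
    rw [hK]; exact aux_prod_isom 8 _ hiso
  have hKe : ∀ (j : Fin 8) (x : V), J (stdBasis 8 j) (K x) = - K (J (stdBasis 8 j) x) := by
    intro j x
    have h := aux_prod_comm (J (stdBasis 8 j)) 8 (fun i => J (stdBasis 8 i))
      (fun i => if i = j then 1 else -1) (by
        intro i
        by_cases hij : i = j
        · simp [hij]
        · ext y
          simp only [Module.End.mul_apply, hij, if_false]
          rw [hac]
          simp [stdBasis, hij, EuclideanSpace.inner_single_left]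
          )
    have hc : (∏ i : Fin 8, (if i = j then (1 : ℤ) else -1)) = -1 := by
      clear h; revert j; decide
    rw [hc, ← hK] at h
    have h' := LinearMap.congr_fun h x
    simpa using h'
  have hKJ : ∀ (s : EuclideanSpace ℝ (Fin 8)) (x : V), K (J s x) = - J s (K x) := by
    intro s x
    have hs : s = ∑ i, s i • stdBasis 8 i := by
      ext k
      simp [stdBasis, Finset.sum_apply, Pi.single_apply]
    rw [hs]
    simp only [map_sum, map_smul, LinearMap.sum_apply, LinearMap.smul_apply, hKe]
    simp
  have horth : ∀ s t r : EuclideanSpace ℝ (Fin 8), ⟪J s (J t v), J r v⟫ = 0 := by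
    intro s t r
    have h := hKiso (J s (J t v)) (J r v)
    rw [hKJ, hKJ, hKJ, hKv, map_neg, neg_neg, inner_neg_right] at h
    linarith
  have hzn : ‖z‖ ^ 2 ≠ 0 := by simpa using hz
  have hvv : ⟪v, v⟫ ≠ 0 := by simpa using hv
  have hvJ : ⟪v, J z v⟫ = 0 := by
    have h := hskew z v v
    rw [real_inner_comm] at h
    linarith
  set p := v + J z v with hp
  set q := v - (‖z‖ ^ 2)⁻¹ • J z v with hq
  have hp0 : p ≠ 0 := by
    intro h
    apply hvv
    have : ⟪v, p⟫ = 0 := by rw [h, inner_zero_right]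
    rwa [hp, inner_add_right, hvJ, add_zero] at this
  have hq0 : q ≠ 0 := by
    intro h
    apply hvv
    have : ⟪v, q⟫ = 0 := by rw [h, inner_zero_right]
    rwa [hq, inner_sub_right, inner_smul_right, hvJ, mul_zero, sub_zero] at this
  have hpq : ∀ s t, ⟪J s p, J t q⟫ = 0 := by
    intro s t
    have h1 : ⟪J s v, J t (J z v)⟫ = 0 := by rw [real_inner_comm]; exact horth _ _ _
    simp only [hp, hq, map_add, map_sub, map_smul, inner_add_left, inner_sub_right,
      inner_smul_right, horth, h1, hin]
    rw [real_inner_self_eq_norm_sq z]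
    field_simp
    ring
  have hrank : ∀ x : V, x ≠ 0 → Module.finrank ℝ (LinearMap.range (J.flip x)) = 8 := by
    intro x hx
    rw [LinearMap.finrank_range_of_inj]
    · simp
    · rw [← LinearMap.ker_eq_bot, LinearMap.ker_eq_bot']
      intro s hs
      have h := hin s s x
      rw [LinearMap.flip_apply] at hs
      rw [hs, inner_zero_left] at h
      have hxx : ⟪x, x⟫ ≠ 0 := by simpa using hx
      have := (mul_eq_zero.mp h.symm).resolve_right hxx
      simpa using this
  have hle : LinearMap.range (J.flip q) ≤ (LinearMap.range (J.flip p))ᗮ := by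
    rintro _ ⟨t, rfl⟩
    rw [Submodule.mem_orthogonal]
    rintro _ ⟨s, rfl⟩
    exact hpq s t
  have heq : LinearMap.range (J.flip q) = (LinearMap.range (J.flip p))ᗮ := by
    apply Submodule.eq_of_le_of_finrank_eq hle
    have := Submodule.finrank_add_finrank_orthogonal (LinearMap.range (J.flip p))
    rw [hdim, hrank p hp0] at this
    rw [hrank q hq0]
    omega
  ext w
  have hw : w ∈ (Set.range fun u => J u q) ↔ w ∈ LinearMap.range (J.flip q) := by
    simp
  rw [hw, heq, Submodule.mem_orthogonal, Set.mem_setOf_eq]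
  constructor
  · rintro h _ ⟨s, rfl⟩
    rw [LinearMap.flip_apply, ← hbra, h, inner_zero_right]
  · intro h
    have h2 := h _ ⟨bra p w, rfl⟩
    rw [LinearMap.flip_apply, ← hbra] at h2
    simpa using h2
end

section
/- Suppose m = 8 and dim V = 16. Set K := J_{e_1} ∘ ⋯ ∘ J_{e_8}. Let v ∈ V be nonzero with K v = v, let z ∈ ℝ^8 be nonzero, and put v' := v - ‖z‖^{-2} • J_z v. If u, u', z ∈ ℝ^8 are linearly independent, then [J_u v', J_{u'} v'] ≠ 0; that is, J_u v' and J_{u'} v' do not commute. -/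
open RealInnerProductSpace

section Helpers
variable {V : Type*} [NormedAddCommGroup V] [InnerProductSpace ℝ V]

lemma aux_anticomm
    (J : EuclideanSpace ℝ (Fin 8) →ₗ[ℝ] V →ₗ[ℝ] V)
    (hsq : ∀ (z : EuclideanSpace ℝ (Fin 8)) (u : V), J z (J z u) = -(‖z‖ ^ 2) • u)
    (a b : EuclideanSpace ℝ (Fin 8)) (x : V) :
    J a (J b x) = -J b (J a x) - (2 * ⟪a, b⟫) • x := by
  have h := hsq (a + b) x
  rw [norm_add_sq_real] at h
  simp only [map_add, LinearMap.add_apply, hsq] at h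
  have h2 : J a (J b x) + J b (J a x) = -(2 * ⟪a, b⟫) • x := by
    rw [← sub_eq_zero] at h ⊢
    rw [← h]
    module
  rw [eq_sub_of_add_eq h2]
  module

lemma aux_inner
    (J : EuclideanSpace ℝ (Fin 8) →ₗ[ℝ] V →ₗ[ℝ] V)
    (hskew : ∀ (z : EuclideanSpace ℝ (Fin 8)) (u w : V), ⟪J z u, w⟫ = -⟪u, J z w⟫)
    (hsq : ∀ (z : EuclideanSpace ℝ (Fin 8)) (u : V), J z (J z u) = -(‖z‖ ^ 2) • u)
    (a b : EuclideanSpace ℝ (Fin 8)) (x : V) :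
    ⟪J a x, J b x⟫ = ⟪a, b⟫ * ‖x‖ ^ 2 := by
  have h1 := hskew a x (J b x)
  have h2 := hskew b x (J a x)
  rw [aux_anticomm J hsq a b x, inner_sub_right, inner_neg_right, inner_smul_right,
    real_inner_self_eq_norm_sq] at h1
  rw [real_inner_comm] at h2
  linarith

lemma aux_inj
    (J : EuclideanSpace ℝ (Fin 8) →ₗ[ℝ] V →ₗ[ℝ] V)
    (hsq : ∀ (z : EuclideanSpace ℝ (Fin 8)) (u : V), J z (J z u) = -(‖z‖ ^ 2) • u)
    (a : EuclideanSpace ℝ (Fin 8)) (ha : a ≠ 0) (x : V) (h : J a x = 0) : x = 0 := by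
  have h1 := hsq a x
  rw [h, map_zero] at h1
  have := smul_eq_zero.1 h1.symm
  simpa [ha] using this

lemma aux_std_anti
    (J : EuclideanSpace ℝ (Fin 8) →ₗ[ℝ] V →ₗ[ℝ] V)
    (hsq : ∀ (z : EuclideanSpace ℝ (Fin 8)) (u : V), J z (J z u) = -(‖z‖ ^ 2) • u)
    (i j : Fin 8) (h : j < i) (x : V) :
    J (stdBasis 8 i) (J (stdBasis 8 j) x) = -J (stdBasis 8 j) (J (stdBasis 8 i) x) := by
  rw [aux_anticomm J hsq]
  have : ⟪stdBasis 8 i, stdBasis 8 j⟫ = (0 : ℝ) := by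
    simp [stdBasis, EuclideanSpace.inner_single_left, h.ne']
  simp [this]

lemma aux_std_sq
    (J : EuclideanSpace ℝ (Fin 8) →ₗ[ℝ] V →ₗ[ℝ] V)
    (hsq : ∀ (z : EuclideanSpace ℝ (Fin 8)) (u : V), J z (J z u) = -(‖z‖ ^ 2) • u)
    (i : Fin 8) (x : V) :
    J (stdBasis 8 i) (J (stdBasis 8 i) x) = - x := by
  rw [hsq]
  simp [stdBasis]

lemma aux_K_apply
    (J : EuclideanSpace ℝ (Fin 8) →ₗ[ℝ] V →ₗ[ℝ] V)
    (x : V) : (List.ofFn fun i : Fin 8 => J (stdBasis 8 i)).prod x =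
      J (stdBasis 8 0) (J (stdBasis 8 1) (J (stdBasis 8 2) (J (stdBasis 8 3)
      (J (stdBasis 8 4) (J (stdBasis 8 5) (J (stdBasis 8 6) (J (stdBasis 8 7) x))))))) := by
  simp [List.ofFn_succ, Module.End.mul_apply]

lemma aux_K_symm
    (J : EuclideanSpace ℝ (Fin 8) →ₗ[ℝ] V →ₗ[ℝ] V)
    (hskew : ∀ (z : EuclideanSpace ℝ (Fin 8)) (u w : V), ⟪J z u, w⟫ = -⟪u, J z w⟫)
    (hsq : ∀ (z : EuclideanSpace ℝ (Fin 8)) (u : V), J z (J z u) = -(‖z‖ ^ 2) • u)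
    (x y : V) : ⟪(List.ofFn fun i : Fin 8 => J (stdBasis 8 i)).prod x, y⟫ =
      ⟪x, (List.ofFn fun i : Fin 8 => J (stdBasis 8 i)).prod y⟫ := by
  rw [aux_K_apply, aux_K_apply]
  simp only [hskew, neg_neg]
  congr 1
  simp (discharger := decide) only [aux_std_anti J hsq, map_neg, neg_neg]

lemma aux_K_anti
    (J : EuclideanSpace ℝ (Fin 8) →ₗ[ℝ] V →ₗ[ℝ] V)
    (hsq : ∀ (z : EuclideanSpace ℝ (Fin 8)) (u : V), J z (J z u) = -(‖z‖ ^ 2) • u)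
    (w : EuclideanSpace ℝ (Fin 8)) (x : V) :
    (List.ofFn fun i : Fin 8 => J (stdBasis 8 i)).prod (J w x) =
      - J w ((List.ofFn fun i : Fin 8 => J (stdBasis 8 i)).prod x) := by
  have hw : w = ∑ i, w i • stdBasis 8 i := by
    ext j
    simp [stdBasis, Pi.single_apply]
  have key : ∀ i, (List.ofFn fun i : Fin 8 => J (stdBasis 8 i)).prod (J (stdBasis 8 i) x) =
      - J (stdBasis 8 i) ((List.ofFn fun i : Fin 8 => J (stdBasis 8 i)).prod x) := by
    intro i
    rw [aux_K_apply, aux_K_apply]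
    fin_cases i <;>
    simp (discharger := decide) [aux_std_anti J hsq, aux_std_sq J hsq, -Fin.isValue]
  rw [hw]
  simp only [map_sum, map_smul, LinearMap.sum_apply, LinearMap.smul_apply, key, smul_neg,
    Finset.sum_neg_distrib]

end Helpers

theorem stmt_7 {V : Type*} [NormedAddCommGroup V] [InnerProductSpace ℝ V]
    [FiniteDimensional ℝ V] (hdim : Module.finrank ℝ V = 16)
    (J : EuclideanSpace ℝ (Fin 8) →ₗ[ℝ] V →ₗ[ℝ] V)
    (hskew : ∀ (z : EuclideanSpace ℝ (Fin 8)) (u w : V), ⟪J z u, w⟫ = -⟪u, J z w⟫)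
    (hsq : ∀ (z : EuclideanSpace ℝ (Fin 8)) (u : V), J z (J z u) = -(‖z‖ ^ 2) • u)
    (bra : V → V → EuclideanSpace ℝ (Fin 8))
    (hbra : ∀ (z : EuclideanSpace ℝ (Fin 8)) (u w : V), ⟪z, bra u w⟫ = ⟪J z u, w⟫)
    (K : V →ₗ[ℝ] V)
    (hK : K = (List.ofFn fun i : Fin 8 => J (stdBasis 8 i)).prod)
    (v : V) (hv : v ≠ 0) (hKv : K v = v)
    (z : EuclideanSpace ℝ (Fin 8)) (hz : z ≠ 0)
    (u u' : EuclideanSpace ℝ (Fin 8))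
    (hind : LinearIndependent ℝ ![u, u', z]) :
    bra (J u (v - (‖z‖ ^ 2)⁻¹ • J z v)) (J u' (v - (‖z‖ ^ 2)⁻¹ • J z v)) ≠ 0 := by
  classical
  have hKs : ∀ x y, ⟪K x, y⟫ = ⟪x, K y⟫ := by
    rw [hK]; exact aux_K_symm J hskew hsq
  have hKa : ∀ w x, K (J w x) = - J w (K x) := by
    rw [hK]; exact aux_K_anti J hsq
  have hinj := aux_inj J hsq
  have hin := aux_inner J hskew hsq
  have hac := aux_anticomm J hsq
  clear hK
  intro h0
  -- orthogonality of the eigenspaces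
  have horth : ∀ x y, K x = x → K y = -y → ⟪x, y⟫ = 0 := by
    intro x y hx hy
    have := hKs x y
    rw [hx, hy, inner_neg_right] at this
    linarith
  have hpm : ∀ w x, K x = x → K (J w x) = - J w x := by
    intro w x hx; rw [hKa, hx]
  have hmp : ∀ w x, K x = -x → K (J w x) = J w x := by
    intro w x hx; rw [hKa, hx, map_neg, neg_neg]
  -- surjectivity
  let P : Submodule ℝ V := LinearMap.ker (K - LinearMap.id)
  let N : Submodule ℝ V := LinearMap.ker (K + LinearMap.id)
  have hP : ∀ x, x ∈ P ↔ K x = x := by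
    intro x; simp [P, sub_eq_zero]
  have hN : ∀ x, x ∈ N ↔ K x = -x := by
    intro x; simp [N, add_eq_zero_iff_eq_neg]
  have hJi : Function.Injective (J z) :=
    (injective_iff_map_eq_zero (J z)).2 (hinj z hz)
  have hNP : Module.finrank ℝ N ≤ Module.finrank ℝ P := by
    rw [(Submodule.equivMapOfInjective (J z) hJi N).finrank_eq]
    apply Submodule.finrank_mono
    rintro _ ⟨x, hx, rfl⟩
    exact (hP _).2 (hmp z x ((hN x).1 hx))
  have hdis : P ⊓ N = ⊥ := by
    rw [eq_bot_iff]
    rintro x ⟨hx1, hx2⟩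
    have := horth x x ((hP x).1 hx1) ((hN x).1 hx2)
    simpa using this
  have hN8 : Module.finrank ℝ N ≤ 8 := by
    have h1 := Submodule.finrank_sup_add_finrank_inf_eq P N
    rw [hdis, finrank_bot] at h1
    have h2 := Submodule.finrank_le (P ⊔ N)
    omega
  let L : EuclideanSpace ℝ (Fin 8) →ₗ[ℝ] V := J.flip v
  have hL : ∀ w, L w = J w v := fun w => rfl
  have hLi : Function.Injective L := by
    refine (injective_iff_map_eq_zero L).2 ?_
    intro w hw
    by_contra hne
    exact hv (hinj w hne v hw)
  have hrange : LinearMap.range L = N := by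
    apply Submodule.eq_of_le_of_finrank_le
    · rintro _ ⟨w, rfl⟩
      exact (hN _).2 (hpm w v hKv)
    · rw [LinearMap.finrank_range_of_inj hLi]
      simpa using hN8
  -- the key vector
  set X : V := J u (J u' (J z v)) + (⟪u, u'⟫ : ℝ) • J z v + (⟪u', z⟫ : ℝ) • J u v
    - (⟪u, z⟫ : ℝ) • J u' v with hX
  have hXN : K X = -X := by
    have e1 : K (J u (J u' (J z v))) = - J u (J u' (J z v)) :=
      hpm _ _ (hmp _ _ (hpm _ _ hKv))
    rw [hX]
    simp only [map_add, map_sub, map_smul, e1, hpm _ _ hKv]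
    module
  have hz2 : ‖z‖ ^ 2 ≠ 0 := by simpa using hz
  have hXw : ∀ w, ⟪J w v, X⟫ = 0 := by
    intro w
    have h1 := hbra w (J u (v - (‖z‖ ^ 2)⁻¹ • J z v)) (J u' (v - (‖z‖ ^ 2)⁻¹ • J z v))
    rw [h0, inner_zero_right] at h1
    simp only [map_sub, map_smul, inner_sub_left, inner_sub_right, inner_smul_left,
      inner_smul_right, RCLike.conj_to_real] at h1
    have o1 : ⟪J w (J u v), J u' v⟫ = 0 :=
      horth _ _ (hmp _ _ (hpm _ _ hKv)) (hpm _ _ hKv)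
    have o2 : ⟪J w (J u (J z v)), J u' (J z v)⟫ = 0 := by
      rw [real_inner_comm]
      exact horth _ _ (hmp _ _ (hpm _ _ hKv)) (hpm _ _ (hmp _ _ (hpm _ _ hKv)))
    rw [o1, o2] at h1
    have h2 : ⟪J w (J u v), J u' (J z v)⟫ + ⟪J w (J u (J z v)), J u' v⟫ = 0 := by
      have h3 : (‖z‖ ^ 2)⁻¹ *
          (⟪J w (J u v), J u' (J z v)⟫ + ⟪J w (J u (J z v)), J u' v⟫) = 0 := by
        linarith
      exact (mul_eq_zero.1 h3).resolve_left (inv_ne_zero hz2)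
    have q : ∀ a b, ⟪v, J a (J b v)⟫ = - (⟪a, b⟫ * ‖v‖ ^ 2) := by
      intro a b
      have := hskew a v (J b v)
      rw [hin] at this
      linarith
    have f1 : ⟪J w (J u v), J u' (J z v)⟫ = ⟪J w v, J u (J u' (J z v))⟫
        + 2 * ⟪w, u⟫ * (⟪u', z⟫ * ‖v‖ ^ 2) := by
      rw [hac w u v, inner_sub_left, inner_neg_left, hskew u, inner_smul_left, q]
      simp
    have f2 : ⟪J w (J u (J z v)), J u' v⟫ = - ⟪J w v, J u' (J u (J z v))⟫
        - 2 * ⟪w, u'⟫ * (⟪u, z⟫ * ‖v‖ ^ 2) := by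
      rw [hskew w, hac w u' v, inner_sub_right, inner_neg_right, inner_smul_right,
        real_inner_comm v, q, real_inner_comm (J u' (J w v)), hskew u']
      ring
    have f3 : ⟪J w v, J u' (J u (J z v))⟫ = - ⟪J w v, J u (J u' (J z v))⟫
        - 2 * ⟪u, u'⟫ * (⟪w, z⟫ * ‖v‖ ^ 2) := by
      rw [hac u' u, inner_sub_right, inner_neg_right, inner_smul_right, hin,
        real_inner_comm u u']
    rw [hX]
    simp only [inner_sub_right, inner_add_right, inner_smul_right, hin]
    linarith
  have hX0 : X = 0 := by
    have : X ∈ LinearMap.range L := by rw [hrange]; exact (hN X).2 hXN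
    obtain ⟨w, hw⟩ := this
    have h1 := hXw w
    rw [← hL, hw] at h1
    simpa using h1
  -- orthogonalisation
  have hli : ∀ a b c : ℝ, a • u + b • u' + c • z = 0 → a = 0 ∧ b = 0 ∧ c = 0 := by
    intro a b c habc
    have := Fintype.linearIndependent_iff.1 hind ![a, b, c]
      (by simpa [Fin.sum_univ_three] using habc)
    exact ⟨this 0, this 1, this 2⟩
  obtain ⟨α, hα⟩ : ∃ α : ℝ, α * ‖z‖ ^ 2 = ⟪u', z⟫ := ⟨⟪u', z⟫ / ‖z‖ ^ 2, by field_simp⟩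
  obtain ⟨γ, hγ⟩ : ∃ γ : ℝ, γ * ‖z‖ ^ 2 = ⟪u, z⟫ := ⟨⟪u, z⟫ / ‖z‖ ^ 2, by field_simp⟩
  obtain ⟨b, hb⟩ : ∃ b, b = u' - α • z := ⟨_, rfl⟩
  have hb0 : b ≠ 0 := by
    intro h
    have := hli 0 1 (-α) (by rw [← h, hb]; module)
    simp at this
  have hb2 : ‖b‖ ^ 2 ≠ 0 := by simpa using hb0
  obtain ⟨β, hβ⟩ : ∃ β : ℝ, β * ‖b‖ ^ 2 = ⟪u, b⟫ := ⟨⟪u, b⟫ / ‖b‖ ^ 2, by field_simp⟩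
  obtain ⟨c, hc⟩ : ∃ c, c = u - β • b - γ • z := ⟨_, rfl⟩
  have hc0 : c ≠ 0 := by
    intro h
    have := hli 1 (-β) (β * α - γ) (by rw [← h, hc, hb]; module)
    simp at this
  have hbz : ⟪z, b⟫ = 0 := by
    rw [hb, inner_sub_right, inner_smul_right, real_inner_self_eq_norm_sq, real_inner_comm, hα]
    ring
  have hub : ⟪u, b⟫ = ⟪u, u'⟫ - α * ⟪u, z⟫ := by
    rw [hb, inner_sub_right, inner_smul_right]
  have e1 : J b (J z v) = J u' (J z v) + (⟪u', z⟫ : ℝ) • v := by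
    rw [← hα, hb]
    simp only [map_sub, map_smul, LinearMap.sub_apply, LinearMap.smul_apply, hsq]
    module
  have e2 : J z (J b (J z v)) = (‖z‖ ^ 2) • J b v := by
    rw [hac z b, hbz, hsq]
    simp
  have e3 : J c (J b (J z v)) = X := by
    have : J c (J b (J z v)) = J u (J b (J z v)) - β • J b (J b (J z v))
        - γ • J z (J b (J z v)) := by
      conv_lhs => rw [hc]
      simp only [map_sub, map_smul, LinearMap.sub_apply, LinearMap.smul_apply]
    rw [this, e2, hsq b, e1, hX, map_add, map_smul, smul_smul, smul_smul, hγ, mul_neg, hβ, hub]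
    conv_lhs => rw [hb]
    simp only [map_sub, map_smul, LinearMap.sub_apply, LinearMap.smul_apply]
    module
  rw [hX0] at e3
  exact hv (hinj z hz _ (hinj b hb0 _ (hinj c hc0 _ e3)))
end

section
/- Suppose m = 8 and dim V = 16. Set K := J_{e_1} ∘ ⋯ ∘ J_{e_8}. Let v ∈ V be nonzero with K v = v and let z ∈ ℝ^8 be nonzero. Then every isotropic subspace of V containing the vector v + J_z v has dimension at most 2. -/
open RealInnerProductSpace

namespace HT

variable {V : Type*} [NormedAddCommGroup V] [InnerProductSpace ℝ V]

theorem anti (J : EuclideanSpace ℝ (Fin 8) →ₗ[ℝ] V →ₗ[ℝ] V)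
    (hsq : ∀ (z : EuclideanSpace ℝ (Fin 8)) (u : V), J z (J z u) = -(‖z‖ ^ 2) • u) (y p : EuclideanSpace ℝ (Fin 8)) (u : V) :
    J y (J p u) = -J p (J y u) - (2 * ⟪y, p⟫) • u := by
  have h := hsq (y + p) u
  have e : ‖y + p‖ ^ 2 = ‖y‖ ^ 2 + 2 * ⟪y, p⟫ + ‖p‖ ^ 2 := norm_add_sq_real y p
  rw [e] at h
  simp only [map_add, LinearMap.add_apply, hsq] at h
  have : J y (J p u) + J p (J y u) + (2 * ⟪y, p⟫) • u = 0 := by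
    rw [← sub_eq_zero] at h
    rw [← h]
    module
  rw [← sub_eq_zero, ← this]
  module

theorem inner_same (J : EuclideanSpace ℝ (Fin 8) →ₗ[ℝ] V →ₗ[ℝ] V)
    (hskew : ∀ (z : EuclideanSpace ℝ (Fin 8)) (u w : V), ⟪J z u, w⟫ = -⟪u, J z w⟫)
    (hsq : ∀ (z : EuclideanSpace ℝ (Fin 8)) (u : V), J z (J z u) = -(‖z‖ ^ 2) • u) (y p : EuclideanSpace ℝ (Fin 8)) (u : V) :
    ⟪J y u, J p u⟫ = ⟪y, p⟫ * ⟪u, u⟫ := by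
  have h1 := hskew y u (J p u)
  have h2 := hskew p u (J y u)
  rw [anti J hsq y p u, inner_sub_right, inner_neg_right, inner_smul_right] at h1
  rw [real_inner_comm] at h2
  linarith

theorem J_iso (J : EuclideanSpace ℝ (Fin 8) →ₗ[ℝ] V →ₗ[ℝ] V)
    (hskew : ∀ (z : EuclideanSpace ℝ (Fin 8)) (u w : V), ⟪J z u, w⟫ = -⟪u, J z w⟫)
    (hsq : ∀ (z : EuclideanSpace ℝ (Fin 8)) (u : V), J z (J z u) = -(‖z‖ ^ 2) • u) (z : EuclideanSpace ℝ (Fin 8)) (a b : V) :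
    ⟪J z a, J z b⟫ = ‖z‖ ^ 2 * ⟪a, b⟫ := by
  rw [hskew, hsq, inner_smul_right]; ring

theorem J_inj (J : EuclideanSpace ℝ (Fin 8) →ₗ[ℝ] V →ₗ[ℝ] V)
    (hsq : ∀ (z : EuclideanSpace ℝ (Fin 8)) (u : V), J z (J z u) = -(‖z‖ ^ 2) • u) (z : EuclideanSpace ℝ (Fin 8)) (u : V)
    (h : J z u = 0) (hu : u ≠ 0) : z = 0 := by
  have h2 := hsq z u
  rw [h, map_zero] at h2
  have := (smul_eq_zero.mp h2.symm).resolve_right hu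
  simpa using this

theorem ofn_apply (J : EuclideanSpace ℝ (Fin 8) →ₗ[ℝ] V →ₗ[ℝ] V) (u : V) :
    (List.ofFn fun i : Fin 8 => J (stdBasis 8 i)).prod u =
    J (stdBasis 8 0) (J (stdBasis 8 1) (J (stdBasis 8 2) (J (stdBasis 8 3)
      (J (stdBasis 8 4) (J (stdBasis 8 5) (J (stdBasis 8 6) (J (stdBasis 8 7) u))))))) := by
  simp [List.ofFn_succ, Module.End.mul_apply]

theorem K_anti (J : EuclideanSpace ℝ (Fin 8) →ₗ[ℝ] V →ₗ[ℝ] V)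
    (hsq : ∀ (z : EuclideanSpace ℝ (Fin 8)) (u : V), J z (J z u) = -(‖z‖ ^ 2) • u) (y : EuclideanSpace ℝ (Fin 8)) (u : V) :
    (List.ofFn fun i : Fin 8 => J (stdBasis 8 i)).prod (J y u) =
      -J y ((List.ofFn fun i : Fin 8 => J (stdBasis 8 i)).prod u) := by
  have key : ∀ i : Fin 8, (List.ofFn fun i : Fin 8 => J (stdBasis 8 i)).prod
      (J (stdBasis 8 i) u) =
      -J (stdBasis 8 i) ((List.ofFn fun i : Fin 8 => J (stdBasis 8 i)).prod u) := by
    intro i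
    have ha : ∀ k : Fin 8, k ≠ i → ∀ w, J (stdBasis 8 k) (J (stdBasis 8 i) w) =
        -J (stdBasis 8 i) (J (stdBasis 8 k) w) := by
      intro k hk w
      rw [anti J hsq]
      have : ⟪stdBasis 8 k, stdBasis 8 i⟫ = (0:ℝ) := by
        simp [stdBasis, EuclideanSpace.inner_single_left, hk]
      simp [this]
    rw [ofn_apply, ofn_apply]
    generalize hj : (fun i : Fin 8 => J (stdBasis 8 i)) = j
    have hjj : ∀ i, J (stdBasis 8 i) = j i := fun i => by rw [← hj]
    simp only [hjj] at ha ⊢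
    have h0 := ha 0
    have h1 := ha 1
    have h2 := ha 2
    have h3 := ha 3
    have h4 := ha 4
    have h5 := ha 5
    have h6 := ha 6
    have h7 := ha 7
    clear ha hj hjj
    fin_cases i <;>
      simp [-LinearMap.map_eq_zero_iff] at h0 h1 h2 h3 h4 h5 h6 h7 ⊢ <;>
      simp only [h0, h1, h2, h3, h4, h5, h6, h7, map_neg, neg_neg]
  have hy : y = ∑ i : Fin 8, y i • stdBasis 8 i := by
    ext k
    simp [stdBasis, Finset.sum_apply, Pi.single_apply]
  rw [hy]
  simp only [map_sum, LinearMap.sum_apply, map_smul, LinearMap.smul_apply, key, smul_neg,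
    Finset.sum_neg_distrib]

theorem K_iso (J : EuclideanSpace ℝ (Fin 8) →ₗ[ℝ] V →ₗ[ℝ] V)
    (hskew : ∀ (z : EuclideanSpace ℝ (Fin 8)) (u w : V), ⟪J z u, w⟫ = -⟪u, J z w⟫)
    (hsq : ∀ (z : EuclideanSpace ℝ (Fin 8)) (u : V), J z (J z u) = -(‖z‖ ^ 2) • u) (a b : V) :
    ⟪(List.ofFn fun i : Fin 8 => J (stdBasis 8 i)).prod a,
      (List.ofFn fun i : Fin 8 => J (stdBasis 8 i)).prod b⟫ = ⟪a, b⟫ := by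
  have hn : ∀ i, ‖stdBasis 8 i‖ = 1 := fun i => by simp [stdBasis]
  simp only [ofn_apply, J_iso J hskew hsq, hn]
  ring

theorem parity (J : EuclideanSpace ℝ (Fin 8) →ₗ[ℝ] V →ₗ[ℝ] V)
    (hskew : ∀ (z : EuclideanSpace ℝ (Fin 8)) (u w : V), ⟪J z u, w⟫ = -⟪u, J z w⟫)
    (hsq : ∀ (z : EuclideanSpace ℝ (Fin 8)) (u : V), J z (J z u) = -(‖z‖ ^ 2) • u) (v : V)
    (hKv : (List.ofFn fun i : Fin 8 => J (stdBasis 8 i)).prod v = v) (y p q : EuclideanSpace ℝ (Fin 8)) :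
    ⟪J y v, J p (J q v)⟫ = 0 := by
  have h := K_iso J hskew hsq (J y v) (J p (J q v))
  simp only [K_anti J hsq, hKv, map_neg, neg_neg, inner_neg_left] at h
  linarith

theorem exists_rep [FiniteDimensional ℝ V] (hdim : Module.finrank ℝ V = 16)
    (J : EuclideanSpace ℝ (Fin 8) →ₗ[ℝ] V →ₗ[ℝ] V)
    (hsq : ∀ (z : EuclideanSpace ℝ (Fin 8)) (u : V), J z (J z u) = -(‖z‖ ^ 2) • u) (a b : V) (ha : a ≠ 0) (hb : b ≠ 0)
    (hab : ∀ y p, ⟪J y a, J p b⟫ = 0) (w : V) (hw : ∀ y, ⟪J y a, w⟫ = 0) :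
    ∃ q, w = J q b := by
  have fr : ∀ c : V, c ≠ 0 → Module.finrank ℝ (LinearMap.range (J.flip c)) = 8 := by
    intro c hc
    rw [LinearMap.finrank_range_of_inj]
    · simp
    · rw [injective_iff_map_eq_zero]
      intro z hz
      exact J_inj J hsq z c hz hc
  have hle : LinearMap.range (J.flip b) ≤ (LinearMap.range (J.flip a))ᗮ := by
    rintro _ ⟨p, rfl⟩
    rw [Submodule.mem_orthogonal]
    rintro _ ⟨y, rfl⟩
    exact hab y p
  have hsum := Submodule.finrank_add_finrank_orthogonal (LinearMap.range (J.flip a))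
  rw [fr a ha, hdim] at hsum
  have heq := Submodule.eq_of_le_of_finrank_eq hle (by rw [fr b hb]; omega)
  have : w ∈ LinearMap.range (J.flip b) := by
    rw [heq, Submodule.mem_orthogonal]
    rintro _ ⟨y, rfl⟩
    exact hw y
  obtain ⟨q, hq⟩ := this
  exact ⟨q, hq.symm⟩

end HT

theorem stmt_8 {V : Type*} [NormedAddCommGroup V] [InnerProductSpace ℝ V]
    [FiniteDimensional ℝ V] (hdim : Module.finrank ℝ V = 16)
    (J : EuclideanSpace ℝ (Fin 8) →ₗ[ℝ] V →ₗ[ℝ] V)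
    (hskew : ∀ (z : EuclideanSpace ℝ (Fin 8)) (u w : V), ⟪J z u, w⟫ = -⟪u, J z w⟫)
    (hsq : ∀ (z : EuclideanSpace ℝ (Fin 8)) (u : V), J z (J z u) = -(‖z‖ ^ 2) • u)
    (bra : V → V → EuclideanSpace ℝ (Fin 8))
    (hbra : ∀ (z : EuclideanSpace ℝ (Fin 8)) (u w : V), ⟪z, bra u w⟫ = ⟪J z u, w⟫)
    (K : V →ₗ[ℝ] V)
    (hK : K = (List.ofFn fun i : Fin 8 => J (stdBasis 8 i)).prod)
    (v : V) (hv : v ≠ 0) (hKv : K v = v)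
    (z : EuclideanSpace ℝ (Fin 8)) (hz : z ≠ 0)
    (U : Submodule ℝ V) (hiso : IsotropicSub bra U) (hmem : v + J z v ∈ U) :
    Module.finrank ℝ U ≤ 2 := by
  subst hK
  have par := HT.parity J hskew hsq v hKv
  have hzn : ‖z‖ ^ 2 ≠ 0 := by simpa using hz
  have hvv : ⟪v, v⟫ ≠ (0:ℝ) := by simpa using hv
  have same := HT.inner_same J hskew hsq
  have anti := HT.anti J hsq
  have hU : ∀ u ∈ U, ∀ w ∈ U, ∀ y, ⟪J y u, w⟫ = 0 := by
    intro u hu w hw y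
    rw [← hbra, hiso u hu w hw, inner_zero_right]
  have J0 : ∀ (q : EuclideanSpace ℝ (Fin 8)) (u : V), q ≠ 0 → u ≠ 0 → J q u ≠ 0 :=
    fun q u hq hu h => hq (HT.J_inj J hsq q u h hu)
  have par1 : ∀ q, ⟪v, J q v⟫ = 0 := by
    intro q
    have := hskew q v v
    rw [real_inner_comm] at this
    linarith
  have hx : v + J z v ≠ 0 := by
    intro h
    have h2 : ⟪v, v + J z v⟫ = 0 := by rw [h, inner_zero_right]
    rw [inner_add_right, par1, add_zero] at h2
    exact hvv h2
  obtain ⟨xp, hxdef⟩ : ∃ xp, xp = J z v - (‖z‖ ^ 2) • v := ⟨_, rfl⟩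
  have hxtwo : xp = J z (v + J z v) := by rw [hxdef, map_add, hsq, neg_smul, sub_eq_add_neg]
  have hxne : xp ≠ 0 := by rw [hxtwo]; exact J0 _ _ hz hx
  have rep : ∀ w ∈ U, ∃ q, w = J q xp := by
    intro w hw
    refine HT.exists_rep hdim J hsq (v + J z v) xp hx hxne ?_ w (hU _ hmem w hw)
    intro y p
    rw [hxdef]
    simp only [map_add, map_sub, map_smul, inner_add_left, inner_sub_right, inner_smul_right, same,
      par]
    rw [real_inner_comm (J p v) (J y (J z v)), par, real_inner_self_eq_norm_sq z]
    ring
  have hxx : J z xp = -(‖z‖ ^ 2) • (v + J z v) := by rw [hxtwo, hsq]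
  have rep2 : ∀ w ∈ U, ∃ (q : EuclideanSpace ℝ (Fin 8)) (s : ℝ), ⟪z, q⟫ = 0 ∧
      w = J q xp + s • (v + J z v) := by
    intro w hw
    obtain ⟨q, hq⟩ := rep w hw
    refine ⟨q - (⟪z, q⟫ / ‖z‖ ^ 2) • z, -⟪z, q⟫, ?_, ?_⟩
    · rw [inner_sub_right, inner_smul_right, real_inner_self_eq_norm_sq]
      field_simp
      ring
    · rw [map_sub, LinearMap.sub_apply, map_smul, LinearMap.smul_apply, hxx, hq, smul_smul]
      have : ⟪z, q⟫ / ‖z‖ ^ 2 * -(‖z‖ ^ 2) = -⟪z, q⟫ := by field_simp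
      rw [this]; abel
  have key : ∀ q r : EuclideanSpace ℝ (Fin 8), q ≠ 0 → ⟪z, q⟫ = 0 → ⟪z, r⟫ = 0 →
      J q xp ∈ U → J r xp ∈ U → ∃ t : ℝ, r = t • q := by
    intro q r hq hzq hzr hm hmr
    have hJq := J0 q v hq hv
    have a1 : ∀ u, J q (J z u) = - J z (J q u) := by
      intro u; rw [anti, real_inner_comm, hzq]; simp
    have a2 : ∀ u, J r (J z u) = - J z (J r u) := by
      intro u; rw [anti, real_inner_comm, hzr]; simp
    have orth : ∀ y, ⟪y, z⟫ = 0 → ⟪J y (J q v), J z (J r v)⟫ = 0 := by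
      intro y hy
      have a3 : ∀ u, J y (J z u) = - J z (J y u) := by
        intro u; rw [anti, hy]; simp
      have h := hU _ hm _ hmr y
      have p1 : ⟪J y (J q v), J r v⟫ = 0 := by rw [real_inner_comm, par]
      rw [hxdef] at h
      simp only [map_sub, map_smul, inner_sub_left, inner_sub_right, inner_smul_left,
        inner_smul_right, a1, a2, a3, map_neg, neg_neg, inner_neg_left, inner_neg_right,
        HT.J_iso J hskew hsq, p1, hskew z] at h
      simp only [conj_trivial, mul_zero, neg_zero, sub_zero, zero_sub] at h
      have h3 : ‖z‖ ^ 2 * ⟪J y (J q v), J z (J r v)⟫ = 0 := by linarith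
      exact (mul_eq_zero.mp h3).resolve_left hzn
    obtain ⟨p, hp⟩ := HT.exists_rep hdim J hsq v (J q v) hv hJq (fun y p => par y p q)
      (J z (J r v)) (fun y => par y z r)
    obtain ⟨t, ht⟩ : ∃ t, t = ⟪p, z⟫ / ‖z‖ ^ 2 := ⟨_, rfl⟩
    have hyz : ⟪p - t • z, z⟫ = 0 := by
      rw [inner_sub_left, inner_smul_left, real_inner_self_eq_norm_sq, ht]
      simp only [conj_trivial]
      field_simp
      ring
    have h4 := orth _ hyz
    rw [hp, same] at h4
    have h5 := (mul_eq_zero.mp h4).resolve_right (by simpa using hJq)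
    have h6 : ⟪p - t • z, p - t • z⟫ = 0 := by
      rw [inner_sub_right, inner_smul_right, h5, hyz]; simp
    have h7 : p = t • z := sub_eq_zero.mp (inner_self_eq_zero.mp h6)
    refine ⟨t, ?_⟩
    have h8 : J z (J (r - t • q) v) = 0 := by
      simp only [map_sub, LinearMap.sub_apply, map_smul, LinearMap.smul_apply, hp, h7, sub_self]
    by_contra hne
    exact J0 _ _ hz (J0 _ _ (sub_ne_zero.mpr hne) hv) h8
  have strip : ∀ q (s : ℝ), J q xp + s • (v + J z v) ∈ U → J q xp ∈ U := by
    intro q s h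
    have := U.sub_mem h (U.smul_mem s hmem)
    simpa using this
  have span2 : ∀ a b : V, U ≤ Submodule.span ℝ {a, b} → Module.finrank ℝ U ≤ 2 := by
    intro a b h
    classical
    refine (Submodule.finrank_mono h).trans ?_
    have := finrank_span_finset_le_card (R := ℝ) ({a, b} : Finset V)
    rw [Finset.coe_pair] at this
    exact this.trans Finset.card_le_two
  by_cases hex : ∃ q : EuclideanSpace ℝ (Fin 8), q ≠ 0 ∧ ⟪z, q⟫ = 0 ∧ J q xp ∈ U
  · obtain ⟨q, hq, hzq, hm⟩ := hex
    refine span2 (J q xp) (v + J z v) ?_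
    intro w hw
    obtain ⟨r, s, hzr, rfl⟩ := rep2 w hw
    obtain ⟨t, rfl⟩ := key q r hq hzq hzr hm (strip _ _ hw)
    rw [Submodule.mem_span_pair]
    exact ⟨t, s, by simp⟩
  · refine span2 0 (v + J z v) ?_
    intro w hw
    obtain ⟨r, s, hzr, rfl⟩ := rep2 w hw
    have : r = 0 := by
      by_contra h
      exact hex ⟨r, h, hzr, strip _ _ hw⟩
    rw [Submodule.mem_span_pair]
    exact ⟨0, s, by simp [this]⟩
end

section
/- Let L ⊆ V be a Lagrangian subspace. Then the orthogonal complement L^⊥ is also Lagrangian, V = L ⊕ L^⊥, and J_z(L) = L^⊥ for every nonzero z ∈ ℝ^m. -/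
open RealInnerProductSpace

/-- A subspace is Lagrangian if it is isotropic of dimension half the dimension of `V`. -/
def LagrangianSub {V : Type*} [AddCommGroup V] [Module ℝ V] {Z : Type*} [Zero Z]
    (bra : V → V → Z) (U : Submodule ℝ V) : Prop :=
  IsotropicSub bra U ∧ 2 * Module.finrank ℝ U = Module.finrank ℝ V

theorem stmt_9 {V : Type*} [NormedAddCommGroup V] [InnerProductSpace ℝ V]
    [FiniteDimensional ℝ V] {m : ℕ} (hm : 1 ≤ m)
    (J : EuclideanSpace ℝ (Fin m) →ₗ[ℝ] V →ₗ[ℝ] V)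
    (hskew : ∀ (z : EuclideanSpace ℝ (Fin m)) (u w : V), ⟪J z u, w⟫ = -⟪u, J z w⟫)
    (hsq : ∀ (z : EuclideanSpace ℝ (Fin m)) (u : V), J z (J z u) = -(‖z‖ ^ 2) • u)
    (bra : V → V → EuclideanSpace ℝ (Fin m))
    (hbra : ∀ (z : EuclideanSpace ℝ (Fin m)) (u w : V), ⟪z, bra u w⟫ = ⟪J z u, w⟫)
    (L : Submodule ℝ V) (hL : LagrangianSub bra L) :
    LagrangianSub bra Lᗮ ∧ IsCompl L Lᗮ ∧
      ∀ z : EuclideanSpace ℝ (Fin m), z ≠ 0 → L.map (J z) = Lᗮ := by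
  obtain ⟨hiso, hdim⟩ := hL
  have hdimc : Module.finrank ℝ L + Module.finrank ℝ Lᗮ = Module.finrank ℝ V :=
    L.finrank_add_finrank_orthogonal
  have hmap : ∀ z : EuclideanSpace ℝ (Fin m), z ≠ 0 → L.map (J z) = Lᗮ := by
    intro z hz
    have hz2 : -(‖z‖ ^ 2) ≠ 0 := neg_ne_zero.mpr (pow_ne_zero 2 (norm_ne_zero_iff.mpr hz))
    have hinj : Function.Injective (J z) := by
      intro u w huw
      have h : J z (J z u) = J z (J z w) := by rw [huw]
      rw [hsq, hsq] at h
      exact smul_right_injective V hz2 h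
    apply Submodule.eq_of_le_of_finrank_eq
    · rintro _ ⟨u, hu, rfl⟩
      rw [Submodule.mem_orthogonal']
      intro w hw
      rw [← hbra, hiso u hu w hw, inner_zero_right]
    · rw [← (Submodule.equivMapOfInjective (J z) hinj L).finrank_eq]
      omega
  refine ⟨⟨?_, by omega⟩, L.isCompl_orthogonal, hmap⟩
  intro u hu w hw
  by_contra hne
  have hu' := hu
  rw [← hmap (bra u w) hne] at hu'
  obtain ⟨l, hl, hlu⟩ := hu'
  apply hne
  have h : ∀ z, J z l = u → ⟪z, bra u w⟫ = 0 := by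
    intro z hz
    rw [hbra, ← hz, hsq, inner_smul_left, (Submodule.mem_orthogonal L w).mp hw l hl, mul_zero]
  exact inner_self_eq_zero.mp (h _ hlu)
end

section
/- Let L ⊆ V be a Lagrangian subspace. Then L is invariant under all double products of the Clifford operators: J_z(J_w(L)) ⊆ L for all z, w ∈ ℝ^m. (Every Lagrangian is a module over the even Clifford algebra C⁺(m).) -/
open RealInnerProductSpace

theorem stmt_10 {V : Type*} [NormedAddCommGroup V] [InnerProductSpace ℝ V]
    [FiniteDimensional ℝ V] {m : ℕ} (hm : 1 ≤ m)
    (J : EuclideanSpace ℝ (Fin m) →ₗ[ℝ] V →ₗ[ℝ] V)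
    (hskew : ∀ (z : EuclideanSpace ℝ (Fin m)) (u w : V), ⟪J z u, w⟫ = -⟪u, J z w⟫)
    (hsq : ∀ (z : EuclideanSpace ℝ (Fin m)) (u : V), J z (J z u) = -(‖z‖ ^ 2) • u)
    (bra : V → V → EuclideanSpace ℝ (Fin m))
    (hbra : ∀ (z : EuclideanSpace ℝ (Fin m)) (u w : V), ⟪z, bra u w⟫ = ⟪J z u, w⟫)
    (L : Submodule ℝ V) (hL : LagrangianSub bra L) :
    ∀ z w : EuclideanSpace ℝ (Fin m), (L.map (J w)).map (J z) ≤ L := by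
  obtain ⟨hiso, hdim⟩ := hL
  have hperp : ∀ z : EuclideanSpace ℝ (Fin m), L.map (J z) ≤ Lᗮ := by
    rintro z _ ⟨u, hu, rfl⟩
    rw [Submodule.mem_orthogonal']
    intro w hw
    rw [← hbra, hiso u hu w hw, inner_zero_right]
  intro z w
  rintro _ ⟨_, ⟨u, hu, rfl⟩, rfl⟩
  by_cases hz : z = 0
  · simp [hz]
  have hz2 : -(‖z‖ ^ 2) ≠ 0 := neg_ne_zero.mpr (pow_ne_zero 2 (norm_ne_zero_iff.mpr hz))
  have hinj : Function.Injective (J z) := by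
    intro a b hab
    have h := congrArg (J z) hab
    rw [hsq, hsq] at h
    exact smul_right_injective V hz2 h
  have hfin : Module.finrank ℝ (L.map (J z)) = Module.finrank ℝ L :=
    (Submodule.equivMapOfInjective (J z) hinj L).finrank_eq.symm
  have hsum := Submodule.finrank_add_finrank_orthogonal L
  have heq : L.map (J z) = Lᗮ :=
    Submodule.eq_of_le_of_finrank_eq (hperp z) (by omega)
  have hmem : J w u ∈ L.map (J z) := heq ▸ hperp w ⟨u, hu, rfl⟩
  obtain ⟨v, hv, hvu⟩ := hmem
  rw [← hvu, hsq]
  exact L.smul_mem _ hv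
end

section
/- Let V and W be real vector spaces, let a, b, a', b' ∈ ℝ, and let A, A', K be linear endomorphisms of V and B, B' linear endomorphisms of W satisfying: A ∘ A = -a • id_V, K ∘ K = id_V, A ∘ K = -K ∘ A, and B ∘ B = -b • id_W. Then the endomorphism T := A ⊗ id_W + K ⊗ B of V ⊗_ℝ W satisfies T ∘ T = -(a + b) • id_{V⊗W}. Moreover, if in addition A' ∘ A' = -a' • id_V, A' ∘ K = -K ∘ A', A ∘ A' + A' ∘ A = 0, B' ∘ B' = -b' • id_W, and B ∘ B' + B' ∘ B = 0, then T' := A' ⊗ id_W + K ⊗ B' satisfies T ∘ T' + T' ∘ T = 0. -/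
open TensorProduct

theorem stmt_11 {V W : Type*} [AddCommGroup V] [Module ℝ V]
    [AddCommGroup W] [Module ℝ W]
    (a b a' b' : ℝ) (A A' K : V →ₗ[ℝ] V) (B B' : W →ₗ[ℝ] W)
    (hA : A ∘ₗ A = -a • LinearMap.id)
    (hK : K ∘ₗ K = LinearMap.id)
    (hAK : A ∘ₗ K = -(K ∘ₗ A))
    (hB : B ∘ₗ B = -b • LinearMap.id) :
    (TensorProduct.map A (LinearMap.id : W →ₗ[ℝ] W) + TensorProduct.map K B) ∘ₗ
        (TensorProduct.map A (LinearMap.id : W →ₗ[ℝ] W) + TensorProduct.map K B) =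
      -(a + b) • (LinearMap.id : V ⊗[ℝ] W →ₗ[ℝ] V ⊗[ℝ] W) ∧
    ((A' ∘ₗ A' = -a' • LinearMap.id) →
      (A' ∘ₗ K = -(K ∘ₗ A')) →
      (A ∘ₗ A' + A' ∘ₗ A = 0) →
      (B' ∘ₗ B' = -b' • LinearMap.id) →
      (B ∘ₗ B' + B' ∘ₗ B = 0) →
      (TensorProduct.map A (LinearMap.id : W →ₗ[ℝ] W) + TensorProduct.map K B) ∘ₗ
          (TensorProduct.map A' (LinearMap.id : W →ₗ[ℝ] W) + TensorProduct.map K B') +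
        (TensorProduct.map A' (LinearMap.id : W →ₗ[ℝ] W) + TensorProduct.map K B') ∘ₗ
          (TensorProduct.map A (LinearMap.id : W →ₗ[ℝ] W) + TensorProduct.map K B) = 0) := by
  have hA1 : ∀ v, A (A v) = -(a • v) := fun v => by simpa using LinearMap.congr_fun hA v
  have hK1 : ∀ v, K (K v) = v := fun v => by simpa using LinearMap.congr_fun hK v
  have hAK1 : ∀ v, A (K v) = -K (A v) := fun v => by simpa using LinearMap.congr_fun hAK v
  have hB1 : ∀ w, B (B w) = -(b • w) := fun w => by simpa using LinearMap.congr_fun hB w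
  constructor
  · apply TensorProduct.ext'
    intro v w
    simp only [LinearMap.comp_apply, LinearMap.add_apply, map_add, TensorProduct.map_tmul,
      LinearMap.id_apply, LinearMap.smul_apply, hA1, hK1, hAK1, hB1, TensorProduct.neg_tmul,
      TensorProduct.tmul_neg, TensorProduct.tmul_smul, ← TensorProduct.smul_tmul']
    module
  · intro _ hAK' hAA _ hBB
    have hAK2 : ∀ v, A' (K v) = -K (A' v) := fun v => by simpa using LinearMap.congr_fun hAK' v
    have hAA1 : ∀ v, A (A' v) = -A' (A v) := fun v =>
      eq_neg_of_add_eq_zero_left (by simpa using LinearMap.congr_fun hAA v)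
    have hBB1 : ∀ w, B (B' w) = -B' (B w) := fun w =>
      eq_neg_of_add_eq_zero_left (by simpa using LinearMap.congr_fun hBB w)
    apply TensorProduct.ext'
    intro v w
    simp only [LinearMap.comp_apply, LinearMap.add_apply, map_add, TensorProduct.map_tmul,
      LinearMap.id_apply, LinearMap.zero_apply, hK1, hAK1, hAK2, hAA1, hBB1,
      TensorProduct.neg_tmul, TensorProduct.tmul_neg]
    abel
end

section
/- Suppose m is odd and let K := J_{e_1} ∘ J_{e_2} ∘ ⋯ ∘ J_{e_m}. If L ⊆ V is a Lagrangian subspace, then K(L) ⊆ L^⊥ and K(L^⊥) ⊆ L, and consequently the trace of K is 0. -/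
open RealInnerProductSpace

theorem prod_swap_aux {V : Type*} [AddCommGroup V] [Module ℝ V] (A B : Submodule ℝ V)
    (l : List (V →ₗ[ℝ] V))
    (h : ∀ f ∈ l, (∀ u ∈ A, f u ∈ B) ∧ (∀ u ∈ B, f u ∈ A)) :
    (Even l.length → (∀ u ∈ A, l.prod u ∈ A) ∧ (∀ u ∈ B, l.prod u ∈ B)) ∧
    (Odd l.length → (∀ u ∈ A, l.prod u ∈ B) ∧ (∀ u ∈ B, l.prod u ∈ A)) := by
  induction l with
  | nil => simp
  | cons f l ih =>
    obtain ⟨h1, h2⟩ := h f (by simp)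
    obtain ⟨ih1, ih2⟩ := ih (fun g hg => h g (by simp [hg]))
    simp only [List.length_cons, List.prod_cons, Module.End.mul_apply]
    constructor
    · intro he
      have ho : Odd l.length := by
        rw [Nat.even_add_one] at he
        exact Nat.not_even_iff_odd.mp he
      exact ⟨fun u hu => h2 _ ((ih2 ho).1 u hu), fun u hu => h1 _ ((ih2 ho).2 u hu)⟩
    · intro ho
      have he : Even l.length := by
        rw [Nat.odd_add_one] at ho
        exact Nat.not_odd_iff_even.mp ho
      exact ⟨fun u hu => h1 _ ((ih1 he).1 u hu), fun u hu => h2 _ ((ih1 he).2 u hu)⟩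

theorem trace_swap_aux {V : Type*} [NormedAddCommGroup V] [InnerProductSpace ℝ V]
    [FiniteDimensional ℝ V] (L : Submodule ℝ V) (K : V →ₗ[ℝ] V)
    (h1 : ∀ u ∈ L, K u ∈ Lᗮ) (h2 : ∀ u ∈ Lᗮ, K u ∈ L) : LinearMap.trace ℝ V K = 0 := by
  let R : V →ₗ[ℝ] V := L.reflection.toLinearEquiv.toLinearMap
  have hRR : R * R = 1 := by
    ext u
    simp [R]
  have hR1 : ∀ u ∈ L, R u = u := fun u hu => Submodule.reflection_mem_subspace_eq_self hu
  have hR2 : ∀ u ∈ Lᗮ, R u = -u := fun u hu =>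
    Submodule.reflection_mem_subspace_orthogonalComplement_eq_neg hu
  have hRK : R * K = -(K * R) := by
    ext u
    obtain ⟨a, ha, b, hb, rfl⟩ := L.exists_add_mem_mem_orthogonal u
    simp only [Module.End.mul_apply, LinearMap.neg_apply, map_add, hR1 a ha, hR2 b hb,
      hR2 _ (h1 a ha), hR1 _ (h2 b hb), map_neg]
    abel
  have e1 : LinearMap.trace ℝ V K = LinearMap.trace ℝ V (R * (R * K)) := by
    rw [← mul_assoc, hRR, one_mul]
  have e2 : LinearMap.trace ℝ V (R * (R * K)) = - LinearMap.trace ℝ V K := by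
    rw [LinearMap.trace_mul_comm, hRK, neg_mul, mul_assoc, hRR, mul_one, map_neg]
  linarith

theorem stmt_12 {V : Type*} [NormedAddCommGroup V] [InnerProductSpace ℝ V]
    [FiniteDimensional ℝ V] {m : ℕ} (hm : 1 ≤ m)
    (J : EuclideanSpace ℝ (Fin m) →ₗ[ℝ] V →ₗ[ℝ] V)
    (hskew : ∀ (z : EuclideanSpace ℝ (Fin m)) (u w : V), ⟪J z u, w⟫ = -⟪u, J z w⟫)
    (hsq : ∀ (z : EuclideanSpace ℝ (Fin m)) (u : V), J z (J z u) = -(‖z‖ ^ 2) • u)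
    (bra : V → V → EuclideanSpace ℝ (Fin m))
    (hbra : ∀ (z : EuclideanSpace ℝ (Fin m)) (u w : V), ⟪z, bra u w⟫ = ⟪J z u, w⟫)
    (hodd : Odd m) (K : V →ₗ[ℝ] V)
    (hK : K = (List.ofFn fun i : Fin m => J (stdBasis m i)).prod)
    (L : Submodule ℝ V) (hL : LagrangianSub bra L) :
    (∀ u ∈ L, K u ∈ Lᗮ) ∧ (∀ u ∈ Lᗮ, K u ∈ L) ∧
      LinearMap.trace ℝ V K = 0 := by
  obtain ⟨hiso, hdim⟩ := hL
  have hswap : ∀ i : Fin m, (∀ u ∈ L, J (stdBasis m i) u ∈ Lᗮ) ∧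
      (∀ u ∈ Lᗮ, J (stdBasis m i) u ∈ L) := by
    intro i
    have hsq' : ∀ u, J (stdBasis m i) (J (stdBasis m i) u) = -u := by
      intro u
      rw [hsq]
      simp [stdBasis]
    have h1 : ∀ u ∈ L, J (stdBasis m i) u ∈ Lᗮ := by
      intro u hu
      rw [Submodule.mem_orthogonal']
      intro w hw
      rw [← hbra, hiso u hu w hw, inner_zero_right]
    have hinj : Function.Injective (J (stdBasis m i)) := by
      intro a b hab
      have := congrArg (J (stdBasis m i)) hab
      rw [hsq', hsq'] at this
      exact neg_injective this
    have hmap : L.map (J (stdBasis m i)) = Lᗮ := by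
      apply Submodule.eq_of_le_of_finrank_eq
      · rintro _ ⟨u, hu, rfl⟩
        exact h1 u hu
      · have e1 := (Submodule.equivMapOfInjective _ hinj L).finrank_eq
        have e2 := L.finrank_add_finrank_orthogonal
        omega
    refine ⟨h1, ?_⟩
    intro u hu
    rw [← hmap] at hu
    obtain ⟨v, hv, rfl⟩ := hu
    rw [hsq']
    exact L.neg_mem hv
  have hk := (prod_swap_aux L Lᗮ (List.ofFn fun i : Fin m => J (stdBasis m i)) (by
    intro f hf
    obtain ⟨i, rfl⟩ := (List.mem_ofFn' _ _).mp hf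
    exact hswap i)).2 (by simpa using hodd)
  rw [← hK] at hk
  exact ⟨hk.1, hk.2, trace_swap_aux L K hk.1 hk.2⟩
end

section
/- Suppose m ≡ 0 (mod 4) and V ≠ 0, and let K := J_{e_1} ∘ ⋯ ∘ J_{e_m}. Then K ∘ K = id_V, K is self-adjoint, and K ∘ J_z = -J_z ∘ K for every z ∈ ℝ^m. Moreover, the eigenspaces W_+ := ker(K - id) and W_- := ker(K + id) satisfy J_z(W_+) = W_- for every nonzero z, and both W_+ and W_- are Lagrangian subspaces of V. -/
open RealInnerProductSpace

theorem hAux_anti {R : Type*} [Ring R] (x : R) (l : List R)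
    (h : ∀ y ∈ l, y * x = -(x * y)) : l.prod * x = (-1) ^ l.length * (x * l.prod) := by
  induction l with
  | nil => simp
  | cons a t ih =>
    have h1 := ih (fun y hy => h y (List.mem_cons_of_mem _ hy))
    have h2 := h a List.mem_cons_self
    rw [List.prod_cons, List.length_cons, mul_assoc, h1]
    rcases neg_one_pow_eq_or R t.length with e | e <;>
      simp [pow_succ, e, ← mul_assoc, h2]

theorem hAux_sq {R : Type*} [Ring R] (l : List R) (hs : ∀ y ∈ l, y * y = -1)
    (h : l.Pairwise fun a b => b * a = -(a * b)) :
    l.prod * l.prod = (-1) ^ (∑ i ∈ Finset.range (l.length + 1), i) := by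
  induction l with
  | nil => simp
  | cons a t ih =>
    rw [List.pairwise_cons] at h
    have h1 := ih (fun y hy => hs y (List.mem_cons_of_mem _ hy)) h.2
    have h2 := hs a List.mem_cons_self
    have h3 := hAux_anti a t h.1
    rw [List.length_cons, Finset.sum_range_succ, pow_add, ← h1, List.prod_cons]
    have : a * t.prod * (a * t.prod) = a * (t.prod * a) * t.prod := by noncomm_ring
    rw [this, h3, pow_succ]
    rcases neg_one_pow_eq_or R t.length with e | e <;>
      simp [e, ← mul_assoc, h2]

theorem hAux_mem {R : Type*} [Ring R] (l : List R)
    (h : l.Pairwise fun a b => b * a = -(a * b)) (x : R) (hx : x ∈ l) :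
    l.prod * x = (-1) ^ (l.length + 1) * (x * l.prod) := by
  induction l with
  | nil => simp at hx
  | cons a t ih =>
    rw [List.pairwise_cons] at h
    rw [List.prod_cons, List.length_cons, mul_assoc]
    rcases List.mem_cons.1 hx with rfl | hx
    · rw [hAux_anti x t h.1]
      rcases neg_one_pow_eq_or R t.length with e | e <;> simp [pow_succ, e]
    · rw [ih h.2 hx]
      have h2 : a * x = -(x * a) := by rw [h.1 x hx, neg_neg]
      rcases neg_one_pow_eq_or R t.length with e | e <;>
        simp [pow_succ, e, ← mul_assoc, h2]

theorem hAux_isom {V : Type*} [NormedAddCommGroup V] [InnerProductSpace ℝ V]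
    (l : List (V →ₗ[ℝ] V)) (h : ∀ f ∈ l, ∀ u w : V, ⟪f u, f w⟫ = ⟪u, w⟫) (u w : V) :
    ⟪l.prod u, l.prod w⟫ = ⟪u, w⟫ := by
  induction l with
  | nil => simp
  | cons a t ih =>
    rw [List.prod_cons, Module.End.mul_apply, Module.End.mul_apply, h a List.mem_cons_self]
    exact ih (fun y hy => h y (List.mem_cons_of_mem _ hy))

theorem stmt_13 {V : Type*} [NormedAddCommGroup V] [InnerProductSpace ℝ V]
    [FiniteDimensional ℝ V] {m : ℕ} (hm : 1 ≤ m)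
    (J : EuclideanSpace ℝ (Fin m) →ₗ[ℝ] V →ₗ[ℝ] V)
    (hskew : ∀ (z : EuclideanSpace ℝ (Fin m)) (u w : V), ⟪J z u, w⟫ = -⟪u, J z w⟫)
    (hsq : ∀ (z : EuclideanSpace ℝ (Fin m)) (u : V), J z (J z u) = -(‖z‖ ^ 2) • u)
    (bra : V → V → EuclideanSpace ℝ (Fin m))
    (hbra : ∀ (z : EuclideanSpace ℝ (Fin m)) (u w : V), ⟪z, bra u w⟫ = ⟪J z u, w⟫)
    [Nontrivial V] (h4 : m % 4 = 0) (K : V →ₗ[ℝ] V)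
    (hK : K = (List.ofFn fun i : Fin m => J (stdBasis m i)).prod) :
    K ∘ₗ K = LinearMap.id ∧
    (∀ u w : V, ⟪K u, w⟫ = ⟪u, K w⟫) ∧
    (∀ z : EuclideanSpace ℝ (Fin m), K ∘ₗ J z = -(J z ∘ₗ K)) ∧
    (∀ z : EuclideanSpace ℝ (Fin m), z ≠ 0 →
      (LinearMap.ker (K - LinearMap.id)).map (J z) = LinearMap.ker (K + LinearMap.id)) ∧
    LagrangianSub bra (LinearMap.ker (K - LinearMap.id)) ∧
    LagrangianSub bra (LinearMap.ker (K + LinearMap.id)) := by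
  have hsqe : ∀ i, J (stdBasis m i) * J (stdBasis m i) = -1 := by
    intro i
    ext u
    simp [Module.End.mul_apply, hsq, stdBasis]
  have hanti : ∀ i j, i ≠ j → J (stdBasis m j) * J (stdBasis m i) =
      -(J (stdBasis m i) * J (stdBasis m j)) := by
    intro i j hij
    ext u
    have h1 := hsq (stdBasis m i + stdBasis m j) u
    have hn : ‖stdBasis m i + stdBasis m j‖ ^ 2 = 2 := by
      rw [norm_add_sq_real]
      have : ⟪stdBasis m i, stdBasis m j⟫ = 0 := by
        simp [stdBasis, EuclideanSpace.inner_single_left, hij]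
      rw [this]
      simp [stdBasis]
      norm_num
    have h2 := hsq (stdBasis m i) u
    have h3 := hsq (stdBasis m j) u
    have hn1 : ∀ i, ‖stdBasis m i‖ = 1 := by intro i; simp [stdBasis]
    rw [hn] at h1
    rw [hn1] at h2 h3
    simp only [map_add, LinearMap.add_apply, h2, h3] at h1
    simp only [Module.End.mul_apply, LinearMap.neg_apply]
    rw [eq_neg_iff_add_eq_zero]
    linear_combination (norm := module) h1
  set l := List.ofFn fun i : Fin m => J (stdBasis m i) with hl
  have hlen : l.length = m := by simp [hl]
  have hpw : l.Pairwise fun a b => b * a = -(a * b) := by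
    rw [hl, List.pairwise_ofFn]
    intro i j hij
    exact hanti i j hij.ne
  have hKK1 : K * K = 1 := by
    rw [hK, hAux_sq l (by
      intro y hy
      rw [hl, List.mem_ofFn] at hy
      obtain ⟨i, rfl⟩ := hy
      exact hsqe i) hpw, hlen]
    apply Even.neg_one_pow
    obtain ⟨k, rfl⟩ : ∃ k, m = 4 * k := ⟨m / 4, by omega⟩
    have := Finset.sum_range_id_mul_two (4 * k + 1)
    refine ⟨k * (4 * k + 1), ?_⟩
    simp only [Nat.add_sub_cancel] at this
    nlinarith
  have hKKa : ∀ u, K (K u) = u := fun u => by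
    rw [← Module.End.mul_apply, hKK1]; rfl
  have hiso : ∀ u w : V, ⟪K u, K w⟫ = ⟪u, w⟫ := by
    rw [hK]
    apply hAux_isom
    intro f hf u w
    rw [hl, List.mem_ofFn] at hf
    obtain ⟨i, rfl⟩ := hf
    rw [hskew, hsq]
    simp [stdBasis]
  have hsa : ∀ u w : V, ⟪K u, w⟫ = ⟪u, K w⟫ := by
    intro u w
    rw [← hiso u (K w), hKKa]
  have hKJe : ∀ i, K * J (stdBasis m i) = -(J (stdBasis m i) * K) := by
    intro i
    have h := hAux_mem l hpw (J (stdBasis m i)) (by rw [hl, List.mem_ofFn]; exact ⟨i, rfl⟩)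
    rw [hlen, Odd.neg_one_pow (by rw [Nat.odd_iff]; omega), ← hK] at h
    rw [h]; simp
  have hKJ : ∀ z, K ∘ₗ J z = -(J z ∘ₗ K) := by
    have : (LinearMap.mulLeft ℝ K) ∘ₗ J = -((LinearMap.mulRight ℝ K) ∘ₗ J) := by
      apply (EuclideanSpace.basisFun (Fin m) ℝ).toBasis.ext
      intro i
      have := hKJe i
      simpa [stdBasis] using this
    intro z
    exact LinearMap.congr_fun this z
  have hKJa : ∀ z u, K (J z u) = -(J z (K u)) := fun z u => LinearMap.congr_fun (hKJ z) u
  have hp : ∀ u, u ∈ LinearMap.ker (K - LinearMap.id) ↔ K u = u := by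
    intro u; simp [sub_eq_zero]
  have hn : ∀ u, u ∈ LinearMap.ker (K + LinearMap.id) ↔ K u = -u := by
    intro u; simp [add_eq_zero_iff_eq_neg]
  have hmap : ∀ z : EuclideanSpace ℝ (Fin m), z ≠ 0 →
      (LinearMap.ker (K - LinearMap.id)).map (J z) = LinearMap.ker (K + LinearMap.id) := by
    intro z hz
    have hz2 : ‖z‖ ^ 2 ≠ 0 := pow_ne_zero _ (norm_ne_zero_iff.2 hz)
    ext w
    rw [Submodule.mem_map, hn]
    constructor
    · rintro ⟨u, hu, rfl⟩
      rw [hp] at hu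
      rw [hKJa, hu]
    · intro hw
      refine ⟨-(‖z‖ ^ 2)⁻¹ • J z w, ?_, ?_⟩
      · rw [hp, map_smul, hKJa, hw]; simp
      · rw [map_smul, hsq, smul_smul]
        rw [neg_mul_neg, inv_mul_cancel₀ hz2, one_smul]
  have hbra0 : ∀ u w, (∀ z, ⟪J z u, w⟫ = 0) → bra u w = 0 := by
    intro u w h
    rw [← inner_self_eq_zero (𝕜 := ℝ), hbra, h]
  have hinj : ∀ z, z ≠ 0 → Function.Injective (J z) := by
    intro z hz
    rw [injective_iff_map_eq_zero]
    intro u hu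
    have h := hsq z u
    rw [hu, map_zero] at h
    have hz2 : -(‖z‖ ^ 2) ≠ 0 := neg_ne_zero.2 (pow_ne_zero _ (norm_ne_zero_iff.2 hz))
    exact (smul_eq_zero.1 h.symm).resolve_left hz2
  have hdim : Module.finrank ℝ (LinearMap.ker (K - LinearMap.id)) =
      Module.finrank ℝ (LinearMap.ker (K + LinearMap.id)) := by
    have hz : stdBasis m ⟨0, hm⟩ ≠ 0 := by simp [stdBasis]
    rw [← hmap _ hz]
    exact (LinearEquiv.finrank_eq (Submodule.equivMapOfInjective _ (hinj _ hz) _).symm).symm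
  have hcompl : IsCompl (LinearMap.ker (K - LinearMap.id)) (LinearMap.ker (K + LinearMap.id)) := by
    constructor
    · rw [Submodule.disjoint_def]
      intro u h1 h2
      rw [hp] at h1
      rw [hn, h1] at h2
      have h3 : (2 : ℝ) • u = 0 := by
        rw [two_smul]; exact add_eq_zero_iff_eq_neg.2 h2
      exact (smul_eq_zero.1 h3).resolve_left two_ne_zero
    · rw [codisjoint_iff, eq_top_iff]
      intro u _
      rw [Submodule.mem_sup]
      refine ⟨(1 / 2 : ℝ) • (u + K u), ?_, (1 / 2 : ℝ) • (u - K u), ?_, ?_⟩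
      · rw [hp, map_smul, map_add, hKKa, add_comm]
      · rw [hn, map_smul, map_sub, hKKa, ← smul_neg, neg_sub]
      · module
  have hsum := Submodule.finrank_add_eq_of_isCompl hcompl
  refine ⟨hKK1, hsa, hKJ, hmap, ⟨?_, by omega⟩, ⟨?_, by omega⟩⟩
  · intro u hu w hw
    apply hbra0
    intro z
    rw [hp] at hu hw
    have := hsa (J z u) w
    rw [hKJa, hu, hw, inner_neg_left] at this
    linarith
  · intro u hu w hw
    apply hbra0
    intro z
    rw [hn] at hu hw
    have := hsa (J z u) w
    rw [hKJa, hu, hw, map_neg, neg_neg, inner_neg_right] at this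
    linarith
end

section
/- Suppose m ≡ 0 (mod 4), let K := J_{e_1} ∘ ⋯ ∘ J_{e_m} and W_+ := ker(K - id). If L₁ ⊆ W_+ is a subspace invariant under J_z ∘ J_w for all z, w ∈ ℝ^m, then L := L₁ + J_{e_m}(W_+ ∩ L₁^⊥) is a Lagrangian subspace of V (here L₁^⊥ is the orthogonal complement of L₁ in V). -/
open RealInnerProductSpace

theorem hl_anti {A ι : Type*} [Ring A] (f : ι → A)
    (hac : ∀ i k, i ≠ k → f i * f k = -(f k * f i)) (i : ι) (l : List ι) :
    l.Nodup → (i ∉ l → f i * (l.map f).prod = (-1) ^ l.length * ((l.map f).prod * f i)) ∧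
      (i ∈ l → f i * (l.map f).prod = - ((-1) ^ l.length * ((l.map f).prod * f i))) := by
  have hc : ∀ (n : ℕ) (x : A), x * (-1) ^ n = (-1) ^ n * x := fun n x =>
    ((Commute.neg_one_right x).pow_right n).eq
  induction l with
  | nil => simp
  | cons a t ih =>
    intro hn
    obtain ⟨hat, ht⟩ := List.nodup_cons.mp hn
    obtain ⟨h1, h2⟩ := ih ht
    simp only [List.map_cons, List.prod_cons, List.length_cons]
    constructor
    · intro hi
      obtain ⟨hia, hit⟩ := not_or.mp (by simpa using hi)
      rw [← mul_assoc, hac i a hia, neg_mul, mul_assoc, h1 hit, ← mul_assoc, hc, pow_succ]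
      noncomm_ring
    · intro hi
      by_cases hia : i = a
      · subst hia
        rw [h1 hat, pow_succ, ← mul_assoc, hc]
        have := h1 hat
        rw [mul_assoc, mul_assoc, ← mul_assoc (f i) (List.map f t).prod, this]
        have h3 : ((-1 : A) ^ t.length) * (-1) ^ t.length = 1 := by
          rw [← pow_add, Even.neg_one_pow ⟨_, rfl⟩]
        noncomm_ring
      · have hit : i ∈ t := by simpa [hia] using hi
        rw [← mul_assoc, hac i a hia, neg_mul, mul_assoc, h2 hit, mul_neg, ← mul_assoc (f a), hc,
          pow_succ]
        noncomm_ring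

theorem hl_sq {A ι : Type*} [Ring A] (f : ι → A)
    (hac : ∀ i k, i ≠ k → f i * f k = -(f k * f i)) (hs : ∀ i, f i * f i = -1) (l : List ι) :
    l.Nodup → (l.map f).prod * (l.map f).prod = (-1) ^ (∑ k ∈ Finset.range (l.length + 1), k) := by
  induction l with
  | nil => simp
  | cons a t ih =>
    intro hn
    obtain ⟨hat, ht⟩ := List.nodup_cons.mp hn
    have h1 := (hl_anti f hac a t ht).1 hat
    have hc : ∀ (n : ℕ) (x : A), x * (-1) ^ n = (-1) ^ n * x := fun n x =>
      ((Commute.neg_one_right x).pow_right n).eq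
    have h3 : ((-1 : A) ^ t.length) * (-1) ^ t.length = 1 := by
      rw [← pow_add, Even.neg_one_pow ⟨_, rfl⟩]
    have h4 : (t.map f).prod * f a = (-1) ^ t.length * (f a * (t.map f).prod) := by
      rw [h1, ← mul_assoc, h3, one_mul]
    simp only [List.map_cons, List.prod_cons, List.length_cons]
    rw [Finset.sum_range_succ, pow_add, ← ih ht]
    calc f a * (t.map f).prod * (f a * (t.map f).prod)
        = f a * ((t.map f).prod * f a) * (t.map f).prod := by noncomm_ring
      _ = (f a * (-1) ^ t.length) * (f a * (t.map f).prod * (t.map f).prod) := by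
          rw [h4]; noncomm_ring
      _ = (-1) ^ t.length * ((f a * f a) * ((t.map f).prod * (t.map f).prod)) := by
          rw [hc]; noncomm_ring
      _ = _ := by rw [hs, hc, pow_succ]; noncomm_ring

theorem stmt_14 {V : Type*} [NormedAddCommGroup V] [InnerProductSpace ℝ V]
    [FiniteDimensional ℝ V] {m : ℕ} (hm : 1 ≤ m)
    (J : EuclideanSpace ℝ (Fin m) →ₗ[ℝ] V →ₗ[ℝ] V)
    (hskew : ∀ (z : EuclideanSpace ℝ (Fin m)) (u w : V), ⟪J z u, w⟫ = -⟪u, J z w⟫)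
    (hsq : ∀ (z : EuclideanSpace ℝ (Fin m)) (u : V), J z (J z u) = -(‖z‖ ^ 2) • u)
    (bra : V → V → EuclideanSpace ℝ (Fin m))
    (hbra : ∀ (z : EuclideanSpace ℝ (Fin m)) (u w : V), ⟪z, bra u w⟫ = ⟪J z u, w⟫)
    (h4 : m % 4 = 0) (K : V →ₗ[ℝ] V)
    (hK : K = (List.ofFn fun i : Fin m => J (stdBasis m i)).prod)
    (L₁ : Submodule ℝ V) (hL₁ : L₁ ≤ LinearMap.ker (K - LinearMap.id))
    (hinv : ∀ (z w : EuclideanSpace ℝ (Fin m)), ∀ u ∈ L₁, J z (J w u) ∈ L₁) :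
    LagrangianSub bra
      (L₁ ⊔ (LinearMap.ker (K - LinearMap.id) ⊓ L₁ᗮ).map
        (J (stdBasis m ⟨m - 1, by omega⟩))) := by
  set e : Fin m → EuclideanSpace ℝ (Fin m) := stdBasis m with he
  let f : Fin m → Module.End ℝ V := fun i => J (e i)
  have hne : ∀ i, ‖e i‖ = 1 := fun i => by simp [he, stdBasis]
  have hpol : ∀ z w u, J z (J w u) + J w (J z u) = (-2 * ⟪z, w⟫) • u := by
    intro z w u
    have h1 := hsq (z + w) u
    rw [norm_add_sq_real] at h1
    simp only [map_add, LinearMap.add_apply, hsq] at h1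
    have h2 : J z (J w u) + J w (J z u) =
      (-(‖z‖ ^ 2) • u + J w (J z u) + (J z (J w u) + -(‖w‖ ^ 2) • u)) + (‖z‖^2 + ‖w‖^2) • u := by
      module
    rw [h2]
    have h3 : -(‖z‖ ^ 2) • u + J w (J z u) + (J z (J w u) + -(‖w‖ ^ 2) • u) =
      -(‖z‖ ^ 2 + 2 * ⟪z, w⟫ + ‖w‖ ^ 2) • u := by rw [← h1]
    rw [h3]; module
  have hs : ∀ i, f i * f i = -1 := by
    intro i; ext u
    simp [f, hsq, hne]
  have hac : ∀ i k, i ≠ k → f i * f k = -(f k * f i) := by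
    intro i k hik; ext u
    have := hpol (e i) (e k) u
    have h0 : ⟪e i, e k⟫ = 0 := by
      simp [he, stdBasis, EuclideanSpace.inner_single_left, hik]
    rw [h0] at this
    simp only [mul_zero, zero_smul] at this
    exact eq_neg_of_add_eq_zero_left this
  have hK' : K = ((List.finRange m).map f).prod := by
    rw [hK, List.ofFn_eq_map]
  have hnd := List.nodup_finRange m
  have heven : Even m := by rw [Nat.even_iff]; omega
  have hKf : ∀ i u, J (e i) (K u) = - K (J (e i) u) := by
    intro i u
    have h := (hl_anti f hac i _ hnd).2 (List.mem_finRange i)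
    rw [← hK', List.length_finRange, heven.neg_one_pow, one_mul] at h
    exact congrArg (fun g : Module.End ℝ V => g u) h
  have hKJ : ∀ z u, K (J z u) = - J z (K u) := by
    intro z u
    have hz : z = ∑ i, z i • e i := by
      have := (EuclideanSpace.basisFun (Fin m) ℝ).sum_repr z
      simpa [he, stdBasis] using this.symm
    rw [hz]
    simp only [map_sum, map_smul, LinearMap.sum_apply, LinearMap.smul_apply, hKf]
    simp
  have hKK : ∀ u, K (K u) = u := by
    intro u
    have h := hl_sq f hac hs _ hnd
    have hev : Even (∑ k ∈ Finset.range (m + 1), k) := by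
      obtain ⟨k, hk⟩ : ∃ k, m = 4 * k := ⟨m / 4, by omega⟩
      have := Finset.sum_range_id_mul_two (m + 1)
      rw [Nat.add_sub_cancel] at this
      refine ⟨(4 * k + 1) * k, ?_⟩
      subst hk
      nlinarith
    rw [← hK', List.length_finRange, hev.neg_one_pow] at h
    exact congrArg (fun g : Module.End ℝ V => g u) h
  have hKi : ∀ u w, ⟪K u, K w⟫ = ⟪u, w⟫ := by
    rw [hK']
    generalize List.finRange m = l
    induction l with
    | nil => simp
    | cons a t ih =>
      intro u w
      simp only [List.map_cons, List.prod_cons, Module.End.mul_apply]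
      rw [← ih u w]
      simp only [f]
      rw [hskew, hsq, hne]
      simp
  have hWp : ∀ u, u ∈ LinearMap.ker (K - LinearMap.id) ↔ K u = u := by
    intro u; simp [sub_eq_zero]
  have hWm : ∀ u, u ∈ LinearMap.ker (K + LinearMap.id) ↔ K u = -u := by
    intro u; simp [add_eq_zero_iff_eq_neg]
  have hperp : ∀ u w, K u = u → K w = -w → ⟪u, w⟫ = 0 := by
    intro u w hu hw
    have := hKi u w
    rw [hu, hw, inner_neg_right] at this
    linarith
  have hperp' : ∀ u w, K u = -u → K w = w → ⟪u, w⟫ = 0 := by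
    intro u w hu hw
    rw [real_inner_comm]; exact hperp w u hw hu
  set Wp := LinearMap.ker (K - LinearMap.id) with hWpd
  set Wm := LinearMap.ker (K + LinearMap.id) with hWmd
  have hpm : ∀ z u, K u = u → K (J z u) = -(J z u) := fun z u h => by rw [hKJ, h]
  have hmp : ∀ z u, K u = -u → K (J z u) = J z u := fun z u h => by rw [hKJ, h]; simp
  generalize e ⟨m - 1, by omega⟩ = E, hne ⟨m - 1, by omega⟩ = hE
  have hinj : Function.Injective (J E) := by
    intro u w h
    have := congrArg (J E) h
    simpa [hsq, hE] using this
  have hmix : ∀ z, ∀ u ∈ L₁, ∀ p ∈ L₁ᗮ, ⟪J z u, J E p⟫ = 0 := by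
    intro z u hu p hp
    have h := hskew E (J z u) p
    rw [(Submodule.mem_orthogonal _ _).mp hp _ (hinv E z u hu)] at h
    linarith
  have hfr : ∀ S : Submodule ℝ V, Module.finrank ℝ (S.map (J E)) = Module.finrank ℝ S :=
    fun S => (Submodule.equivMapOfInjective _ hinj S).finrank_eq.symm
  have hdisj : Wp ⊓ Wm = ⊥ := by
    rw [Submodule.eq_bot_iff]
    rintro u ⟨h1, h2⟩
    exact inner_self_eq_zero.mp (hperp u u ((hWp u).1 h1) ((hWm u).1 h2))
  refine ⟨?_, ?_⟩
  · intro u hu w hw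
    refine ext_inner_left ℝ fun z => ?_
    rw [hbra, inner_zero_right]
    obtain ⟨a, ha, _, ⟨p, ⟨hp, hp'⟩, rfl⟩, rfl⟩ := Submodule.mem_sup.mp hu
    obtain ⟨b, hb, _, ⟨q, ⟨hq, hq'⟩, rfl⟩, rfl⟩ := Submodule.mem_sup.mp hw
    have ha' := (hWp a).1 (hL₁ ha)
    have hb' := (hWp b).1 (hL₁ hb)
    have hp2 := (hWp p).1 hp
    have hq2 := (hWp q).1 hq
    rw [map_add, inner_add_left, inner_add_right, inner_add_right,
      hperp' _ _ (hpm z a ha') hb', hmix z a ha q hq',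
      hperp _ _ (hmp z _ (hpm E p hp2)) (hpm E q hq2), hskew z (J E p) b,
      real_inner_comm, hmix z b hb p hp']
    simp
  · have hsum : Wp ⊔ Wm = ⊤ := by
      rw [eq_top_iff]
      intro u _
      refine Submodule.mem_sup.mpr ⟨(1/2 : ℝ) • (u + K u), (hWp _).2 ?_,
        (1/2 : ℝ) • (u - K u), (hWm _).2 ?_, ?_⟩
      · simp [hKK, add_comm]
      · simp only [map_smul, map_sub, hKK]; module
      · module
    have d1 := Submodule.finrank_sup_add_finrank_inf_eq Wp Wm
    rw [hsum, hdisj, finrank_top, finrank_bot] at d1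
    have d2 : Module.finrank ℝ Wp ≤ Module.finrank ℝ Wm := by
      rw [← hfr Wp]
      apply Submodule.finrank_mono
      rintro _ ⟨u, hu, rfl⟩
      exact (hWm _).2 (hpm E u ((hWp u).1 hu))
    have d3 : Module.finrank ℝ Wm ≤ Module.finrank ℝ Wp := by
      rw [← hfr Wm]
      apply Submodule.finrank_mono
      rintro _ ⟨u, hu, rfl⟩
      exact (hWp _).2 (hmp E u ((hWm u).1 hu))
    have d4 := Submodule.finrank_add_inf_finrank_orthogonal hL₁
    rw [inf_comm] at d4
    have d5 := Submodule.finrank_sup_add_finrank_inf_eq L₁ ((Wp ⊓ L₁ᗮ).map (J E))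
    have d6 : L₁ ⊓ (Wp ⊓ L₁ᗮ).map (J E) = ⊥ := by
      rw [eq_bot_iff, ← hdisj]
      refine inf_le_inf hL₁ ?_
      rintro _ ⟨u, hu, rfl⟩
      exact (hWm _).2 (hpm E u ((hWp u).1 hu.1))
    rw [d6, finrank_bot, hfr] at d5
    omega
end

section
/- Suppose m is even and let K := J_{e_1} ∘ ⋯ ∘ J_{e_m}. Let L ⊆ V be a subspace with dim L = (dim V)/2 which is isotropic with respect to the first m-1 directions, i.e. ⟪J_{e_i} u, w⟫ = 0 for all u, w ∈ L and all 1 ≤ i ≤ m-1. Then L is isotropic for the full H-type structure (⟪J_z u, w⟫ = 0 for all z ∈ ℝ^m and u, w ∈ L) if and only if K(L) ⊆ L. (A Lagrangian of the C(m)-structure is the same as a K-invariant Lagrangian of the C(m-1)-structure.) -/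
open RealInnerProductSpace

theorem swap_aux {V : Type*} [NormedAddCommGroup V] [InnerProductSpace ℝ V]
    [FiniteDimensional ℝ V] (T : V →ₗ[ℝ] V) (hT : ∀ u, T (T u) = -u)
    (L : Submodule ℝ V) (hdim : 2 * Module.finrank ℝ L = Module.finrank ℝ V)
    (h : ∀ u ∈ L, ∀ w ∈ L, ⟪T u, w⟫ = 0) :
    (∀ x, T x ∈ L ↔ x ∈ Lᗮ) ∧ (∀ x, T x ∈ Lᗮ ↔ x ∈ L) := by
  have h1 : ∀ x ∈ L, T x ∈ Lᗮ := by
    intro x hx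
    rw [Submodule.mem_orthogonal']
    exact fun w hw => h x hx w hw
  have hinj : Function.Injective T := by
    intro a b hab
    have := congrArg T hab
    simpa [hT] using this
  have hmap : L.map T = Lᗮ := by
    apply Submodule.eq_of_le_of_finrank_eq
    · rintro _ ⟨x, hx, rfl⟩
      exact h1 x hx
    · rw [← (Submodule.equivMapOfInjective T hinj L).finrank_eq]
      have := L.finrank_add_finrank_orthogonal
      omega
  have h2 : ∀ x ∈ Lᗮ, T x ∈ L := by
    intro x hx
    rw [← hmap] at hx
    obtain ⟨y, hy, rfl⟩ := hx
    rw [hT]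
    exact L.neg_mem hy
  refine ⟨fun x => ⟨fun hx => ?_, h2 x⟩, fun x => ⟨fun hx => ?_, h1 x⟩⟩
  · have := h1 _ hx
    rw [hT] at this
    simpa using this
  · have := h2 _ hx
    rw [hT] at this
    simpa using this

theorem list_aux {V : Type*} [NormedAddCommGroup V] [InnerProductSpace ℝ V]
    (L : Submodule ℝ V) (l : List (V →ₗ[ℝ] V))
    (h : ∀ T ∈ l, (∀ x, T x ∈ L ↔ x ∈ Lᗮ) ∧ (∀ x, T x ∈ Lᗮ ↔ x ∈ L)) :
    (l.length % 2 = 0 → (∀ x, l.prod x ∈ L ↔ x ∈ L) ∧ (∀ x, l.prod x ∈ Lᗮ ↔ x ∈ Lᗮ)) ∧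
    (l.length % 2 = 1 → (∀ x, l.prod x ∈ L ↔ x ∈ Lᗮ) ∧ (∀ x, l.prod x ∈ Lᗮ ↔ x ∈ L)) := by
  induction l with
  | nil => simp
  | cons T l ih =>
    obtain ⟨i1, i2⟩ := ih (fun S hS => h S (List.mem_cons_of_mem _ hS))
    obtain ⟨a, b⟩ := h T List.mem_cons_self
    simp only [List.length_cons, List.prod_cons, Module.End.mul_apply, a, b]
    constructor
    · intro hl
      obtain ⟨c, d⟩ := i2 (by omega)
      exact ⟨d, c⟩
    · intro hl
      obtain ⟨c, d⟩ := i1 (by omega)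
      exact ⟨d, c⟩

theorem stmt_16 {V : Type*} [NormedAddCommGroup V] [InnerProductSpace ℝ V]
    [FiniteDimensional ℝ V] {m : ℕ} (hm : 1 ≤ m)
    (J : EuclideanSpace ℝ (Fin m) →ₗ[ℝ] V →ₗ[ℝ] V)
    (hskew : ∀ (z : EuclideanSpace ℝ (Fin m)) (u w : V), ⟪J z u, w⟫ = -⟪u, J z w⟫)
    (hsq : ∀ (z : EuclideanSpace ℝ (Fin m)) (u : V), J z (J z u) = -(‖z‖ ^ 2) • u)
    (bra : V → V → EuclideanSpace ℝ (Fin m))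
    (hbra : ∀ (z : EuclideanSpace ℝ (Fin m)) (u w : V), ⟪z, bra u w⟫ = ⟪J z u, w⟫)
    (heven : m % 2 = 0) (K : V →ₗ[ℝ] V)
    (hK : K = (List.ofFn fun i : Fin m => J (stdBasis m i)).prod)
    (L : Submodule ℝ V)
    (hdim : 2 * Module.finrank ℝ L = Module.finrank ℝ V)
    (hiso' : ∀ i : Fin m, (i : ℕ) < m - 1 →
      ∀ u ∈ L, ∀ w ∈ L, ⟪J (stdBasis m i) u, w⟫ = 0) :
    (∀ z : EuclideanSpace ℝ (Fin m), ∀ u ∈ L, ∀ w ∈ L, ⟪J z u, w⟫ = 0) ↔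
      ∀ u ∈ L, K u ∈ L := by
  obtain ⟨n, rfl⟩ : ∃ n, m = n + 1 := ⟨m - 1, by omega⟩
  have hT : ∀ i u, J (stdBasis (n + 1) i) (J (stdBasis (n + 1) i) u) = -u := by
    intro i u
    rw [hsq]
    simp [stdBasis]
  have hsw : ∀ i : Fin (n + 1), (i : ℕ) < n + 1 - 1 → _ := fun i hi =>
    swap_aux (J (stdBasis (n + 1) i)) (hT i) L hdim (hiso' i hi)
  constructor
  · intro h u hu
    rw [hK]
    refine (((list_aux L _ ?_).1 (by simpa using heven)).1 u).2 hu
    intro T hTm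
    obtain ⟨i, rfl⟩ := (List.mem_ofFn' _ _).1 hTm
    exact swap_aux _ (hT i) L hdim (h _)
  · intro h
    have hlast : ∀ u ∈ L, J (stdBasis (n + 1) (Fin.last n)) u ∈ Lᗮ := by
      intro u hu
      have hu' := h u hu
      rw [hK, List.ofFn_succ', List.concat_eq_append, List.prod_append, List.prod_singleton,
        Module.End.mul_apply] at hu'
      refine (((list_aux L _ ?_).2 (by simp; omega)).1 _).1 hu'
      intro T hTm
      obtain ⟨i, rfl⟩ := (List.mem_ofFn' _ _).1 hTm
      exact hsw i.castSucc (by simp)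
    have hall : ∀ i : Fin (n + 1), ∀ u ∈ L, ∀ w ∈ L, ⟪J (stdBasis (n + 1) i) u, w⟫ = 0 := by
      intro i
      by_cases hi : (i : ℕ) < n + 1 - 1
      · exact hiso' i hi
      · obtain rfl : i = Fin.last n := Fin.ext (by have := i.2; simp; omega)
        intro u hu w hw
        exact (Submodule.mem_orthogonal' _ _).1 (hlast u hu) w hw
    intro z u hu w hw
    have hz : z = ∑ i, z i • stdBasis (n + 1) i := by
      simpa [stdBasis] using ((EuclideanSpace.basisFun (Fin (n + 1)) ℝ).sum_repr z).symm
    rw [hz]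
    simp only [map_sum, map_smul, LinearMap.sum_apply, LinearMap.smul_apply, sum_inner,
      inner_smul_left, hall _ u hu w hw, mul_zero, Finset.sum_const_zero]
end

section
/- Suppose m ≢ 0 (mod 4). Then for any two Lagrangian subspaces L and L' of V there exists a linear isometry ψ : V → V (orthogonal with respect to the inner product) such that ψ ∘ J_z = J_z ∘ ψ for every z ∈ ℝ^m and ψ(L) = L'. (The group Aut_o(𝔫) of automorphisms fixing the center acts transitively on the set of Lagrangians.) -/
open RealInnerProductSpace

section CliffordAux
variable {V : Type*} [NormedAddCommGroup V] [InnerProductSpace ℝ V]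

/-- averaging -/
noncomputable def cavg (l : List (Module.End ℝ V)) (A : Module.End ℝ V) : Module.End ℝ V :=
  (l.sublists'.map (fun s => s.prod * A * ((-1) ^ s.length * s.reverse.prod))).sum

lemma cavg_cons (a : Module.End ℝ V) (l : List (Module.End ℝ V)) (A : Module.End ℝ V) :
    cavg (a :: l) A = cavg l A - a * cavg l A * a := by
  unfold cavg
  rw [List.sublists'_cons, List.map_append, List.sum_append, List.map_map, sub_eq_add_neg]
  congr 1
  generalize l.sublists' = M
  induction M with
  | nil => simp
  | cons s M ih =>
    simp only [List.map_cons, List.sum_cons, ih, Function.comp, List.prod_cons, List.length_cons,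
      List.reverse_cons, List.prod_append, List.prod_nil, mul_add, add_mul, neg_add]
    congr 1
    simp only [pow_succ, mul_neg, neg_mul, mul_one, mul_assoc]

lemma cavg_comm (l : List (Module.End ℝ V)) (A : Module.End ℝ V)
    (hp : l.Pairwise (fun a b => a * b = -(b * a))) (hs : ∀ a ∈ l, a * a = -1) :
    ∀ f ∈ l, f * cavg l A = cavg l A * f := by
  induction l with
  | nil => simp
  | cons a l ih =>
    rw [List.pairwise_cons] at hp
    have ih' := ih hp.2 (fun b hb => hs b (List.mem_cons_of_mem _ hb))
    intro f hf
    rw [cavg_cons]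
    generalize cavg l A = X at *
    rcases List.mem_cons.1 hf with rfl | hf
    · have h := hs f (by simp)
      have h1 : f * (f * X * f) = - (X * f) := by
        rw [← mul_assoc, ← mul_assoc, h]; simp
      have h2 : (f * X * f) * f = - (f * X) := by
        rw [mul_assoc, h]; simp
      rw [mul_sub, sub_mul, h1, h2]; abel
    · have h := hp.1 f hf
      have hx := ih' f hf
      have h1 : f * (a * X * a) = (a * X * a) * f := by
        calc f * (a * X * a) = (f * a) * X * a := by noncomm_ring
          _ = -(a * f) * X * a := by rw [h]; simp
          _ = - (a * (f * X) * a) := by noncomm_ring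
          _ = - (a * X * (f * a)) := by rw [hx]; noncomm_ring
          _ = a * X * (a * f) := by rw [h]; noncomm_ring
          _ = _ := by noncomm_ring
      rw [mul_sub, sub_mul, h1, hx]

lemma sublists_sum (l : List (Module.End ℝ V)) (g : List (Module.End ℝ V) → ℝ)
    (hg : ∀ s, s.Sublist l → s ≠ [] → g s = 0) : (l.sublists'.map g).sum = g [] := by
  induction l with
  | nil => simp
  | cons a l ih =>
    rw [List.sublists'_cons, List.map_append, List.sum_append,
      ih (fun s h1 h2 => hg s (h1.cons a) h2), List.map_map, add_eq_left]
    apply List.sum_eq_zero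
    intro x hx
    simp only [List.mem_map, List.mem_sublists', Function.comp] at hx
    obtain ⟨s, h1, rfl⟩ := hx
    exact hg _ (h1.cons_cons a) (by simp)

lemma anti_prod (f : Module.End ℝ V) (s : List (Module.End ℝ V))
    (h : ∀ b ∈ s, f * b = -(b * f)) : f * s.prod = (-1) ^ s.length * (s.prod * f) := by
  induction s with
  | nil => simp
  | cons b s ih =>
    have ih' := ih (fun c hc => h c (List.mem_cons_of_mem _ hc))
    have hb := h b (by simp)
    rw [List.prod_cons, List.length_cons, ← mul_assoc, hb, neg_mul, mul_assoc, ih']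
    rcases neg_one_pow_eq_or (Module.End ℝ V) s.length with e | e <;> rw [pow_succ, e] <;> noncomm_ring

lemma trace_anti [FiniteDimensional ℝ V] (P a w : Module.End ℝ V) (ha : a * a = -1) (hP : a * P = P * a)
    (hw : a * w = -(w * a)) : LinearMap.trace ℝ V (P * w) = 0 := by
  have h1 : LinearMap.trace ℝ V (P * w) = LinearMap.trace ℝ V (- ((P * w * a) * a)) := by
    congr 1; rw [mul_assoc, ha]; simp
  have h2 : LinearMap.trace ℝ V ((P * w * a) * a) = LinearMap.trace ℝ V (P * w) := by
    rw [LinearMap.trace_mul_comm]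
    congr 1
    calc a * (P * w * a) = (a * P) * w * a := by noncomm_ring
      _ = P * (a * w) * a := by rw [hP]; noncomm_ring
      _ = - (P * w * (a * a)) := by rw [hw]; noncomm_ring
      _ = _ := by rw [ha]; simp
  rw [map_neg, h2] at h1
  linarith

lemma prod_adj (l : List (Module.End ℝ V))
    (hp : l.Pairwise (fun a b => a * b = -(b * a)))
    (hk : ∀ a ∈ l, ∀ x y : V, ⟪a x, y⟫ = -⟪x, a y⟫) (x y : V) :
    ⟪l.prod x, y⟫ = (-1) ^ (∑ i ∈ Finset.range (l.length + 1), i) * ⟪x, l.prod y⟫ := by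
  induction l generalizing x y with
  | nil => simp
  | cons a l ih =>
    rw [List.pairwise_cons] at hp
    have ih' := ih hp.2 (fun b hb => hk b (List.mem_cons_of_mem _ hb))
    have h := anti_prod a l hp.1
    rw [List.prod_cons, Module.End.mul_apply, hk a (by simp), ih', List.length_cons,
      Finset.sum_range_succ _ (l.length + 1), pow_add, pow_succ _ l.length, h,
      ← Module.End.mul_apply l.prod a]
    rcases Nat.even_or_odd l.length with e | e
    · simp [e.neg_one_pow]
    · simp [e.neg_one_pow]

lemma sum_odd (n : ℕ) (h : n % 4 = 1) : Odd (∑ i ∈ Finset.range (n + 1), i) := by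
  obtain ⟨k, rfl⟩ : ∃ k, n = 4 * k + 1 := ⟨n / 4, by omega⟩
  clear h
  induction k with
  | zero => decide
  | succ k ih =>
    have : 4 * (k + 1) + 1 + 1 = 4 * k + 1 + 1 + 1 + 1 + 1 + 1 := by ring
    rw [this]
    iterate 4 rw [Finset.sum_range_succ]
    obtain ⟨c, hc⟩ := ih
    rw [hc]
    exact ⟨c + 8 * k + 7, by ring⟩

lemma exists_anti (l s : List (Module.End ℝ V))
    (hp : l.Pairwise (fun a b => a * b = -(b * a))) (hsl : s.Sublist l) (hne : s ≠ l) :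
    ∃ a ∈ l, ∀ b ∈ s, a * b = -(b * a) := by
  induction hsl with
  | slnil => exact absurd rfl hne
  | cons c h ih =>
    rw [List.pairwise_cons] at hp
    exact ⟨c, by simp, fun b hb => hp.1 b (h.subset hb)⟩
  | cons_cons c h ih =>
    rw [List.pairwise_cons] at hp
    obtain ⟨a, ha, hab⟩ := ih hp.2 (fun e => hne (by rw [e]))
    refine ⟨a, List.mem_cons_of_mem _ ha, fun b hb => ?_⟩
    rcases List.mem_cons.1 hb with rfl | hb
    · rw [hp.1 a ha, neg_neg]
    · exact hab b hb

lemma trace_word [FiniteDimensional ℝ V] (l : List (Module.End ℝ V))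
    (hp : l.Pairwise (fun a b => a * b = -(b * a))) (hs : ∀ a ∈ l, a * a = -1)
    (hk : ∀ a ∈ l, ∀ x y : V, ⟪a x, y⟫ = -⟪x, a y⟫) (hlen : l.length % 4 ≠ 3)
    (P : Module.End ℝ V) (hP : ∀ a ∈ l, a * P = P * a) (hPs : ∀ x y : V, ⟪P x, y⟫ = ⟪x, P y⟫)
    (s : List (Module.End ℝ V)) (hsl : s.Sublist l) (hne : s ≠ []) :
    LinearMap.trace ℝ V (P * s.prod) = 0 := by
  rcases Nat.even_or_odd s.length with he | ho
  · obtain ⟨a, t, rfl⟩ := List.exists_cons_of_ne_nil hne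
    have ha : a ∈ l := hsl.subset (by simp)
    refine trace_anti P a _ (hs a ha) (hP a ha) ?_
    have hp' := List.pairwise_cons.1 (hp.sublist hsl)
    have h := anti_prod a t hp'.1
    have ht : Odd t.length := by
      rw [List.length_cons] at he
      exact Nat.not_even_iff_odd.1 (Nat.even_add_one.1 he)
    rw [ht.neg_one_pow, neg_one_mul] at h
    rw [List.prod_cons]
    calc a * (a * t.prod) = a * (-(t.prod * a)) := by rw [h]
      _ = _ := by noncomm_ring
  · by_cases hl : s = l
    · subst hl
      have h1 : s.length % 4 = 1 := by
        have := Nat.odd_iff.1 ho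
        omega
      have hadj := prod_adj s hp hk
      rw [(sum_odd _ h1).neg_one_pow] at hadj
      have hc : s.prod * P = P * s.prod := by
        have : Commute P s.prod := Commute.list_prod_right _ _ (fun a ha => (hP a ha).symm)
        exact this.symm
      rw [LinearMap.trace_eq_sum_inner _ (stdOrthonormalBasis ℝ V)]
      apply Finset.sum_eq_zero
      intro i _
      generalize stdOrthonormalBasis ℝ V i = x
      have e1 : ⟪x, (P * s.prod) x⟫ = - ⟪x, (P * s.prod) x⟫ := by
        conv_lhs => rw [← hc, Module.End.mul_apply, real_inner_comm, hadj, hPs, neg_one_mul]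
        rw [Module.End.mul_apply]
      linarith
    · obtain ⟨a, ha, hab⟩ := exists_anti l s hp hsl hl
      refine trace_anti P a _ (hs a ha) (hP a ha) ?_
      have h := anti_prod a s hab
      rwa [ho.neg_one_pow, neg_one_mul] at h


/-- rank one -/
noncomputable def rk1 (x y : V) : Module.End ℝ V := (innerₛₗ ℝ x).smulRight y

lemma rk1_apply (x y v : V) : rk1 x y v = ⟪x, v⟫ • y := rfl

lemma tr_rk1 [FiniteDimensional ℝ V] (X Y : Module.End ℝ V) :
    ∑ i, ∑ j, ⟪stdOrthonormalBasis ℝ V j,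
      (X * rk1 (stdOrthonormalBasis ℝ V i) (stdOrthonormalBasis ℝ V j) * Y)
        (stdOrthonormalBasis ℝ V i)⟫ = LinearMap.trace ℝ V X * LinearMap.trace ℝ V Y := by
  rw [LinearMap.trace_eq_sum_inner X (stdOrthonormalBasis ℝ V),
    LinearMap.trace_eq_sum_inner Y (stdOrthonormalBasis ℝ V), mul_comm, Finset.sum_mul_sum]
  refine Finset.sum_congr rfl fun i _ => Finset.sum_congr rfl fun j _ => ?_
  simp only [Module.End.mul_apply, rk1_apply, map_smul, inner_smul_right]

lemma exists_inter [FiniteDimensional ℝ V] (l : List (Module.End ℝ V))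
    (hp : l.Pairwise (fun a b => a * b = -(b * a))) (hs : ∀ a ∈ l, a * a = -1)
    (hk : ∀ a ∈ l, ∀ x y : V, ⟪a x, y⟫ = -⟪x, a y⟫) (hlen : l.length % 4 ≠ 3)
    (P P' : Module.End ℝ V)
    (hP' : ∀ a ∈ l, a * P' = P' * a) (hPs' : ∀ x y : V, ⟪P' x, y⟫ = ⟪x, P' y⟫)
    (ht : LinearMap.trace ℝ V P ≠ 0) (ht' : LinearMap.trace ℝ V P' ≠ 0) :
    ∃ A, P' * cavg l A * P ≠ 0 := by
  by_contra! h
  set b := stdOrthonormalBasis ℝ V with hb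
  have h0 : ∑ i, ∑ j, ⟪b j, (P' * cavg l (rk1 (b i) (b j)) * P) (b i)⟫ = 0 := by
    simp [h]
  have key : ∀ M : List (List (Module.End ℝ V)),
      ∑ i, ∑ j, ⟪b j, (P' * (M.map (fun s => s.prod * (rk1 (b i) (b j)) *
        ((-1) ^ s.length * s.reverse.prod))).sum * P) (b i)⟫ =
      (M.map (fun s => LinearMap.trace ℝ V (P' * s.prod) *
        LinearMap.trace ℝ V ((-1) ^ s.length * s.reverse.prod * P))).sum := by
    intro M
    induction M with
    | nil => simp
    | cons s M ih =>
      rw [List.map_cons, List.sum_cons, ← ih, ← tr_rk1, ← Finset.sum_add_distrib]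
      refine Finset.sum_congr rfl fun i _ => ?_
      rw [← Finset.sum_add_distrib]
      refine Finset.sum_congr rfl fun j _ => ?_
      rw [← inner_add_right, ← LinearMap.add_apply, List.map_cons, List.sum_cons, mul_add, add_mul]
      simp only [mul_assoc, hb]
  unfold cavg at h0
  rw [key, sublists_sum] at h0
  · simp at h0
    tauto
  · intro s h1 h2
    rw [trace_word l hp hs hk hlen P' hP' hPs' s h1 h2, zero_mul]

lemma skew_orth (f : Module.End ℝ V) (hk : ∀ x y : V, ⟪f x, y⟫ = -⟪x, f y⟫) (E : Submodule ℝ V)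
    (hE : ∀ x ∈ E, f x ∈ E) (x : V) (hx : x ∈ Eᗮ) : f x ∈ Eᗮ := by
  rw [Submodule.mem_orthogonal'] at hx ⊢
  intro u hu
  rw [hk, hx _ (hE u hu), neg_zero]

lemma proj_comm [FiniteDimensional ℝ V] (f : Module.End ℝ V)
    (hk : ∀ x y : V, ⟪f x, y⟫ = -⟪x, f y⟫) (E : Submodule ℝ V)
    (hE : ∀ x ∈ E, f x ∈ E) (x : V) : E.starProjection (f x) = f (E.starProjection x) := by
  apply Submodule.eq_starProjection_of_mem_orthogonal
  · exact hE _ (E.starProjection_apply_mem x)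
  · rw [← map_sub]
    exact skew_orth f hk E hE _ (E.sub_starProjection_mem_orthogonal x)

lemma proj_trace [FiniteDimensional ℝ V] (E : Submodule ℝ V) :
    LinearMap.trace ℝ V (E.starProjection : V →ₗ[ℝ] V) = Module.finrank ℝ E := by
  apply LinearMap.IsProj.trace
  constructor
  · intro x; exact E.starProjection_apply_mem x
  · intro x hx; exact Submodule.starProjection_eq_self_iff.2 hx

/-- one step: matching nonzero pieces -/
lemma exists_piece [FiniteDimensional ℝ V] (l : List (Module.End ℝ V))
    (hp : l.Pairwise (fun a b => a * b = -(b * a))) (hs : ∀ a ∈ l, a * a = -1)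
    (hk : ∀ a ∈ l, ∀ x y : V, ⟪a x, y⟫ = -⟪x, a y⟫) (hlen : l.length % 4 ≠ 3)
    (E E' : Submodule ℝ V) (hE : ∀ a ∈ l, ∀ x ∈ E, a x ∈ E) (hE' : ∀ a ∈ l, ∀ x ∈ E', a x ∈ E')
    (h0 : E ≠ ⊥) (h0' : E' ≠ ⊥) :
    ∃ (F : Submodule ℝ V) (T : Module.End ℝ V), F ≤ E ∧ F ≠ ⊥ ∧ (∀ a ∈ l, ∀ x ∈ F, a x ∈ F) ∧
      (∀ a ∈ l, ∀ x, T (a x) = a (T x)) ∧ (∀ x, T x ∈ E') ∧ (∀ x ∈ F, ‖T x‖ = ‖x‖) := by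
  obtain ⟨A, hA⟩ := exists_inter l hp hs hk hlen (E.starProjection : V →ₗ[ℝ] V)
    (E'.starProjection : V →ₗ[ℝ] V)
    (fun a ha => LinearMap.ext fun x => (proj_comm a (hk a ha) E' (hE' a ha) x).symm)
    (fun x y => E'.starProjection_isSymmetric x y)
    (by rw [proj_trace]; exact_mod_cast fun h => h0 (Submodule.finrank_eq_zero.1 h))
    (by rw [proj_trace]; exact_mod_cast fun h => h0' (Submodule.finrank_eq_zero.1 h))
  set T : Module.End ℝ V := (E'.starProjection : V →ₗ[ℝ] V) * cavg l A *
    (E.starProjection : V →ₗ[ℝ] V) with hT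
  have hTa : ∀ x, T x = E'.starProjection (cavg l A (E.starProjection x)) := fun x => rfl
  have hcomm : ∀ a ∈ l, ∀ x, T (a x) = a (T x) := by
    intro a ha x
    rw [hTa, hTa, proj_comm a (hk a ha) E (hE a ha), ← proj_comm a (hk a ha) E' (hE' a ha)]
    congr 1
    exact (LinearMap.congr_fun (cavg_comm l A hp hs a ha) _).symm
  have hTE : ∀ x, T x ∈ E' := fun x => E'.starProjection_apply_mem _
  have hTz : ∀ x ∈ Eᗮ, T x = 0 := by
    intro x hx
    rw [hTa, (Submodule.starProjection_apply_eq_zero_iff E).2 hx]; simp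
  clear_value T
  set S : Module.End ℝ V := LinearMap.adjoint T * T with hS
  have hSi : ∀ x y, ⟪S x, y⟫ = ⟪T x, T y⟫ := fun x y => by
    rw [hS, Module.End.mul_apply, LinearMap.adjoint_inner_left]
  have hsym : S.IsSymmetric := fun x y => by
    rw [hSi, real_inner_comm, ← hSi, real_inner_comm]
  have hSc : ∀ a ∈ l, ∀ x, S (a x) = a (S x) := by
    intro a ha x
    apply ext_inner_right ℝ
    intro y
    rw [hSi, hcomm a ha, hk a ha, ← hcomm a ha, ← hSi, hk a ha]
  have hex : ∃ μ, μ ≠ 0 ∧ Module.End.HasEigenvalue S μ := by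
    by_contra! hcon
    apply hA
    have hS0 : S = 0 := by
      refine (hsym.eigenvectorBasis rfl).toBasis.ext fun i => ?_
      have := hsym.apply_eigenvectorBasis rfl i
      by_cases hz : hsym.eigenvalues rfl i = 0
      · simp [this, hz]
      · exact absurd (hsym.hasEigenvalue_eigenvalues rfl i) (hcon _ hz)
    ext x
    have := hSi x x
    rw [hS0] at this
    simpa using this.symm
  obtain ⟨μ, hμ0, hμ⟩ := hex
  have hpos : 0 < μ := by
    obtain ⟨v, hv⟩ := hμ.exists_hasEigenvector
    have h1 := hSi v v
    rw [hv.apply_eq_smul, inner_smul_left, real_inner_self_eq_norm_sq,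
      real_inner_self_eq_norm_sq] at h1
    have h2 : 0 < ‖v‖ ^ 2 := by have := norm_pos_iff.2 hv.2; positivity
    have h3 : 0 ≤ μ * ‖v‖ ^ 2 := by
      have : μ * ‖v‖ ^ 2 = ‖T v‖ ^ 2 := by simpa using h1
      rw [this]; positivity
    exact lt_of_le_of_ne (nonneg_of_mul_nonneg_left h3 h2) hμ0.symm
  refine ⟨Module.End.eigenspace S μ, (Real.sqrt μ)⁻¹ • T, ?_, hμ, ?_, ?_, ?_, ?_⟩
  · intro x hx
    rw [Module.End.mem_eigenspace_iff] at hx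
    rw [← Submodule.orthogonal_orthogonal E, Submodule.mem_orthogonal']
    intro u hu
    have h1 := hSi x u
    rw [hTz u hu, hx, inner_smul_left, inner_zero_right] at h1
    simpa [hμ0] using h1
  · intro a ha x hx
    rw [Module.End.mem_eigenspace_iff] at hx ⊢
    rw [hSc a ha, hx, map_smul]
  · intro a ha x
    simp [hcomm a ha]
  · intro x
    exact E'.smul_mem _ (hTE x)
  · intro x hx
    rw [Module.End.mem_eigenspace_iff] at hx
    have h1 := hSi x x
    rw [hx, inner_smul_left, real_inner_self_eq_norm_sq, real_inner_self_eq_norm_sq] at h1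
    have h2 : ‖T x‖ = Real.sqrt μ * ‖x‖ := by
      rw [← Real.sqrt_sq (norm_nonneg (T x)), ← h1]
      simp [Real.sqrt_mul hpos.le]
    have h3 : Real.sqrt μ ≠ 0 := (Real.sqrt_pos.2 hpos).ne'
    rw [LinearMap.smul_apply, norm_smul, h2, Real.norm_of_nonneg (by positivity)]
    field_simp


lemma norm_add_orth (F : Submodule ℝ V) (x y : V) (hx : x ∈ F) (hy : y ∈ Fᗮ) :
    ‖x + y‖ ^ 2 = ‖x‖ ^ 2 + ‖y‖ ^ 2 := by
  rw [norm_add_sq_real, (Submodule.mem_orthogonal F y).1 hy x hx]; ring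

lemma exists_iso [FiniteDimensional ℝ V] (l : List (Module.End ℝ V))
    (hp : l.Pairwise (fun a b => a * b = -(b * a))) (hs : ∀ a ∈ l, a * a = -1)
    (hk : ∀ a ∈ l, ∀ x y : V, ⟪a x, y⟫ = -⟪x, a y⟫) (hlen : l.length % 4 ≠ 3) (n : ℕ) :
    ∀ (E E' : Submodule ℝ V) (_ : ∀ a ∈ l, ∀ x ∈ E, a x ∈ E)
      (_ : ∀ a ∈ l, ∀ x ∈ E', a x ∈ E') (_ : Module.finrank ℝ E = n)
      (_ : Module.finrank ℝ E' = n),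
    ∃ φ : Module.End ℝ V, (∀ a ∈ l, ∀ x ∈ E, φ (a x) = a (φ x)) ∧ (∀ x ∈ E, φ x ∈ E') ∧
      (∀ x ∈ E, ‖φ x‖ = ‖x‖) := by
  induction n using Nat.strong_induction_on with
  | _ n ih =>
  intro E E' hE hE' hd hd'
  rcases Nat.eq_zero_or_pos n with h0 | hn
  · have : E = ⊥ := Submodule.finrank_eq_zero.1 (hd.trans h0)
    subst this
    exact ⟨0, by simp, by simp, by simp⟩
  obtain ⟨F, T, hFE, hF0, hF, hTc, hTE, hTn⟩ := exists_piece l hp hs hk hlen E E' hE hE'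
    (by rintro rfl; simp at hd; omega) (by rintro rfl; simp at hd'; omega)
  have hF' : F.map T ≤ E' := by
    rintro _ ⟨x, _, rfl⟩; exact hTE x
  have hF'i : ∀ a ∈ l, ∀ x ∈ F.map T, a x ∈ F.map T := by
    rintro a ha _ ⟨x, hx, rfl⟩
    exact ⟨a x, hF a ha x hx, hTc a ha x⟩
  have hdF : Module.finrank ℝ (F.map T) = Module.finrank ℝ F := by
    rw [← LinearMap.range_domRestrict]
    apply LinearMap.finrank_range_of_inj
    rw [injective_iff_map_eq_zero]
    rintro ⟨x, hx⟩ h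
    have h1 := hTn x hx
    have h2 : T x = 0 := h
    rw [h2, norm_zero] at h1
    exact Subtype.ext (norm_eq_zero.1 h1.symm)
  have e1 := Submodule.finrank_add_inf_finrank_orthogonal hFE
  have e2 := Submodule.finrank_add_inf_finrank_orthogonal hF'
  have hpos : 0 < Module.finrank ℝ F :=
    Nat.pos_of_ne_zero fun h => hF0 (Submodule.finrank_eq_zero.1 h)
  obtain ⟨φ, hφc, hφE, hφn⟩ := ih (Module.finrank ℝ (Fᗮ ⊓ E : Submodule ℝ V)) (by omega)
    (Fᗮ ⊓ E) ((F.map T)ᗮ ⊓ E')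
    (fun a ha x hx => ⟨skew_orth a (hk a ha) F (hF a ha) x hx.1, hE a ha x hx.2⟩)
    (fun a ha x hx => ⟨skew_orth a (hk a ha) _ (hF'i a ha) x hx.1, hE' a ha x hx.2⟩)
    rfl (by omega)
  have hmem : ∀ x ∈ E, x - F.starProjection x ∈ Fᗮ ⊓ E := fun x hx =>
    ⟨F.sub_starProjection_mem_orthogonal x, E.sub_mem hx (hFE (F.starProjection_apply_mem x))⟩
  refine ⟨T * (F.starProjection : V →ₗ[ℝ] V) + φ * (1 - (F.starProjection : V →ₗ[ℝ] V)),
    ?_, ?_, ?_⟩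
  · intro a ha x hx
    have h1 : φ (a (x - F.starProjection x)) = a (φ (x - F.starProjection x)) :=
      hφc a ha _ (hmem x hx)
    change T (F.starProjection (a x)) + φ (a x - F.starProjection (a x)) =
      a (T (F.starProjection x) + φ (x - F.starProjection x))
    rw [proj_comm a (hk a ha) F (hF a ha), hTc a ha, ← map_sub, h1, map_add]
  · intro x hx
    exact E'.add_mem (hTE _) (hφE _ (hmem x hx)).2
  · intro x hx
    change ‖T (F.starProjection x) + φ (x - F.starProjection x)‖ = ‖x‖
    have hFx := F.starProjection_apply_mem x
    rw [← sq_eq_sq₀ (norm_nonneg _) (norm_nonneg _),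
      norm_add_orth (F.map T) _ _ ⟨_, hFx, rfl⟩ (hφE _ (hmem x hx)).1,
      hTn _ hFx, hφn _ (hmem x hx), ← norm_add_orth F _ _ hFx (hmem x hx).1]
    congr 2
    abel

end CliffordAux

lemma lag_orth {V : Type*} [NormedAddCommGroup V] [InnerProductSpace ℝ V]
    [FiniteDimensional ℝ V] {m : ℕ}
    (J : EuclideanSpace ℝ (Fin m) →ₗ[ℝ] V →ₗ[ℝ] V)
    (hsq : ∀ (z : EuclideanSpace ℝ (Fin m)) (u : V), J z (J z u) = -(‖z‖ ^ 2) • u)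
    (bra : V → V → EuclideanSpace ℝ (Fin m))
    (hbra : ∀ (z : EuclideanSpace ℝ (Fin m)) (u w : V), ⟪z, bra u w⟫ = ⟪J z u, w⟫)
    (L : Submodule ℝ V) (hL : LagrangianSub bra L) (z : EuclideanSpace ℝ (Fin m))
    (hz : ‖z‖ = 1) : (∀ x ∈ L, J z x ∈ Lᗮ) ∧ (∀ x ∈ Lᗮ, J z x ∈ L) := by
  have hz2 : ∀ u, J z (J z u) = -u := fun u => by rw [hsq, hz]; simp
  have h1 : ∀ x ∈ L, J z x ∈ Lᗮ := by
    intro x hx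
    rw [Submodule.mem_orthogonal']
    intro u hu
    rw [← hbra, hL.1 x hx u hu, inner_zero_right]
  refine ⟨h1, ?_⟩
  have hinj : Function.Injective (J z) := by
    rw [injective_iff_map_eq_zero]
    intro a ha
    have := hz2 a
    rw [ha, map_zero] at this
    exact neg_eq_zero.1 this.symm
  have h2 : L.map (J z) = Lᗮ := by
    apply Submodule.eq_of_le_of_finrank_eq
    · rintro _ ⟨x, hx, rfl⟩; exact h1 x hx
    · have e1 := L.finrank_add_finrank_orthogonal
      have e2 := hL.2
      have e3 : Module.finrank ℝ (L.map (J z)) = Module.finrank ℝ L :=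
        (Submodule.equivMapOfInjective (J z) hinj L).finrank_eq.symm
      omega
  intro x hx
  rw [← h2] at hx
  obtain ⟨y, hy, rfl⟩ := hx
  rw [hz2]
  exact L.neg_mem hy

lemma J_anti {V : Type*} [NormedAddCommGroup V] [InnerProductSpace ℝ V] {m : ℕ}
    (J : EuclideanSpace ℝ (Fin m) →ₗ[ℝ] V →ₗ[ℝ] V)
    (hsq : ∀ (z : EuclideanSpace ℝ (Fin m)) (u : V), J z (J z u) = -(‖z‖ ^ 2) • u)
    (z w : EuclideanSpace ℝ (Fin m)) (h : ⟪z, w⟫ = 0) (u : V) :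
    J z (J w u) = - J w (J z u) := by
  have h1 := hsq (z + w) u
  rw [norm_add_sq_real, h] at h1
  simp only [map_add, LinearMap.add_apply, hsq] at h1
  have h2 : J z (J w u) + J w (J z u) = 0 := by
    have h3 : -(‖z‖ ^ 2 + 2 * 0 + ‖w‖ ^ 2) • u = -(‖z‖ ^ 2) • u + -(‖w‖ ^ 2) • u := by
      rw [← add_smul]; congr 1; ring
    rw [h3] at h1
    have h4 : J z (J w u) + J w (J z u) =
      (-(‖z‖ ^ 2) • u + J w (J z u) + (J z (J w u) + -(‖w‖ ^ 2) • u))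
        - (-(‖z‖ ^ 2) • u + -(‖w‖ ^ 2) • u) := by abel
    rw [h4, h1, sub_self]
  exact eq_neg_of_add_eq_zero_left h2

theorem stmt_17 {V : Type*} [NormedAddCommGroup V] [InnerProductSpace ℝ V]
    [FiniteDimensional ℝ V] {m : ℕ} (hm : 1 ≤ m)
    (J : EuclideanSpace ℝ (Fin m) →ₗ[ℝ] V →ₗ[ℝ] V)
    (hskew : ∀ (z : EuclideanSpace ℝ (Fin m)) (u w : V), ⟪J z u, w⟫ = -⟪u, J z w⟫)
    (hsq : ∀ (z : EuclideanSpace ℝ (Fin m)) (u : V), J z (J z u) = -(‖z‖ ^ 2) • u)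
    (bra : V → V → EuclideanSpace ℝ (Fin m))
    (hbra : ∀ (z : EuclideanSpace ℝ (Fin m)) (u w : V), ⟪z, bra u w⟫ = ⟪J z u, w⟫)
    (h4 : m % 4 ≠ 0)
    (L L' : Submodule ℝ V) (hL : LagrangianSub bra L) (hL' : LagrangianSub bra L') :
    ∃ ψ : V ≃ₗᵢ[ℝ] V,
      (∀ (z : EuclideanSpace ℝ (Fin m)) (v : V), ψ (J z v) = J z (ψ v)) ∧
      L.map ψ.toLinearEquiv.toLinearMap = L' := by
  obtain ⟨n, rfl⟩ : ∃ n, m = n + 1 := ⟨m - 1, by omega⟩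
  set K : Fin (n + 1) → Module.End ℝ V := fun i => J (EuclideanSpace.single i (1 : ℝ)) with hK
  have hKK : ∀ i u, K i (K i u) = -u := fun i u => by
    simp only [hK]; rw [hsq]; simp
  have hKa : ∀ i j, i ≠ j → ∀ u, K i (K j u) = - K j (K i u) := fun i j hij u => by
    apply J_anti J hsq
    simp [EuclideanSpace.inner_single_left, hij]
  have hKs : ∀ i u w, ⟪K i u, w⟫ = -⟪u, K i w⟫ := fun i u w => hskew _ u w
  have hKL := fun i => lag_orth J hsq bra hbra L hL (EuclideanSpace.single i (1 : ℝ)) (by simp)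
  have hKL' := fun i => lag_orth J hsq bra hbra L' hL' (EuclideanSpace.single i (1 : ℝ)) (by simp)
  change ∀ i, (∀ x ∈ L, K i x ∈ Lᗮ) ∧ (∀ x ∈ Lᗮ, K i x ∈ L) at hKL
  change ∀ i, (∀ x ∈ L', K i x ∈ L'ᗮ) ∧ (∀ x ∈ L'ᗮ, K i x ∈ L') at hKL'
  have hgen : ∀ ψ : Module.End ℝ V, (∀ i v, ψ (K i v) = K i (ψ v)) →
      ∀ z v, ψ (J z v) = J z (ψ v) := by
    intro ψ h z v
    have hz : z = ∑ i, z i • EuclideanSpace.single i (1 : ℝ) := by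
      have := (EuclideanSpace.basisFun (Fin (n + 1)) ℝ).sum_repr z
      simpa using this.symm
    rw [hz]
    simp only [map_sum, map_smul, LinearMap.sum_apply, LinearMap.smul_apply]
    exact Finset.sum_congr rfl fun i _ => by rw [← h i v]
  clear_value K
  have hne : ∀ j : Fin n, (0 : Fin (n + 1)) ≠ j.succ := fun j => (Fin.succ_ne_zero j).symm
  set f : Fin n → Module.End ℝ V := fun j => K 0 * K j.succ with hf
  have hfa : ∀ j x, f j x = K 0 (K j.succ x) := fun j x => rfl
  have hfm : ∀ a ∈ List.ofFn f, ∃ j, a = f j := by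
    intro a ha
    obtain ⟨j, hj⟩ := (List.mem_ofFn' f a).1 ha
    exact ⟨j, hj.symm⟩
  obtain ⟨φ, hφc, hφL, hφn⟩ := exists_iso (List.ofFn f)
    (by
      rw [List.pairwise_ofFn]
      intro i j hij
      have hij' : i.succ ≠ j.succ := fun h => hij.ne (Fin.succ_injective _ h)
      ext x
      change K 0 (K i.succ (K 0 (K j.succ x))) = - K 0 (K j.succ (K 0 (K i.succ x)))
      rw [hKa _ 0 (hne i).symm, hKa _ 0 (hne j).symm, map_neg, map_neg, hKK, hKK,
        hKa _ _ hij'])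
    (by
      intro a ha
      obtain ⟨j, rfl⟩ := hfm a ha
      ext x
      change K 0 (K j.succ (K 0 (K j.succ x))) = - x
      rw [hKa _ 0 (hne j).symm, map_neg, hKK, hKK]
      simp)
    (by
      intro a ha
      obtain ⟨j, rfl⟩ := hfm a ha
      intro x y
      rw [hfa, hfa, hKs, hKs, hKa _ 0 (hne j).symm]
      simp)
    (by rw [List.length_ofFn]; omega) (Module.finrank ℝ L) L L'
    (by
      intro a ha
      obtain ⟨j, rfl⟩ := hfm a ha
      intro x hx
      exact (hKL 0).2 _ ((hKL _).1 x hx))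
    (by
      intro a ha
      obtain ⟨j, rfl⟩ := hfm a ha
      intro x hx
      exact (hKL' 0).2 _ ((hKL' _).1 x hx))
    rfl (by have := hL.2; have := hL'.2; omega)
  have hφf : ∀ j, ∀ x ∈ L, φ (f j x) = f j (φ x) := fun j x hx =>
    hφc _ ((List.mem_ofFn' f _).2 ⟨j, rfl⟩) x hx
  set P : Module.End ℝ V := (L.starProjection : V →ₗ[ℝ] V) with hP
  have hP1 : ∀ x ∈ L, P x = x := fun x hx => Submodule.starProjection_eq_self_iff.2 hx
  have hP0 : ∀ x ∈ Lᗮ, P x = 0 := fun x hx => (Submodule.starProjection_apply_eq_zero_iff L).2 hx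
  have hPL : ∀ x, P x ∈ L := fun x => L.starProjection_apply_mem x
  have hPO : ∀ x, x - P x ∈ Lᗮ := fun x => L.sub_starProjection_mem_orthogonal x
  clear_value P
  set Ψ : Module.End ℝ V := φ * P - K 0 * φ * K 0 * (1 - P) with hΨ
  have hΨa : ∀ x, Ψ x = φ (P x) - K 0 (φ (K 0 (x - P x))) := fun x => rfl
  have hΨ1 : ∀ x ∈ L, Ψ x = φ x := fun x hx => by rw [hΨa, hP1 x hx]; simp
  have hΨ0 : ∀ x ∈ Lᗮ, Ψ x = - K 0 (φ (K 0 x)) := fun x hx => by rw [hΨa, hP0 x hx]; simp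
  -- a linear identity may be checked on `L` and its orthogonal complement
  have hsplit : ∀ A B : Module.End ℝ V, (∀ x ∈ L, A x = B x) → (∀ x ∈ Lᗮ, A x = B x) →
      ∀ x, A x = B x := by
    intro A B h1 h2 x
    have : x = P x + (x - P x) := by abel
    rw [this, map_add, map_add, h1 _ (hPL x), h2 _ (hPO x)]
  have hc0 : ∀ v, Ψ (K 0 v) = K 0 (Ψ v) := by
    apply hsplit (Ψ * K 0) (K 0 * Ψ)
    · intro x hx
      change Ψ (K 0 x) = K 0 (Ψ x)
      rw [hΨ1 x hx, hΨ0 _ ((hKL 0).1 x hx), hKK]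
      simp
    · intro x hx
      change Ψ (K 0 x) = K 0 (Ψ x)
      rw [hΨ0 x hx, hΨ1 _ ((hKL 0).2 x hx), map_neg, hKK]
      simp
  have hKf : ∀ j v, K 0 (f j v) = - f j (K 0 v) := by
    intro j v
    rw [hfa, hfa, hKa _ 0 (hne j).symm, map_neg, neg_neg]
  have hcf : ∀ j v, Ψ (f j v) = f j (Ψ v) := by
    intro j
    apply hsplit (Ψ * f j) (f j * Ψ)
    · intro x hx
      change Ψ (f j x) = f j (Ψ x)
      rw [hΨ1 x hx, hΨ1 (f j x) ((hKL 0).2 _ ((hKL _).1 x hx)), hφf j x hx]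
    · intro x hx
      change Ψ (f j x) = f j (Ψ x)
      rw [hΨ0 x hx, hΨ0 (f j x) ((hKL 0).1 _ ((hKL _).2 x hx)), hKf, map_neg, hφf j _ ((hKL 0).2 x hx),
        map_neg, hKf]
      simp
  have hcK : ∀ i v, Ψ (K i v) = K i (Ψ v) := by
    intro i v
    rcases Fin.eq_zero_or_eq_succ i with rfl | ⟨j, rfl⟩
    · exact hc0 v
    · have h1 : ∀ u, K j.succ u = - K 0 (f j u) := fun u => by rw [hfa, hKK, neg_neg]
      rw [h1, h1, map_neg, hc0, hcf]
  have hKn : ∀ i x, ‖K i x‖ = ‖x‖ := by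
    intro i x
    rw [← sq_eq_sq₀ (norm_nonneg _) (norm_nonneg _), ← real_inner_self_eq_norm_sq, hKs, hKK,
      inner_neg_right, neg_neg, real_inner_self_eq_norm_sq]
  have hnorm : ∀ x, ‖Ψ x‖ = ‖x‖ := by
    intro x
    have hm1 := (hKL 0).2 _ (hPO x)
    rw [← sq_eq_sq₀ (norm_nonneg _) (norm_nonneg _), hΨa, sub_eq_add_neg,
      norm_add_orth L' _ _ (hφL _ (hPL x))
        (L'ᗮ.neg_mem ((hKL' 0).1 _ (hφL _ hm1))), norm_neg, hKn, hφn _ hm1, hKn,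
      hφn _ (hPL x), ← norm_add_orth L _ _ (hPL x) (hPO x)]
    congr 2
    abel
  let ψ : V ≃ₗᵢ[ℝ] V := LinearIsometry.toLinearIsometryEquiv ⟨Ψ, hnorm⟩ rfl
  have hψ : ∀ x, ψ x = Ψ x := fun x => rfl
  refine ⟨ψ, fun z v => ?_, ?_⟩
  · rw [hψ, hψ]; exact hgen Ψ hcK z v
  · apply Submodule.eq_of_le_of_finrank_eq
    · rintro _ ⟨x, hx, rfl⟩
      change Ψ x ∈ L'
      rw [hΨ1 x hx]
      exact hφL x hx
    · have e1 := hL.2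
      have e2 := hL'.2
      have e3 : Module.finrank ℝ (L.map ψ.toLinearEquiv.toLinearMap) = Module.finrank ℝ L :=
        LinearEquiv.finrank_map_eq ψ.toLinearEquiv L
      omega
end

section
/- Suppose m ≡ 0 (mod 4), let K := J_{e_1} ∘ ⋯ ∘ J_{e_m} and W_+ := ker(K - id). For Lagrangian subspaces L and L' of V, there exists a linear isometry ψ : V → V with ψ ∘ J_z = J_z ∘ ψ for all z ∈ ℝ^m and ψ(L) = L' if and only if dim(L ∩ W_+) = dim(L' ∩ W_+). (For m ≡ 0 mod 4 the orbits of Aut_o(𝔫) on the Lagrangians are distinguished exactly by the dimension of the intersection with W_+.) -/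
open RealInnerProductSpace

section H18
set_option linter.unusedSectionVars false
variable {V : Type*} [NormedAddCommGroup V] [InnerProductSpace ℝ V] [FiniteDimensional ℝ V]

/-- orthogonal projection commutes with operators preserving U and its complement -/
theorem h18_proj_comm (U : Submodule ℝ V) (S S' : Module.End ℝ V)
    (adj : ∀ u w, ⟪S u, w⟫ = ⟪u, S' w⟫)
    (h : ∀ x ∈ U, S x ∈ U) (h' : ∀ x ∈ U, S' x ∈ U) (x : V) :
    U.starProjection (S x) = S (U.starProjection x) := by
  apply Submodule.eq_starProjection_of_mem_of_inner_eq_zero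
  · exact h _ (U.starProjection_apply_mem x)
  · intro w hw
    rw [← map_sub, adj]
    exact U.starProjection_inner_eq_zero x _ (h' w hw)

theorem h18_eig (S : Module.End ℝ V) (hS : S.IsSymmetric) (hne : S ≠ 0) :
    ∃ (μ : ℝ) (x : V), μ ≠ 0 ∧ x ≠ 0 ∧ S x = μ • x := by
  by_contra hcon
  push Not at hcon
  apply hne
  apply (hS.eigenvectorBasis rfl).toBasis.ext
  intro i
  have h1 := hS.apply_eigenvectorBasis rfl i
  have h2 : hS.eigenvectorBasis rfl i ≠ 0 := by
    intro h0
    have := (hS.eigenvectorBasis rfl).orthonormal.1 i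
    rw [h0] at this; simp at this
  simp only [OrthonormalBasis.coe_toBasis, LinearMap.zero_apply]
  by_cases h0 : hS.eigenvalues rfl i = 0
  · rw [h1, h0]; simp
  · exact absurd h1 (hcon _ _ h0 h2)

theorem h18_main {ι : Type*} (E : ι → Module.End ℝ V) (τ : ι → ι)
    (adj : ∀ k u w, ⟪E k u, w⟫ = ⟪u, E (τ k) w⟫)
    (adj' : ∀ k u w, ⟪E (τ k) u, w⟫ = ⟪u, E k w⟫)
    (A₀ B₀ : Submodule ℝ V)
    (H : ∀ A B : Submodule ℝ V, A ≤ A₀ → B ≤ B₀ → (∀ k, ∀ x ∈ A, E k x ∈ A) →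
      (∀ k, ∀ x ∈ B, E k x ∈ B) → A ≠ ⊥ → B ≠ ⊥ →
      ∃ f : Module.End ℝ V, (∀ k x, f (E k x) = E k (f x)) ∧ (∀ x ∈ A, f x ∈ B) ∧
        ∃ a ∈ A, f a ≠ 0) :
    ∀ (n : ℕ) (A B : Submodule ℝ V), Module.finrank ℝ A = n → Module.finrank ℝ B = n →
      A ≤ A₀ → B ≤ B₀ → (∀ k, ∀ x ∈ A, E k x ∈ A) → (∀ k, ∀ x ∈ B, E k x ∈ B) →
      ∃ F : Module.End ℝ V, (∀ k x, F (E k x) = E k (F x)) ∧ (∀ x ∈ A, F x ∈ B) ∧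
        ∀ x ∈ A, ‖F x‖ = ‖x‖ := by
  intro n
  induction n using Nat.strong_induction_on with
  | _ n ih =>
  intro A B hA hB hA0 hB0 hAi hBi
  rcases Nat.eq_zero_or_pos n with hn | hn
  · subst hn
    have hA' : A = ⊥ := Submodule.finrank_eq_zero.mp hA
    refine ⟨0, by simp, by simp, ?_⟩
    intro x hx
    rw [hA'] at hx
    simp [(Submodule.mem_bot ℝ).mp hx]
  have hAne : A ≠ ⊥ := by rintro rfl; simp at hA; omega
  have hBne : B ≠ ⊥ := by rintro rfl; simp at hB; omega
  obtain ⟨f, fE, fAB, a, haA, hfa⟩ := H A B hA0 hB0 hAi hBi hAne hBne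
  set P : Module.End ℝ V := (A.starProjection : V →L[ℝ] V).toLinearMap with hP
  have hPA : ∀ x, P x ∈ A := fun x => A.starProjection_apply_mem x
  have hPid : ∀ x ∈ A, P x = x := fun x hx => Submodule.starProjection_eq_self_iff.mpr hx
  have hPs : ∀ x y, ⟪P x, y⟫ = ⟪x, P y⟫ := fun x y => Submodule.inner_starProjection_left_eq_right A x y
  have hPE : ∀ k x, P (E k x) = E k (P x) := fun k x =>
    h18_proj_comm A (E k) (E (τ k)) (adj k) (hAi k) (hAi (τ k)) x
  let S : Module.End ℝ V := P * (LinearMap.adjoint f * (f * P))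
  have hSapp : ∀ x, S x = P (LinearMap.adjoint f (f (P x))) := fun x => rfl
  have hSin : ∀ x y, ⟪S x, y⟫ = ⟪f (P x), f (P y)⟫ := by
    intro x y
    rw [hSapp, hPs, LinearMap.adjoint_inner_left]
  have hSsym : S.IsSymmetric := by
    intro x y
    rw [hSin, real_inner_comm, ← hSin, real_inner_comm]
  have hSne : S ≠ 0 := by
    intro h0
    have h1 := hSin a a
    rw [h0, hPid a haA] at h1
    simp at h1
    exact hfa (by simpa using h1.symm)
  have hfE' : ∀ k x, LinearMap.adjoint f (E k x) = E k (LinearMap.adjoint f x) := by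
    intro k x
    apply ext_inner_right ℝ
    intro y
    rw [LinearMap.adjoint_inner_left, adj, adj, LinearMap.adjoint_inner_left, fE]
  have hSE : ∀ k x, S (E k x) = E k (S x) := by
    intro k x
    rw [hSapp, hSapp, hPE, fE, hfE', hPE]
  obtain ⟨μ, x₀, hμ, hx₀, hSx₀⟩ := h18_eig S hSsym hSne
  let N : Submodule ℝ V := LinearMap.ker (S - μ • LinearMap.id)
  have hN : ∀ x, x ∈ N ↔ S x = μ • x := by
    intro x
    simp [N, LinearMap.mem_ker, sub_eq_zero]
  have hNA : N ≤ A := by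
    intro x hx
    have h1 := (hN x).mp hx
    have h2 : x = μ⁻¹ • S x := by rw [h1, smul_smul, inv_mul_cancel₀ hμ, one_smul]
    rw [h2]
    exact A.smul_mem _ (hPA _)
  have hfN : ∀ x ∈ N, ‖f x‖ ^ 2 = μ * ‖x‖ ^ 2 := by
    intro x hx
    have h1 := hSin x x
    rw [(hN x).mp hx, hPid x (hNA hx), inner_smul_left, real_inner_self_eq_norm_sq,
      real_inner_self_eq_norm_sq] at h1
    simpa using h1.symm
  have hx₀N : x₀ ∈ N := (hN _).mpr hSx₀
  have hμpos : 0 < μ := by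
    have h1 := hfN x₀ hx₀N
    have h2 : 0 < ‖x₀‖ ^ 2 := by positivity
    have h3 : 0 ≤ μ := by
      by_contra h
      push Not at h
      nlinarith [sq_nonneg ‖f x₀‖]
    exact lt_of_le_of_ne h3 (Ne.symm hμ)
  have hNi : ∀ k, ∀ x ∈ N, E k x ∈ N := by
    intro k x hx
    rw [hN, hSE, (hN x).mp hx, map_smul]
  let M : Submodule ℝ V := N.map f
  have hMB : M ≤ B := by
    rintro _ ⟨x, hx, rfl⟩
    exact fAB x (hNA hx)
  have hMi : ∀ k, ∀ x ∈ M, E k x ∈ M := by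
    rintro k _ ⟨x, hx, rfl⟩
    exact ⟨E k x, hNi k x hx, fE k x⟩
  have hMfin : Module.finrank ℝ M = Module.finrank ℝ N := by
    have hinj : Function.Injective (f.domRestrict N) := by
      rw [← LinearMap.ker_eq_bot, LinearMap.ker_eq_bot']
      rintro ⟨x, hx⟩ h
      have h0 : f x = 0 := h
      have h1 := hfN x hx
      rw [h0] at h1
      simp [hμ] at h1
      ext; simpa using h1
    have h1 := LinearMap.finrank_range_of_inj hinj
    rwa [LinearMap.range_domRestrict] at h1
  have hNpos : 0 < Module.finrank ℝ N := by
    rw [Module.finrank_pos_iff_exists_ne_zero]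
    exact ⟨⟨x₀, hx₀N⟩, by simpa [Subtype.ext_iff] using hx₀⟩
  have hf1 := Submodule.finrank_add_inf_finrank_orthogonal hNA
  have hf2 := Submodule.finrank_add_inf_finrank_orthogonal hMB
  have horth : ∀ (U : Submodule ℝ V), (∀ k, ∀ x ∈ U, E k x ∈ U) → ∀ k, ∀ x ∈ Uᗮ, E k x ∈ Uᗮ := by
    intro U hU k x hx
    rw [Submodule.mem_orthogonal] at hx ⊢
    intro u hu
    rw [← adj']
    exact hx _ (hU (τ k) u hu)
  obtain ⟨G, GE, GAB, Gn⟩ := ih (Module.finrank ℝ (Nᗮ ⊓ A : Submodule ℝ V)) (by omega)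
    (Nᗮ ⊓ A) (Mᗮ ⊓ B) rfl (by omega) (inf_le_right.trans hA0) (inf_le_right.trans hB0)
    (fun k x hx => ⟨horth N hNi k x hx.1, hAi k x hx.2⟩)
    (fun k x hx => ⟨horth M hMi k x hx.1, hBi k x hx.2⟩)
  set Q : Module.End ℝ V := (N.starProjection : V →L[ℝ] V).toLinearMap with hQ
  have hQN : ∀ x, Q x ∈ N := fun x => N.starProjection_apply_mem x
  have hQE : ∀ k x, Q (E k x) = E k (Q x) := fun k x =>
    h18_proj_comm N (E k) (E (τ k)) (adj k) (hNi k) (hNi (τ k)) x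
  have hQo : ∀ x, x - Q x ∈ Nᗮ := fun x => N.sub_starProjection_mem_orthogonal x
  have hQr : ∀ x ∈ A, x - Q x ∈ (Nᗮ ⊓ A : Submodule ℝ V) := fun x hx =>
    ⟨hQo x, A.sub_mem hx (hNA (hQN x))⟩
  refine ⟨(Real.sqrt μ)⁻¹ • (f * Q) + G * (1 - Q), ?_, ?_, ?_⟩
  · intro k x
    simp only [LinearMap.add_apply, LinearMap.smul_apply, Module.End.mul_apply,
      LinearMap.sub_apply, Module.End.one_apply, map_add, map_smul, map_sub, hQE, fE, GE]
  · intro x hx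
    exact B.add_mem (B.smul_mem _ (hMB ⟨_, hQN x, rfl⟩)) (GAB _ (hQr x hx)).2
  · intro x hx
    have e1 : ((Real.sqrt μ)⁻¹ • (f * Q) + G * (1 - Q)) x
      = (Real.sqrt μ)⁻¹ • f (Q x) + G (x - Q x) := rfl
    have e2 : ⟪(Real.sqrt μ)⁻¹ • f (Q x), G (x - Q x)⟫ = 0 := by
      rw [inner_smul_left]
      have := (Submodule.mem_orthogonal _ _).mp (GAB _ (hQr x hx)).1 (f (Q x)) ⟨_, hQN x, rfl⟩
      rw [this]; simp
    have e3 : ⟪Q x, x - Q x⟫ = 0 := (Submodule.mem_orthogonal _ _).mp (hQo x) _ (hQN x)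
    have e4 := norm_add_sq_eq_norm_sq_add_norm_sq_of_inner_eq_zero _ _ e2
    have e5 := norm_add_sq_eq_norm_sq_add_norm_sq_of_inner_eq_zero _ _ e3
    rw [add_sub_cancel] at e5
    have e6 : ‖(Real.sqrt μ)⁻¹ • f (Q x)‖ * ‖(Real.sqrt μ)⁻¹ • f (Q x)‖ = ‖Q x‖ * ‖Q x‖ := by
      have h1 := hfN _ (hQN x)
      have h2 := Real.mul_self_sqrt hμpos.le
      have h3 : Real.sqrt μ ≠ 0 := (Real.sqrt_pos.mpr hμpos).ne'
      rw [norm_smul, Real.norm_eq_abs, abs_of_nonneg (by positivity)]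
      field_simp
      rw [h1, Real.sq_sqrt hμpos.le]
    rw [e1]
    rw [e6, Gn _ (hQr x hx), ← e5] at e4
    exact (mul_self_inj_of_nonneg (norm_nonneg _) (norm_nonneg x)).mp e4



theorem h18_anti_not_mem {ι : Type*} (j : ι → Module.End ℝ V)
    (h3 : ∀ i k, i ≠ k → j i * j k = -(j k * j i)) (i : ι) (l : List ι) (hi : i ∉ l) :
    (l.map j).prod * j i = (-1 : ℝ) ^ l.length • (j i * (l.map j).prod) := by
  induction l with
  | nil => simp
  | cons a l ih =>
    simp only [List.mem_cons, not_or] at hi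
    rw [List.map_cons, List.prod_cons, mul_assoc, ih hi.2, mul_smul_comm, ← mul_assoc,
      h3 a i (Ne.symm hi.1), List.length_cons, pow_succ]
    simp [mul_assoc]

theorem h18_anti_mem {ι : Type*} (j : ι → Module.End ℝ V)
    (h3 : ∀ i k, i ≠ k → j i * j k = -(j k * j i)) (i : ι) (l : List ι) (hl : l.Nodup)
    (hi : i ∈ l) :
    (l.map j).prod * j i = -((-1 : ℝ) ^ l.length • (j i * (l.map j).prod)) := by
  induction l with
  | nil => simp at hi
  | cons a l ih =>
    rw [List.nodup_cons] at hl
    by_cases hia : i = a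
    · subst hia
      rw [List.map_cons, List.prod_cons, mul_assoc, h18_anti_not_mem j h3 i l hl.1,
        List.length_cons, pow_succ]
      simp
    · have hi' : i ∈ l := by simpa [hia] using hi
      rw [List.map_cons, List.prod_cons, mul_assoc, ih hl.2 hi', mul_neg, mul_smul_comm, ← mul_assoc,
        h3 a i (Ne.symm hia), List.length_cons, pow_succ]
      simp [mul_assoc]

theorem h18_sq {ι : Type*} (j : ι → Module.End ℝ V) (h2 : ∀ i, j i * j i = -1)
    (h3 : ∀ i k, i ≠ k → j i * j k = -(j k * j i)) (l : List ι) (hl : l.Nodup) :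
    (l.map j).prod * (l.map j).prod
      = ((-1 : ℝ) ^ (∑ t ∈ Finset.range (l.length + 1), t)) • 1 := by
  induction l with
  | nil => simp
  | cons a l ih =>
    rw [List.nodup_cons] at hl
    have h := h18_anti_not_mem j h3 a l hl.1
    rw [List.length_cons, Finset.sum_range_succ, pow_add, List.map_cons, List.prod_cons]
    calc j a * (l.map j).prod * (j a * (l.map j).prod)
        = j a * ((l.map j).prod * j a) * (l.map j).prod := by simp only [mul_assoc]
      _ = (-1 : ℝ) ^ l.length • ((j a * j a) * ((l.map j).prod * (l.map j).prod)) := by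
          rw [h, mul_smul_comm, smul_mul_assoc]; simp only [mul_assoc]
      _ = _ := by
          rw [h2, ih hl.2, pow_succ, mul_smul_comm, smul_smul, mul_one, ← neg_one_smul ℝ (1 : Module.End ℝ V),
            smul_smul]
          congr 1
          ring

/-- averaging operator -/
noncomputable def h18Avg {ι : Type*} (j : ι → Module.End ℝ V) :
    List ι → Module.End ℝ V → Module.End ℝ V
  | [], T => T
  | i :: l, T => h18Avg j l T - j i * h18Avg j l T * j i

theorem h18_avg_comm {ι : Type*} (j : ι → Module.End ℝ V) (h2 : ∀ i, j i * j i = -1)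
    (h3 : ∀ i k, i ≠ k → j i * j k = -(j k * j i)) (T : Module.End ℝ V) (l : List ι) :
    ∀ i ∈ l, h18Avg j l T * j i = j i * h18Avg j l T := by
  induction l with
  | nil => simp
  | cons a l ih =>
    intro i hi
    have key : ∀ X : Module.End ℝ V, (X - j a * X * j a) * j a = j a * (X - j a * X * j a) := by
      intro X
      rw [sub_mul, mul_sub, mul_assoc (j a * X), h2, ← mul_assoc, ← mul_assoc, h2]
      simp only [mul_neg, mul_one, neg_mul, one_mul, sub_neg_eq_add]
      abel
    by_cases hia : i = a
    · subst hia; exact key _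
    · have hi' : i ∈ l := by simpa [hia] using hi
      have h := ih i hi'
      have h4 := h3 a i (Ne.symm hia)
      simp only [h18Avg]
      rw [sub_mul, mul_sub, h]
      congr 1
      calc j a * h18Avg j l T * j a * j i = j a * h18Avg j l T * (j a * j i) := by
            simp only [mul_assoc]
        _ = -(j a * (h18Avg j l T * j i) * j a) := by rw [h4]; simp only [mul_assoc, mul_neg]
        _ = -((j a * j i) * h18Avg j l T * j a) := by rw [h]; simp only [mul_assoc]
        _ = _ := by rw [h4]; simp only [mul_assoc, neg_mul, neg_neg]

theorem h18_avg_apply {ι : Type*} (j : ι → Module.End ℝ V)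
    (h1 : ∀ i u w, ⟪j i u, w⟫ = -⟪u, j i w⟫) (T : Module.End ℝ V) (a b : V)
    (hT : ∀ v, T v = ⟪a, v⟫ • b) (l : List ι) (v : V) :
    h18Avg j l T v = (l.sublists'.map fun s =>
      ⟪(s.map j).prod a, v⟫ • (s.map j).prod b).sum := by
  induction l generalizing v with
  | nil => simp [h18Avg, hT]
  | cons i l ih =>
    rw [List.sublists'_cons, List.map_append, List.sum_append, ← ih, h18Avg, LinearMap.sub_apply,
      Module.End.mul_apply, Module.End.mul_apply, ih (j i v), map_list_sum, sub_eq_add_neg]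
    congr 1
    rw [← neg_one_smul ℝ, List.smul_sum, List.map_map, List.map_map, List.map_map]
    congr 1
    apply List.map_congr_left
    intro s _
    simp [h1]

theorem h18_even_mem {ι : Type*} (j : ι → Module.End ℝ V) (A : Submodule ℝ V)
    (hA : ∀ i k, ∀ x ∈ A, j i (j k x) ∈ A) :
    ∀ (s : List ι), s.length % 2 = 0 → ∀ x ∈ A, (s.map j).prod x ∈ A
  | [], _, x, hx => by simpa using hx
  | [_], h, _, _ => by simp at h
  | i :: k :: s, h, x, hx => by
    have h' : s.length % 2 = 0 := by simp at h; omega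
    simpa using hA i k _ (h18_even_mem j A hA s h' x hx)

theorem h18_odd_orth {ι : Type*} (j : ι → Module.End ℝ V) (A : Submodule ℝ V)
    (hA : ∀ i k, ∀ x ∈ A, j i (j k x) ∈ A) (hiso : ∀ i, ∀ x ∈ A, ∀ y ∈ A, ⟪j i x, y⟫ = 0)
    (s : List ι) (hs : s.length % 2 = 1) (x : V) (hx : x ∈ A) (y : V) (hy : y ∈ A) :
    ⟪(s.map j).prod x, y⟫ = 0 := by
  cases s with
  | nil => simp at hs
  | cons i s =>
    have h' : s.length % 2 = 0 := by simp at hs; omega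
    simpa using hiso i _ (h18_even_mem j A hA s h' x hx) y hy

theorem h18_exists {m : ℕ} (j : Fin m → Module.End ℝ V)
    (h1 : ∀ i u w, ⟪j i u, w⟫ = -⟪u, j i w⟫)
    (h2 : ∀ i, j i * j i = -1)
    (h3 : ∀ i k, i ≠ k → j i * j k = -(j k * j i))
    (ε : ℝ) (A B : Submodule ℝ V)
    (hA : ∀ i k, ∀ x ∈ A, j i (j k x) ∈ A) (hB : ∀ i k, ∀ x ∈ B, j i (j k x) ∈ B)
    (hAiso : ∀ i, ∀ x ∈ A, ∀ y ∈ A, ⟪j i x, y⟫ = 0)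
    (hAK : ∀ x ∈ A, ((List.finRange m).map j).prod x = ε • x)
    (hBK : ∀ x ∈ B, ((List.finRange m).map j).prod x = ε • x)
    (hAne : A ≠ ⊥) (hBne : B ≠ ⊥) :
    ∃ f : Module.End ℝ V, (∀ i x, f (j i x) = j i (f x)) ∧ (∀ x ∈ A, f x ∈ B) ∧
        ∃ a ∈ A, f a ≠ 0 := by
  obtain ⟨b, hbB, hb0⟩ := (Submodule.ne_bot_iff B).mp hBne
  let T : V → Module.End ℝ V := fun a => (innerₛₗ ℝ a).smulRight b
  have hT : ∀ a v, T a v = ⟪a, v⟫ • b := fun a v => by simp [T]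
  let f : V → Module.End ℝ V := fun a => h18Avg j (List.finRange m) (T a)
  have hf : ∀ a v, f a v = ((List.finRange m).sublists'.map fun s =>
      ⟪(s.map j).prod a, v⟫ • (s.map j).prod b).sum := fun a v =>
    h18_avg_apply j h1 (T a) a b (hT a) _ v
  suffices h : ∃ a ∈ A, f a a ≠ 0 by
    obtain ⟨a, ha, hfa⟩ := h
    refine ⟨f a, ?_, ?_, a, ha, hfa⟩
    · intro i x
      exact LinearMap.congr_fun (h18_avg_comm j h2 h3 (T a) (List.finRange m) i (List.mem_finRange i)) x
    · intro x hx
      rw [hf]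
      apply list_sum_mem
      intro y hy
      obtain ⟨s, _, rfl⟩ := List.mem_map.mp hy
      rcases Nat.mod_two_eq_zero_or_one s.length with hs | hs
      · exact B.smul_mem _ (h18_even_mem j B hB s hs b hbB)
      · rw [h18_odd_orth j A hA hAiso s hs a ha x hx]; simp
  by_contra hcon
  push Not at hcon
  set P : Module.End ℝ V := (A.starProjection : V →L[ℝ] V).toLinearMap with hP
  have hPA : ∀ x, P x ∈ A := fun x => A.starProjection_apply_mem x
  have hPid : ∀ x ∈ A, P x = x := fun x hx => Submodule.starProjection_eq_self_iff.mpr hx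
  have hPs : ∀ x y, ⟪P x, y⟫ = ⟪x, P y⟫ := fun x y => Submodule.inner_starProjection_left_eq_right A x y
  let e := stdOrthonormalBasis ℝ V
  -- trace form
  let t : List (Fin m) → ℝ := fun s => ∑ k, ⟪(s.map j).prod (P (e k)), P (e k)⟫
  have ht : ∀ s, t s = LinearMap.trace ℝ V (P * ((s.map j).prod * P)) := by
    intro s
    rw [LinearMap.trace_eq_sum_inner _ e]
    apply Finset.sum_congr rfl
    intro k _
    rw [Module.End.mul_apply, Module.End.mul_apply, ← hPs, real_inner_comm]
  have hsum : ((List.finRange m).sublists'.map fun s => t s * ⟪(s.map j).prod b, b⟫).sum = 0 := by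
    have h0 : ∀ k, ((List.finRange m).sublists'.map fun s =>
        ⟪(s.map j).prod (P (e k)), P (e k)⟫ * ⟪(s.map j).prod b, b⟫).sum = 0 := by
      intro k
      have h := congrArg (fun v => innerₛₗ ℝ b v) ((hf (P (e k)) (P (e k))).symm.trans (hcon _ (hPA (e k))))
      simp only [map_list_sum, List.map_map, map_zero] at h
      rw [← h]
      congr 1
      apply List.map_congr_left
      intro s _
      simp [inner_smul_right, real_inner_comm]
    have h1' : ∀ L : List (List (Fin m)), (L.map fun s => t s * ⟪(s.map j).prod b, b⟫).sum
        = ∑ k, (L.map fun s =>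
          ⟪(s.map j).prod (P (e k)), P (e k)⟫ * ⟪(s.map j).prod b, b⟫).sum := by
      intro L
      induction L with
      | nil => simp
      | cons s L ih =>
        rw [List.map_cons, List.sum_cons, ih]
        simp only [List.map_cons, List.sum_cons, Finset.sum_add_distrib, t, Finset.sum_mul]
    rw [h1']
    exact Finset.sum_eq_zero fun k _ => h0 k
  have hnil : t [] = ∑ k, ‖P (e k)‖ ^ 2 := by
    simp only [t, List.map_nil, List.prod_nil, Module.End.one_apply, real_inner_self_eq_norm_sq]
  have hPg : ∀ i k, P * (j i * j k) = (j i * j k) * P := by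
    intro i k
    ext x
    refine (LinearMap.congr_fun (?_ : P * (j i * j k) = (j i * j k) * P) x)
    ext x
    exact h18_proj_comm A (j i * j k) (j k * j i) (fun u w => by simp [h1]) (hA i k) (hA k i) x
  have hzero : ∀ s, s.Sublist (List.finRange m) → s ≠ [] → s ≠ List.finRange m → t s = 0 := by
    intro s hs hs0 hs1
    rcases Nat.mod_two_eq_zero_or_one s.length with hpar | hpar
    · have hnd : s.Nodup := (List.nodup_finRange m).sublist hs
      obtain ⟨i, hi⟩ := List.exists_mem_of_ne_nil s hs0
      have : ∃ k, k ∉ s := by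
        by_contra hall
        push Not at hall
        apply hs1
        apply hs.eq_of_length_le
        exact (List.nodup_finRange m).length_le_of_subset (fun k _ => hall k)
      obtain ⟨k, hk⟩ := this
      have hik : i ≠ k := fun h => hk (h ▸ hi)
      have hev : (-1 : ℝ) ^ s.length = 1 := Even.neg_one_pow (Nat.even_iff.mpr hpar)
      have c1 := h18_anti_mem j h3 i s hnd hi
      have c2 := h18_anti_not_mem j h3 k s hk
      rw [hev, one_smul] at c1 c2
      set X := (s.map j).prod with hX
      have c3 : X * (j i * j k) = -((j i * j k) * X) := by
        rw [← mul_assoc, c1, neg_mul, mul_assoc, c2, mul_assoc]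
      have c4 : (j i * j k) * (j k * j i) = 1 := by
        rw [mul_assoc, ← mul_assoc (j k), h2]; simp [h2]
      have c5 : (j k * j i) * (j i * j k) = 1 := by
        rw [mul_assoc, ← mul_assoc (j i), h2]; simp [h2]
      have c6 : t s = - t s := by
        rw [ht]
        calc LinearMap.trace ℝ V (P * (X * P))
            = LinearMap.trace ℝ V (((j k * j i) * (j i * j k)) * (P * (X * P))) := by
              rw [c5, one_mul]
          _ = LinearMap.trace ℝ V ((j i * j k) * (P * (X * P)) * (j k * j i)) := by
              rw [mul_assoc, LinearMap.trace_mul_comm]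
          _ = LinearMap.trace ℝ V (-((P * (X * P)) * ((j i * j k) * (j k * j i)))) := by
              congr 1
              rw [← mul_assoc (j i * j k) P, ← hPg, mul_assoc P, ← mul_assoc _ X P,
                ← neg_eq_iff_eq_neg.mpr c3, neg_mul, mul_neg, neg_mul, mul_assoc X _ P, ← hPg]
              simp only [mul_assoc]
          _ = _ := by rw [c4, mul_one, map_neg]
      linarith
    · exact Finset.sum_eq_zero fun k _ =>
        h18_odd_orth j A hA hAiso s hpar _ (hPA _) _ (hPA _)
  have hnn : 0 ≤ t [] := by rw [hnil]; positivity
  have hbb : 0 < ‖b‖ ^ 2 := by positivity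
  have hge : ∀ x ∈ ((List.finRange m).sublists'.map fun s => t s * ⟪(s.map j).prod b, b⟫), 0 ≤ x := by
    intro x hx
    obtain ⟨s, hs, rfl⟩ := List.mem_map.mp hx
    rw [List.mem_sublists'] at hs
    by_cases hs0 : s = []
    · subst hs0
      simp only [List.map_nil, List.prod_nil, Module.End.one_apply, real_inner_self_eq_norm_sq]
      positivity
    by_cases hs1 : s = List.finRange m
    · subst hs1
      have : t (List.finRange m) = ε * t [] := by
        rw [hnil, Finset.mul_sum]
        apply Finset.sum_congr rfl
        intro k _
        rw [hAK _ (hPA _), inner_smul_left, real_inner_self_eq_norm_sq]; simp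
      rw [this, hBK b hbB, inner_smul_left, real_inner_self_eq_norm_sq]
      have h5 : ε * t [] * (ε * ‖b‖ ^ 2) = (ε * ε) * (t [] * ‖b‖ ^ 2) := by ring
      simp only [conj_trivial]
      rw [h5]
      exact mul_nonneg (mul_self_nonneg _) (mul_nonneg hnn hbb.le)
    · simp [hzero s hs hs0 hs1]
  have hle := List.single_le_sum hge (t [] * ⟪(([] : List (Fin m)).map j).prod b, b⟫)
    (List.mem_map.mpr ⟨[], by simp, rfl⟩)
  rw [hsum] at hle
  simp only [List.map_nil, List.prod_nil, Module.End.one_apply, real_inner_self_eq_norm_sq] at hle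
  have ht0 : t [] = 0 := by nlinarith
  rw [hnil, Finset.sum_eq_zero_iff_of_nonneg (fun _ _ => by positivity)] at ht0
  have hP0 : P = 0 := by
    apply e.toBasis.ext
    intro k
    have := ht0 k (Finset.mem_univ k)
    simpa using this
  obtain ⟨a, haA, ha0⟩ := (Submodule.ne_bot_iff A).mp hAne
  apply ha0
  rw [← hPid a haA, hP0]; simp




theorem h18_finrank_map {L : Submodule ℝ V} (S : V →ₗ[ℝ] V) (hS : Function.Injective S) :
    Module.finrank ℝ (L.map S) = Module.finrank ℝ L :=
  (Submodule.equivMapOfInjective S hS L).finrank_eq.symm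

/-- odd operators swap a Lagrangian with its orthogonal complement -/
theorem h18_lag (L : Submodule ℝ V) (hdim : 2 * Module.finrank ℝ L = Module.finrank ℝ V)
    (S : Module.End ℝ V) (hS : S * S = -1) (hiso : ∀ x ∈ L, ∀ y ∈ L, ⟪S x, y⟫ = 0) :
    (∀ x ∈ L, S x ∈ Lᗮ) ∧ (∀ x ∈ Lᗮ, S x ∈ L) := by
  have hSS : ∀ x, S (S x) = -x := fun x => LinearMap.congr_fun hS x
  have hinj : Function.Injective S := by
    intro x y hxy
    have := congrArg S hxy
    rw [hSS, hSS] at this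
    exact neg_injective this
  have ha : ∀ x ∈ L, S x ∈ Lᗮ := by
    intro x hx
    rw [Submodule.mem_orthogonal']
    exact fun y hy => hiso x hx y hy
  refine ⟨ha, ?_⟩
  have hmap : L.map S = Lᗮ := by
    apply Submodule.eq_of_le_of_finrank_eq
    · rintro _ ⟨x, hx, rfl⟩
      exact ha x hx
    · have h1 := L.finrank_add_finrank_orthogonal
      rw [h18_finrank_map S hinj]
      omega
  intro y hy
  rw [← hmap] at hy
  obtain ⟨x, hx, rfl⟩ := hy
  rw [hSS]
  exact L.neg_mem hx

/-- splitting of the dimension under an orthogonal involution -/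
theorem h18_split (L : Submodule ℝ V) (K : Module.End ℝ V) (hKK : ∀ x, K (K x) = x)
    (hKs : ∀ x y, ⟪K x, y⟫ = ⟪x, K y⟫) (hKL : ∀ x ∈ L, K x ∈ L) :
    Module.finrank ℝ (L ⊓ LinearMap.ker (K - LinearMap.id) : Submodule ℝ V)
      + Module.finrank ℝ (L ⊓ LinearMap.ker (K + LinearMap.id) : Submodule ℝ V)
      = Module.finrank ℝ L := by
  have h := Submodule.finrank_add_inf_finrank_orthogonal
    (inf_le_left : L ⊓ LinearMap.ker (K - LinearMap.id) ≤ L)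
  rw [← h]
  have : L ⊓ LinearMap.ker (K + LinearMap.id) =
      (L ⊓ LinearMap.ker (K - LinearMap.id))ᗮ ⊓ L := by
    ext x
    simp only [Submodule.mem_inf, LinearMap.mem_ker, LinearMap.add_apply, LinearMap.id_apply,
      Submodule.mem_orthogonal, LinearMap.sub_apply, sub_eq_zero]
    constructor
    · rintro ⟨hx, hKx⟩
      refine ⟨?_, hx⟩
      rintro u ⟨hu, hKu⟩
      have h1 := hKs u x
      rw [hKu, eq_neg_of_add_eq_zero_left hKx, inner_neg_right] at h1
      linarith
    · rintro ⟨hx, hxL⟩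
      refine ⟨hxL, ?_⟩
      have h1 := hx (K x + x) ⟨L.add_mem (hKL x hxL) hxL, by rw [map_add, hKK, add_comm]⟩
      have h2 : ⟪K x + x, K x⟫ = 0 := by
        rw [← hKs, map_add, hKK, add_comm]; exact h1
      rw [← inner_self_eq_zero (𝕜 := ℝ), inner_add_right, h1, h2, add_zero]
  rw [this]

end H18

theorem stmt_18 {V : Type*} [NormedAddCommGroup V] [InnerProductSpace ℝ V]
    [FiniteDimensional ℝ V] {m : ℕ} (hm : 1 ≤ m)
    (J : EuclideanSpace ℝ (Fin m) →ₗ[ℝ] V →ₗ[ℝ] V)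
    (hskew : ∀ (z : EuclideanSpace ℝ (Fin m)) (u w : V), ⟪J z u, w⟫ = -⟪u, J z w⟫)
    (hsq : ∀ (z : EuclideanSpace ℝ (Fin m)) (u : V), J z (J z u) = -(‖z‖ ^ 2) • u)
    (bra : V → V → EuclideanSpace ℝ (Fin m))
    (hbra : ∀ (z : EuclideanSpace ℝ (Fin m)) (u w : V), ⟪z, bra u w⟫ = ⟪J z u, w⟫)
    (h4 : m % 4 = 0) (K : V →ₗ[ℝ] V)
    (hK : K = (List.ofFn fun i : Fin m => J (stdBasis m i)).prod)
    (L L' : Submodule ℝ V) (hL : LagrangianSub bra L) (hL' : LagrangianSub bra L') :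
    (∃ ψ : V ≃ₗᵢ[ℝ] V,
      (∀ (z : EuclideanSpace ℝ (Fin m)) (v : V), ψ (J z v) = J z (ψ v)) ∧
      L.map ψ.toLinearEquiv.toLinearMap = L') ↔
    Module.finrank ℝ (L ⊓ LinearMap.ker (K - LinearMap.id) : Submodule ℝ V) =
      Module.finrank ℝ (L' ⊓ LinearMap.ker (K - LinearMap.id) : Submodule ℝ V) := by
  set j : Fin m → Module.End ℝ V := fun i => J (stdBasis m i) with hj
  have hnorm : ∀ i, ‖stdBasis m i‖ = 1 := fun i => by simp [stdBasis]
  have h1 : ∀ i u w, ⟪j i u, w⟫ = -⟪u, j i w⟫ := fun i u w => hskew _ u w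
  have hjj : ∀ i x, j i (j i x) = -x := by
    intro i x
    have := hsq (stdBasis m i) x
    rw [hnorm] at this
    simpa using this
  have h2 : ∀ i, j i * j i = -1 := by
    intro i
    apply LinearMap.ext
    intro x
    exact hjj i x
  have h3 : ∀ i k, i ≠ k → j i * j k = -(j k * j i) := by
    intro i k hik
    apply LinearMap.ext
    intro x
    have ho : ⟪stdBasis m i, stdBasis m k⟫ = 0 := by
      simp [stdBasis, EuclideanSpace.inner_single_left, hik]
    have hn : ‖stdBasis m i + stdBasis m k‖ ^ 2 = 2 := by
      have := norm_add_sq_eq_norm_sq_add_norm_sq_of_inner_eq_zero _ _ ho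
      rw [hnorm, hnorm] at this
      rw [sq, this]; norm_num
    have h := hsq (stdBasis m i + stdBasis m k) x
    rw [hn] at h
    simp only [map_add, LinearMap.add_apply] at h
    have e1 : J (stdBasis m i) (J (stdBasis m i) x) = -x := hjj i x
    have e2 : J (stdBasis m k) (J (stdBasis m k) x) = -x := hjj k x
    rw [e1, e2] at h
    change J (stdBasis m i) (J (stdBasis m k) x) = -(J (stdBasis m k) (J (stdBasis m i) x))
    have e3 : J (stdBasis m i) (J (stdBasis m k) x) + J (stdBasis m k) (J (stdBasis m i) x)
        = (-x + J (stdBasis m k) (J (stdBasis m i) x) + (J (stdBasis m i) (J (stdBasis m k) x) + -x))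
          + (2 : ℝ) • x := by
      rw [two_smul]; abel
    rw [eq_neg_iff_add_eq_zero, e3]
    have e4 : (-x + J (stdBasis m k) (J (stdBasis m i) x)
        + (J (stdBasis m i) (J (stdBasis m k) x) + -x)) = -(2 : ℝ) • x := by
      rw [← h]; try abel
    rw [e4, ← add_smul]; simp
  have hKl : K = ((List.finRange m).map j).prod := by
    rw [hK, List.ofFn_eq_map]
  have hlen : ((List.finRange m)).length = m := List.length_finRange
  have hKK : ∀ x, K (K x) = x := by
    have h := h18_sq j h2 h3 (List.finRange m) (List.nodup_finRange m)
    have hev : Even (∑ t ∈ Finset.range (m + 1), t) := by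
      obtain ⟨r, hr⟩ : ∃ r, m = 4 * r := ⟨m / 4, by omega⟩
      have h5 := Finset.sum_range_id_mul_two (m + 1)
      rw [Nat.add_sub_cancel, hr] at h5
      refine ⟨(4 * r + 1) * r, ?_⟩
      rw [hr]
      nlinarith
    rw [hlen, ← hKl, hev.neg_one_pow] at h
    intro x
    simpa using LinearMap.congr_fun h x
  have hjn : ∀ i u w, ⟪j i u, j i w⟫ = ⟪u, w⟫ := by
    intro i u w
    rw [h1, hjj, inner_neg_right, neg_neg]
  have hKn : ∀ u w, ⟪K u, K w⟫ = ⟪u, w⟫ := by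
    have : ∀ (l : List (Fin m)) (u w : V), ⟪(l.map j).prod u, (l.map j).prod w⟫ = ⟪u, w⟫ := by
      intro l
      induction l with
      | nil => simp
      | cons i l ih => intro u w; simp [hjn, ih]
    rw [hKl]; exact this _
  have hKs : ∀ x y, ⟪K x, y⟫ = ⟪x, K y⟫ := by
    intro x y
    rw [← hKn, hKK]
  have hKj : ∀ i x, K (j i x) = -(j i (K x)) := by
    intro i x
    have h := h18_anti_mem j h3 i (List.finRange m) (List.nodup_finRange m) (List.mem_finRange i)
    rw [hlen, ← hKl, Even.neg_one_pow (Nat.even_iff.mpr (by omega)), one_smul] at h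
    exact LinearMap.congr_fun h x
  have hiso : ∀ M : Submodule ℝ V, LagrangianSub bra M → ∀ i, ∀ x ∈ M, ∀ y ∈ M, ⟪j i x, y⟫ = 0 := by
    intro M hM i x hx y hy
    have := hbra (stdBasis m i) x y
    rw [hM.1 x hx y hy, inner_zero_right] at this
    exact this.symm
  have hswap : ∀ M : Submodule ℝ V, LagrangianSub bra M → ∀ i,
      (∀ x ∈ M, j i x ∈ Mᗮ) ∧ (∀ x ∈ Mᗮ, j i x ∈ M) := fun M hM i =>
    h18_lag M hM.2 (j i) (h2 i) (hiso M hM i)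
  have heven : ∀ M : Submodule ℝ V, LagrangianSub bra M → ∀ i k, ∀ x ∈ M, j i (j k x) ∈ M :=
    fun M hM i k x hx => (hswap M hM i).2 _ ((hswap M hM k).1 x hx)
  have hKM : ∀ M : Submodule ℝ V, LagrangianSub bra M → ∀ x ∈ M, K x ∈ M := by
    intro M hM x hx
    rw [hKl]
    exact h18_even_mem j M (heven M hM) _ (by rw [hlen]; omega) x hx
  constructor
  · rintro ⟨ψ, hψ, rfl⟩
    have hψl : ∀ (l : List (Fin m)) (x : V), ψ ((l.map j).prod x) = (l.map j).prod (ψ x) := by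
      intro l
      induction l with
      | nil => simp
      | cons i l ih =>
        intro x
        simp only [List.map_cons, List.prod_cons, Module.End.mul_apply]
        rw [← ih]
        exact hψ _ _
    have hψK : ∀ x, ψ (K x) = K (ψ x) := by rw [hKl]; exact hψl _
    have heq : (L.map ψ.toLinearEquiv.toLinearMap ⊓ LinearMap.ker (K - LinearMap.id) : Submodule ℝ V)
        = (L ⊓ LinearMap.ker (K - LinearMap.id)).map ψ.toLinearEquiv.toLinearMap := by
      ext y
      simp only [Submodule.mem_inf, Submodule.mem_map, LinearMap.mem_ker, LinearMap.sub_apply,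
        LinearMap.id_apply, sub_eq_zero]
      constructor
      · rintro ⟨⟨x, hx, rfl⟩, hy⟩
        refine ⟨x, ⟨hx, ?_⟩, rfl⟩
        apply ψ.injective
        rw [hψK]; exact hy
      · rintro ⟨x, ⟨hx, hKx⟩, rfl⟩
        refine ⟨⟨x, hx, rfl⟩, ?_⟩
        have := hψK x
        rw [hKx] at this
        exact this.symm
    rw [heq]
    exact (h18_finrank_map _ ψ.injective).symm
  · intro hfin
    have hs1 := h18_split L K hKK hKs (hKM L hL)
    have hs2 := h18_split L' K hKK hKs (hKM L' hL')
    have hd1 := hL.2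
    have hd2 := hL'.2
    have hKe : ∀ i k x, K (j i (j k x)) = j i (j k (K x)) := by
      intro i k x
      rw [hKj, hKj, map_neg, neg_neg]
    -- the two eigenspace pieces
    have piece : ∀ (ε : ℝ) (W : Submodule ℝ V), (∀ x, x ∈ W ↔ K x = ε • x) →
        Module.finrank ℝ (L ⊓ W : Submodule ℝ V) = Module.finrank ℝ (L' ⊓ W : Submodule ℝ V) →
        ∃ F : Module.End ℝ V, (∀ i k x, F (j i (j k x)) = j i (j k (F x))) ∧
          (∀ x ∈ L ⊓ W, F x ∈ L' ⊓ W) ∧ ∀ x ∈ L ⊓ W, ‖F x‖ = ‖x‖ := by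
      intro ε W hW hd
      have hWi : ∀ i k, ∀ x ∈ W, j i (j k x) ∈ W := by
        intro i k x hx
        rw [hW, hKe, (hW x).mp hx, map_smul, map_smul]
      obtain ⟨F, hF1, hF2, hF3⟩ := h18_main (fun p : Fin m × Fin m => j p.1 * j p.2) Prod.swap
        (fun k u w => by simp [h1]) (fun k u w => by simp [h1]) (L ⊓ W) (L' ⊓ W)
        (by
          intro A B hA hB hAi hBi hAne hBne
          obtain ⟨f, f1, f2, f3⟩ := h18_exists j h1 h2 h3 ε A B
            (fun i k x hx => hAi (i, k) x hx) (fun i k x hx => hBi (i, k) x hx)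
            (fun i x hx y hy => hiso L hL i x (hA hx).1 y (hA hy).1)
            (fun x hx => by rw [← hKl]; exact (hW x).mp (hA hx).2)
            (fun x hx => by rw [← hKl]; exact (hW x).mp (hB hx).2) hAne hBne
          refine ⟨f, ?_, f2, f3⟩
          intro k x
          simp only [Module.End.mul_apply, f1])
        _ (L ⊓ W) (L' ⊓ W) rfl hd.symm le_rfl le_rfl
        (fun p x hx => ⟨heven L hL _ _ x hx.1, hWi _ _ x hx.2⟩)
        (fun p x hx => ⟨heven L' hL' _ _ x hx.1, hWi _ _ x hx.2⟩)
      exact ⟨F, fun i k x => hF1 (i, k) x, hF2, hF3⟩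
    obtain ⟨F, hF1, hF2, hF3⟩ := piece 1 (LinearMap.ker (K - LinearMap.id))
      (fun x => by simp [LinearMap.mem_ker, sub_eq_zero]) hfin
    obtain ⟨G, hG1, hG2, hG3⟩ := piece (-1) (LinearMap.ker (K + LinearMap.id))
      (fun x => by simp [LinearMap.mem_ker, add_eq_zero_iff_eq_neg]) (by omega)
    have hp : ∀ x ∈ L, (1 / 2 : ℝ) • (x + K x) ∈ L ⊓ LinearMap.ker (K - LinearMap.id) := by
      intro x hx
      refine ⟨L.smul_mem _ (L.add_mem hx (hKM L hL x hx)), ?_⟩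
      change (K - LinearMap.id : V →ₗ[ℝ] V) _ = 0
      simp only [LinearMap.sub_apply, LinearMap.id_apply, map_smul, map_add, hKK]
      rw [sub_add_sub_cancel, sub_self, smul_zero]
    have hq : ∀ x ∈ L, (1 / 2 : ℝ) • (x - K x) ∈ L ⊓ LinearMap.ker (K + LinearMap.id) := by
      intro x hx
      refine ⟨L.smul_mem _ (L.sub_mem hx (hKM L hL x hx)), ?_⟩
      change (K + LinearMap.id : V →ₗ[ℝ] V) _ = 0
      simp only [LinearMap.add_apply, LinearMap.id_apply, map_smul, map_sub, hKK]
      rw [add_comm x, sub_self, smul_zero]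
    have hpm : ∀ u ∈ LinearMap.ker (K - LinearMap.id), ∀ w ∈ LinearMap.ker (K + LinearMap.id),
        ⟪u, w⟫ = 0 := by
      intro u hu w hw
      simp only [LinearMap.mem_ker, LinearMap.sub_apply, LinearMap.add_apply, LinearMap.id_apply,
        sub_eq_zero] at hu hw
      have h := hKs u w
      rw [hu, eq_neg_of_add_eq_zero_left hw, inner_neg_right] at h
      linarith
    let g : Module.End ℝ V := F * ((1 / 2 : ℝ) • (1 + K)) + G * ((1 / 2 : ℝ) • (1 - K))
    have hg : ∀ x, g x = F ((1 / 2 : ℝ) • (x + K x)) + G ((1 / 2 : ℝ) • (x - K x)) := fun x => rfl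
    have hge : ∀ i k x, g (j i (j k x)) = j i (j k (g x)) := by
      intro i k x
      simp only [hg, hKe, map_smul, map_add, map_sub, hF1, hG1]
    have hgL : ∀ x ∈ L, g x ∈ L' := fun x hx =>
      L'.add_mem (hF2 _ (hp x hx)).1 (hG2 _ (hq x hx)).1
    have hgn : ∀ x ∈ L, ‖g x‖ * ‖g x‖ = ‖x‖ * ‖x‖ := by
      intro x hx
      have e1 := norm_add_sq_eq_norm_sq_add_norm_sq_of_inner_eq_zero _ _
        (hpm _ (hF2 _ (hp x hx)).2 _ (hG2 _ (hq x hx)).2)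
      have e2 := norm_add_sq_eq_norm_sq_add_norm_sq_of_inner_eq_zero _ _
        (hpm _ (hp x hx).2 _ (hq x hx).2)
      have e3 : (1 / 2 : ℝ) • (x + K x) + (1 / 2 : ℝ) • (x - K x) = x := by
        rw [← smul_add, add_add_sub_cancel, ← two_smul ℝ, smul_smul]; norm_num
      rw [hF3 _ (hp x hx), hG3 _ (hq x hx), ← e2, e3, ← hg] at e1
      exact e1
    let i₀ : Fin m := ⟨0, hm⟩
    set P : Module.End ℝ V := (L.starProjection : V →L[ℝ] V).toLinearMap with hP
    have hPL : ∀ x, P x ∈ L := fun x => L.starProjection_apply_mem x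
    have hPo : ∀ x, x - P x ∈ Lᗮ := fun x => L.sub_starProjection_mem_orthogonal x
    have hPid : ∀ x ∈ L, P x = x := fun x hx => Submodule.starProjection_eq_self_iff.mpr hx
    have hP0 : ∀ x ∈ Lᗮ, P x = 0 := fun x hx =>
      (Submodule.starProjection_apply_eq_zero_iff L).mpr hx
    let Ψ : Module.End ℝ V := g * P - j i₀ * (g * (j i₀ * (1 - P)))
    have hΨ : ∀ x, Ψ x = g (P x) - j i₀ (g (j i₀ (x - P x))) := fun x => rfl
    have hΨL : ∀ x ∈ L, Ψ x = g x := by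
      intro x hx
      rw [hΨ, hPid x hx]; simp
    have hΨo : ∀ x ∈ Lᗮ, Ψ x = -(j i₀ (g (j i₀ x))) := by
      intro x hx
      rw [hΨ, hP0 x hx]; simp
    have hΨj : ∀ i x, Ψ (j i x) = j i (Ψ x) := by
      intro i x
      have a1 : ∀ x ∈ L, Ψ (j i x) = j i (Ψ x) := by
        intro x hx
        rw [hΨo _ ((hswap L hL i).1 x hx), hΨL x hx, hge, hjj, neg_neg]
      have a2 : ∀ x ∈ Lᗮ, Ψ (j i x) = j i (Ψ x) := by
        intro x hx
        rw [hΨL _ ((hswap L hL i).2 x hx), hΨo x hx, map_neg, ← hge, hjj, map_neg, map_neg, neg_neg]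
      have e : x = P x + (x - P x) := by abel
      rw [e]
      simp only [map_add]
      rw [a1 _ (hPL x), a2 _ (hPo x)]
    have hjnorm : ∀ i x, ‖j i x‖ * ‖j i x‖ = ‖x‖ * ‖x‖ := by
      intro i x
      rw [← real_inner_self_eq_norm_mul_norm, hjn, real_inner_self_eq_norm_mul_norm]
    have hΨn : ∀ x, ‖Ψ x‖ = ‖x‖ := by
      intro x
      have b1 : j i₀ (x - P x) ∈ L := (hswap L hL i₀).2 _ (hPo x)
      have b2 : -(j i₀ (g (j i₀ (x - P x)))) ∈ L'ᗮ :=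
        L'ᗮ.neg_mem ((hswap L' hL' i₀).1 _ (hgL _ b1))
      have e1 := norm_add_sq_eq_norm_sq_add_norm_sq_of_inner_eq_zero _ _
        ((Submodule.mem_orthogonal _ _).mp b2 _ (hgL _ (hPL x)))
      have e2 := norm_add_sq_eq_norm_sq_add_norm_sq_of_inner_eq_zero _ _
        ((Submodule.mem_orthogonal _ _).mp (hPo x) _ (hPL x))
      rw [norm_neg, hjnorm, hgn _ (hPL x), hgn _ b1, hjnorm, ← e2, ← sub_eq_add_neg, ← hΨ,
        add_sub_cancel] at e1
      exact (mul_self_inj_of_nonneg (norm_nonneg _) (norm_nonneg x)).mp e1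
    let li : V →ₗᵢ[ℝ] V := ⟨Ψ, hΨn⟩
    let ψ : V ≃ₗᵢ[ℝ] V := li.toLinearIsometryEquiv rfl
    have hψ : ∀ x, ψ x = Ψ x := fun x => rfl
    refine ⟨ψ, ?_, ?_⟩
    · intro z v
      have hz : z = ∑ i, z i • stdBasis m i := by
        have := (EuclideanSpace.basisFun (Fin m) ℝ).sum_repr z
        simpa [stdBasis] using this.symm
      rw [hψ, hψ, hz]
      simp only [map_sum, map_smul, LinearMap.sum_apply, LinearMap.smul_apply]
      apply Finset.sum_congr rfl
      intro i _
      congr 1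
      exact hΨj i v
    · apply Submodule.eq_of_le_of_finrank_eq
      · rintro _ ⟨x, hx, rfl⟩
        have : Ψ x ∈ L' := by rw [hΨL x hx]; exact hgL x hx
        exact this
      · rw [h18_finrank_map _ ψ.injective]
        omega
end
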